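/- Assume Ω is connected. Then for all p, q ∈ Ω the Kobayashi pseudodistance coincides with the integrated Kobayashi–Royden pseudodistance: d_Ω(p,q) = d̄_Ω(p,q). -/

import Mathlib

open Metric Set Filter
open scoped ENNReal Topology

noncomputable section

abbrev Cn (n : ℕ) := EuclideanSpace ℂ (Fin n)

def IsAlmostComplexOn (n : ℕ) (Ω : Set (Cn n)) (J : Cn n → (Cn n →L[ℝ] Cn n)) : Prop :=
  ContDiffOn ℝ (⊤ : ℕ∞) J Ω ∧
    ∀ x ∈ Ω, (J x).comp (J x) = -ContinuousLinearMap.id ℝ (Cn n)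

def IsJHolomorphicOn (n : ℕ) (Ω : Set (Cn n)) (J : Cn n → (Cn n →L[ℝ] Cn n))
    (R : ℝ) (f : ℂ → Cn n) : Prop :=
  MapsTo f (ball (0:ℂ) R) Ω ∧
    ∀ z ∈ ball (0:ℂ) R, DifferentiableAt ℝ f z ∧
      ∀ ξ : ℂ, fderiv ℝ f z (Complex.I * ξ) = J (f z) (fderiv ℝ f z ξ)

def kobayashiRoyden (n : ℕ) (Ω : Set (Cn n)) (J : Cn n → (Cn n →L[ℝ] Cn n))
    (p v : Cn n) : ℝ≥0∞ :=
  sInf {c : ℝ≥0∞ | ∃ r : ℝ, 0 < r ∧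
    (∃ f : ℂ → Cn n, IsJHolomorphicOn n Ω J 1 f ∧ f 0 = p ∧ fderiv ℝ f 0 1 = r • v) ∧
    c = ENNReal.ofReal (1 / r)}

/-- The inverse hyperbolic tangent, `arctanh x = ½ log((1 + x)/(1 - x))`. -/
def arctanh (x : ℝ) : ℝ := (1 / 2) * Real.log ((1 + x) / (1 - x))

/-- The Poincaré distance on the unit disc. -/
def poincareDist (z w : ℂ) : ℝ :=
  arctanh (‖z - w‖ / ‖1 - (starRingEnd ℂ) z * w‖)

/-- The Kobayashi pseudodistance `d_Ω(p, q)` of the almost complex manifold `(Ω, J)`. -/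
def kobayashiDist (n : ℕ) (Ω : Set (Cn n)) (J : Cn n → (Cn n →L[ℝ] Cn n))
    (p q : Cn n) : ℝ≥0∞ :=
  sInf {c : ℝ≥0∞ | ∃ m : ℕ, ∃ z w : Fin (m + 1) → ℂ, ∃ f : Fin (m + 1) → ℂ → Cn n,
    (∀ k, z k ∈ ball (0:ℂ) 1 ∧ w k ∈ ball (0:ℂ) 1 ∧ IsJHolomorphicOn n Ω J 1 (f k)) ∧
    f 0 (z 0) = p ∧
    (∀ k : Fin m, f k.castSucc (w k.castSucc) = f k.succ (z k.succ)) ∧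
    f (Fin.last m) (w (Fin.last m)) = q ∧
    c = ENNReal.ofReal (∑ k, poincareDist (z k) (w k))}

/-- `γ` is a piecewise continuously differentiable path in `Ω`, parametrized by `[0,1]`. -/
def IsPiecewiseC1PathIn (n : ℕ) (Ω : Set (Cn n)) (γ : ℝ → Cn n) : Prop :=
  ContinuousOn γ (Icc (0:ℝ) 1) ∧ MapsTo γ (Icc (0:ℝ) 1) Ω ∧
    ∃ (k : ℕ) (t : Fin (k + 1) → ℝ), StrictMono t ∧ t 0 = 0 ∧ t (Fin.last k) = 1 ∧
      ∀ i : Fin k, ContDiffOn ℝ 1 γ (Icc (t i.castSucc) (t i.succ))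

/-- The Kobayashi–Royden length `∫₀¹ F_Ω(γ(t), γ′(t)) dt` of a path. -/
def kobayashiRoydenLength (n : ℕ) (Ω : Set (Cn n)) (J : Cn n → (Cn n →L[ℝ] Cn n))
    (γ : ℝ → Cn n) : ℝ≥0∞ :=
  ∫⁻ t in Icc (0:ℝ) 1, kobayashiRoyden n Ω J (γ t) (deriv γ t)

/-- The integrated Kobayashi–Royden pseudodistance `d̄_Ω(p, q)`. -/
def integratedKRDist (n : ℕ) (Ω : Set (Cn n)) (J : Cn n → (Cn n →L[ℝ] Cn n))
    (p q : Cn n) : ℝ≥0∞ :=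
  ⨅ γ : {γ : ℝ → Cn n // IsPiecewiseC1PathIn n Ω γ ∧ γ 0 = p ∧ γ 1 = q},
    kobayashiRoydenLength n Ω J γ

section Helpers

theorem pa_deriv {E : Type*} [NormedAddCommGroup E] [NormedSpace ℝ E] [FiniteDimensional ℝ E]
    {f : ℂ → E} {A : ℂ → E →L[ℝ] E} {z0 : ℂ} {R K K0 L : ℝ}
    (hK : 0 ≤ K) (hL : 0 ≤ L)
    (hd : ∀ z ∈ ball z0 R, DifferentiableAt ℝ f z)
    (hA : ∀ z ∈ ball z0 R, ∀ ξ : ℂ, fderiv ℝ f z (Complex.I * ξ) = A z (fderiv ℝ f z ξ))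
    (hA2 : ∀ v, A z0 (A z0 v) = -v) (hA0 : ‖A z0‖ ≤ K0)
    (hAK : ∀ z ∈ ball z0 R, ‖A z - A z0‖ ≤ K * ‖f z - f z0‖)
    (hDL : ∀ z ∈ ball z0 R, ‖fderiv ℝ f z‖ ≤ L) (r : ℝ) (hr : 0 < r) (hrR : r < R) :
    ∃ N' : E, HasDerivAt (fun r : ℝ => ∫ θ in (0:ℝ)..(2 * Real.pi),
      (Real.cos θ • f (z0 + r * Complex.exp (θ * Complex.I))
        - Real.sin θ • A z0 (f (z0 + r * Complex.exp (θ * Complex.I))))) N' r ∧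
      ‖r • N' - ∫ θ in (0:ℝ)..(2 * Real.pi),
      (Real.cos θ • f (z0 + r * Complex.exp (θ * Complex.I))
        - Real.sin θ • A z0 (f (z0 + r * Complex.exp (θ * Complex.I))))‖
        ≤ 2 * Real.pi * ((1 + K0) * K * L ^ 2) * r ^ 2 := by
  borelize E
  have hK0 : 0 ≤ K0 := (norm_nonneg _).trans hA0
  set e : ℝ → ℂ := fun θ => Complex.exp (θ * Complex.I) with he
  have hec : Continuous e := by fun_prop
  have hen : ∀ θ, ‖e θ‖ = 1 := fun θ => Complex.norm_exp_ofReal_mul_I θ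
  have hmem : ∀ s θ : ℝ, |s| < R → z0 + s * e θ ∈ ball z0 R := by
    intro s θ hs
    simp [mem_ball, dist_eq_norm, hen, hs]
  have hde : ∀ θ, HasDerivAt e (Complex.I * e θ) θ := by
    intro θ
    have h1 : HasDerivAt (fun θ : ℝ => (θ : ℂ) * Complex.I) (1 * Complex.I) θ :=
      (Complex.ofRealCLM.hasDerivAt (x := θ)).mul_const Complex.I
    have := h1.cexp
    convert this using 1
    simp only [he]; ring
  have hfc : ∀ s : ℝ, |s| < R → Continuous (fun θ => f (z0 + s * e θ)) := by
    intro s hs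
    rw [continuous_iff_continuousAt]
    intro θ
    exact ContinuousAt.comp (g := f) (f := fun θ => z0 + s * e θ)
      (hd _ (hmem s θ hs)).continuousAt (by fun_prop)
  have hmeas : Measurable (fun z => fderiv ℝ f z) := measurable_fderiv ℝ f
  set cr : ℝ → ℝ → E := fun s θ => fderiv ℝ f (z0 + s * e θ) (e θ) with hcr
  have hcrL : ∀ s θ : ℝ, |s| < R → ‖cr s θ‖ ≤ L := by
    intro s θ hs
    calc ‖cr s θ‖ ≤ ‖fderiv ℝ f (z0 + s * e θ)‖ * ‖e θ‖ := ContinuousLinearMap.le_opNorm _ _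
      _ ≤ L := by rw [hen, mul_one]; exact hDL _ (hmem s θ hs)
  have hcrm : ∀ s, Measurable (cr s) := by
    intro s
    have h1 : Measurable (fun θ => fderiv ℝ f (z0 + s * e θ)) :=
      hmeas.comp (by fun_prop : Continuous fun θ => z0 + s * e θ).measurable
    have h2 : Continuous (fun p : (ℂ →L[ℝ] E) × ℂ => p.1 p.2) := by fun_prop
    exact h2.measurable.comp (h1.prodMk hec.measurable)
  have hdr : ∀ s θ : ℝ, |s| < R → HasDerivAt (fun s : ℝ => f (z0 + s * e θ)) (cr s θ) s := by
    intro s θ hs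
    have h1 : HasDerivAt (fun s : ℝ => z0 + (s:ℂ) * e θ) (1 * e θ) s :=
      ((Complex.ofRealCLM.hasDerivAt (x := s)).mul_const (e θ)).const_add z0
    have := (hd _ (hmem s θ hs)).hasFDerivAt.comp_hasDerivAt s h1
    rw [one_mul] at this
    exact this
  have hdθ : ∀ s θ : ℝ, |s| < R →
      HasDerivAt (fun θ : ℝ => f (z0 + s * e θ)) (s • A (z0 + s * e θ) (cr s θ)) θ := by
    intro s θ hs
    have h1 : HasDerivAt (fun θ : ℝ => z0 + (s:ℂ) * e θ) ((s:ℂ) * (Complex.I * e θ)) θ :=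
      ((hde θ).const_mul (s:ℂ)).const_add z0
    have := (hd _ (hmem s θ hs)).hasFDerivAt.comp_hasDerivAt θ h1
    refine HasDerivAt.congr_deriv (f := fun θ : ℝ => f (z0 + s * e θ)) this ?_
    have h2 : (s:ℂ) * (Complex.I * e θ) = s • (Complex.I * e θ) := Complex.real_smul.symm
    rw [h2, map_smul, hA _ (hmem s θ hs)]
  set W : ℝ → E →L[ℝ] E := fun θ => Real.cos θ • ContinuousLinearMap.id ℝ E - Real.sin θ • A z0 with hW
  have hWc : Continuous W := by fun_prop
  have hWn : ∀ θ, ‖W θ‖ ≤ 1 + K0 := by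
    intro θ
    calc ‖W θ‖ ≤ ‖Real.cos θ • ContinuousLinearMap.id ℝ E‖ + ‖Real.sin θ • A z0‖ := norm_sub_le _ _
      _ ≤ 1 * 1 + 1 * K0 := by
        rw [norm_smul, norm_smul]
        gcongr
        · exact Real.abs_cos_le_one θ
        · exact ContinuousLinearMap.norm_id_le
        · exact Real.abs_sin_le_one θ
      _ = _ := by ring
  set V : ℝ → E →L[ℝ] E := fun θ => Real.sin θ • ContinuousLinearMap.id ℝ E + Real.cos θ • A z0 with hV
  have hVn : ∀ θ, ‖V θ‖ ≤ 1 + K0 := by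
    intro θ
    calc ‖V θ‖ ≤ ‖Real.sin θ • ContinuousLinearMap.id ℝ E‖ + ‖Real.cos θ • A z0‖ := norm_add_le _ _
      _ ≤ 1 * 1 + 1 * K0 := by
        rw [norm_smul, norm_smul]
        gcongr
        · exact Real.abs_sin_le_one θ
        · exact ContinuousLinearMap.norm_id_le
        · exact Real.abs_cos_le_one θ
      _ = _ := by ring
  have hVd : ∀ θ, HasDerivAt V (W θ) θ := by
    intro θ
    have := ((Real.hasDerivAt_sin θ).smul_const (ContinuousLinearMap.id ℝ E)).add
      ((Real.hasDerivAt_cos θ).smul_const (A z0))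
    refine HasDerivAt.congr_deriv (f := V) this ?_
    simp only [hW, neg_smul, sub_eq_add_neg]
  have hVW : ∀ θ v, W θ v = - V θ (A z0 v) := by
    intro θ v
    simp [hV, hW, hA2]
    abel
  have hmainR : ∀ᶠ s in 𝓝 r, |s| < R := by
    have : |r| < R := by rw [abs_of_pos hr]; exact hrR
    exact (continuous_abs.tendsto r).eventually (gt_mem_nhds this)
  have hrR' : |r| < R := by rw [abs_of_pos hr]; exact hrR
  have hrew : (fun r : ℝ => ∫ θ in (0:ℝ)..(2 * Real.pi),
      (Real.cos θ • f (z0 + r * e θ) - Real.sin θ • A z0 (f (z0 + r * e θ)))) =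
      fun r : ℝ => ∫ θ in (0:ℝ)..(2 * Real.pi), W θ (f (z0 + r * e θ)) := by
    funext s; simp [hW]
  have hrew' := congrFun hrew r
  change ∃ N', HasDerivAt (fun r : ℝ => ∫ θ in (0:ℝ)..(2 * Real.pi),
      (Real.cos θ • f (z0 + r * e θ) - Real.sin θ • A z0 (f (z0 + r * e θ)))) N' r ∧ ‖r • N' - ∫ θ in (0:ℝ)..(2 * Real.pi),
      (Real.cos θ • f (z0 + r * e θ) - Real.sin θ • A z0 (f (z0 + r * e θ)))‖ ≤ _
  rw [hrew, hrew']
  have key := intervalIntegral.hasDerivAt_integral_of_dominated_loc_of_deriv_le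
    (μ := MeasureTheory.volume) (a := (0:ℝ)) (b := 2 * Real.pi)
    (F := fun (s : ℝ) θ => W θ (f (z0 + s * e θ))) (F' := fun s θ => W θ (cr s θ)) (x₀ := r)
    (bound := fun _ => (1 + K0) * L) (s := {s : ℝ | |s| < R}) hmainR
    (by
      filter_upwards [hmainR] with s hs
      exact (hWc.clm_apply (hfc s hs)).aestronglyMeasurable)
    ((hWc.clm_apply (hfc r hrR')).intervalIntegrable _ _)
    (by
      have h2 : Continuous (fun p : (E →L[ℝ] E) × E => p.1 p.2) := by fun_prop
      exact (h2.measurable.comp (hWc.measurable.prodMk (hcrm r))).aestronglyMeasurable)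
    (by
      refine Eventually.of_forall fun θ _ s hs => ?_
      exact (ContinuousLinearMap.le_opNorm _ _).trans
        (mul_le_mul (hWn θ) (hcrL s θ hs) (norm_nonneg _) (by linarith)))
    (by simp)
    (by
      refine Eventually.of_forall fun θ _ s hs => ?_
      exact (W θ).hasFDerivAt.comp_hasDerivAt s (hdr s θ hs))
  refine ⟨_, key.2, ?_⟩
  have hint1 := key.1
  have hWf : IntervalIntegrable (fun θ => W θ (f (z0 + r * e θ))) MeasureTheory.volume 0 (2 * Real.pi) :=
    (hWc.clm_apply (hfc r hrR')).intervalIntegrable _ _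
  have hder : ∀ θ, HasDerivAt (fun θ => V θ (f (z0 + r * e θ)))
      (W θ (f (z0 + r * e θ)) + V θ (r • A (z0 + r * e θ) (cr r θ))) θ := fun θ =>
    (hVd θ).clm_apply (hdθ r θ hrR')
  have hVc : Continuous V := by fun_prop
  have hm2 : MeasureTheory.AEStronglyMeasurable (fun θ => V θ (r • A (z0 + r * e θ) (cr r θ)))
      (MeasureTheory.volume.restrict (uIoc 0 (2 * Real.pi))) := by
    have h1 : Measurable (deriv (fun θ : ℝ => f (z0 + r * e θ))) := measurable_deriv _
    have h3 : deriv (fun θ : ℝ => f (z0 + r * e θ)) = fun θ => r • A (z0 + r * e θ) (cr r θ) :=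
      funext fun θ => (hdθ r θ hrR').deriv
    rw [h3] at h1
    have h2 : Continuous (fun p : (E →L[ℝ] E) × E => p.1 p.2) := by fun_prop
    exact (h2.measurable.comp (hVc.measurable.prodMk h1)).aestronglyMeasurable
  have hAn : ∀ θ, ‖A (z0 + r * e θ) - A z0‖ ≤ K * (L * r) := by
    intro θ
    refine (hAK _ (hmem r θ hrR')).trans ?_
    gcongr
    have hconv : Convex ℝ (ball z0 R) := convex_ball _ _
    have := hconv.norm_image_sub_le_of_norm_fderiv_le (𝕜 := ℝ) (f := f) (C := L)
      (fun z hz => hd z hz) hDL (mem_ball_self (hr.trans hrR)) (hmem r θ hrR')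
    simpa [hen, abs_of_pos hr] using this
  have hm2i : IntervalIntegrable (fun θ => V θ (r • A (z0 + r * e θ) (cr r θ)))
      MeasureTheory.volume 0 (2 * Real.pi) := by
    refine IntervalIntegrable.mono_fun
      (f := fun _ => (1 + K0) * (r * ((K * (L * r) + K0) * L))) (by simp) hm2 ?_
    · 
      refine Eventually.of_forall fun θ => ?_
      refine (ContinuousLinearMap.le_opNorm _ _).trans ?_
      rw [Real.norm_of_nonneg (by positivity), norm_smul, Real.norm_of_nonneg hr.le]
      have h4 : ‖A (z0 + r * e θ)‖ ≤ K * (L * r) + K0 := by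
        calc ‖A (z0 + r * e θ)‖ = ‖(A (z0 + r * e θ) - A z0) + A z0‖ := by simp
          _ ≤ _ := (norm_add_le _ _).trans (add_le_add (hAn θ) hA0)
      refine mul_le_mul (hVn θ) ?_ (by positivity) (by positivity)
      refine mul_le_mul_of_nonneg_left ?_ hr.le
      exact (ContinuousLinearMap.le_opNorm _ _).trans
        (mul_le_mul h4 (hcrL r θ hrR') (norm_nonneg _) (by positivity))
  have hibp := intervalIntegral.integral_eq_sub_of_hasDerivAt (a := 0) (b := 2 * Real.pi)
    (fun θ _ => hder θ) (hWf.add hm2i)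
  have hper : V (2 * Real.pi) (f (z0 + r * e (2 * Real.pi))) - V 0 (f (z0 + r * e 0)) = 0 := by
    have h1 : e (2 * Real.pi) = e 0 := by
      simp [he, Complex.exp_two_pi_mul_I]
    have h2 : V (2 * Real.pi) = V 0 := by simp [hV]
    rw [h1, h2, sub_self]
  rw [hper, intervalIntegral.integral_add hWf hm2i] at hibp
  have hfin : r • (∫ θ in (0:ℝ)..(2 * Real.pi), W θ (cr r θ)) -
      ∫ θ in (0:ℝ)..(2 * Real.pi), W θ (f (z0 + r * e θ)) =
      ∫ θ in (0:ℝ)..(2 * Real.pi), r • V θ ((A (z0 + r * e θ) - A z0) (cr r θ)) := by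
    have hint2 : IntervalIntegrable (fun θ => r • W θ (cr r θ)) MeasureTheory.volume 0 (2 * Real.pi) :=
      hint1.smul r
    rw [eq_neg_of_add_eq_zero_left hibp, sub_neg_eq_add, ← intervalIntegral.integral_smul,
      ← intervalIntegral.integral_add hint2 hm2i]
    refine intervalIntegral.integral_congr fun θ _ => ?_
    simp only [hVW, map_smul, ContinuousLinearMap.sub_apply, map_sub, smul_sub, smul_neg]
    abel
  rw [hfin]
  have := intervalIntegral.norm_integral_le_of_norm_le_const (a := 0) (b := 2 * Real.pi)
    (C := (1 + K0) * K * L ^ 2 * r ^ 2)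
    (f := fun θ => r • V θ ((A (z0 + r * e θ) - A z0) (cr r θ))) (fun θ _ => by
      rw [norm_smul, Real.norm_of_nonneg hr.le]
      have h5 : ‖V θ ((A (z0 + r * e θ) - A z0) (cr r θ))‖ ≤ (1 + K0) * ((K * (L * r)) * L) := by
        refine (ContinuousLinearMap.le_opNorm _ _).trans ?_
        refine mul_le_mul (hVn θ) ?_ (by positivity) (by positivity)
        exact (ContinuousLinearMap.le_opNorm _ _).trans
          (mul_le_mul (hAn θ) (hcrL r θ hrR') (norm_nonneg _) (by positivity))
      calc r * _ ≤ r * ((1 + K0) * ((K * (L * r)) * L)) := by gcongr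
        _ = _ := by ring)
  refine this.trans (le_of_eq ?_)
  rw [sub_zero, abs_of_pos Real.two_pi_pos]; ring

def ringMean {E : Type*} [NormedAddCommGroup E] [NormedSpace ℝ E]
    (f : ℂ → E) (B : E →L[ℝ] E) (z0 : ℂ) (r : ℝ) : E :=
  ∫ θ in (0:ℝ)..(2 * Real.pi),
      (Real.cos θ • f (z0 + r * Complex.exp (θ * Complex.I))
        - Real.sin θ • B (f (z0 + r * Complex.exp (θ * Complex.I))))

theorem pa_lim {E : Type*} [NormedAddCommGroup E] [NormedSpace ℝ E] [FiniteDimensional ℝ E]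
    {f : ℂ → E} {B : E →L[ℝ] E} {z0 : ℂ} {R : ℝ} (hR : 0 < R)
    (hd : ∀ z ∈ ball z0 R, DifferentiableAt ℝ f z)
    (hA : ∀ ξ : ℂ, fderiv ℝ f z0 (Complex.I * ξ) = B (fderiv ℝ f z0 ξ))
    (hA2 : ∀ v, B (B v) = -v) :
    Tendsto (fun s : ℝ => s⁻¹ • ringMean f B z0 s) (𝓝[>] 0)
      (𝓝 ((2 * Real.pi) • fderiv ℝ f z0 1)) := by
  set e : ℝ → ℂ := fun θ => Complex.exp (θ * Complex.I) with he
  have hec : Continuous e := by fun_prop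
  have hen : ∀ θ, ‖e θ‖ = 1 := fun θ => Complex.norm_exp_ofReal_mul_I θ
  have hmem : ∀ s θ : ℝ, |s| < R → z0 + s * e θ ∈ ball z0 R := by
    intro s θ hs
    simp [mem_ball, dist_eq_norm, hen, hs]
  have hfc : ∀ s : ℝ, |s| < R → Continuous (fun θ => f (z0 + s * e θ)) := by
    intro s hs
    rw [continuous_iff_continuousAt]
    intro θ
    exact ContinuousAt.comp (g := f) (f := fun θ => z0 + s * e θ)
      (hd _ (hmem s θ hs)).continuousAt (by fun_prop)
  set W : ℝ → E →L[ℝ] E := fun θ => Real.cos θ • ContinuousLinearMap.id ℝ E - Real.sin θ • B with hW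
  have hWc : Continuous W := by fun_prop
  have hWn : ∀ θ, ‖W θ‖ ≤ 1 + ‖B‖ := by
    intro θ
    calc ‖W θ‖ ≤ ‖Real.cos θ • ContinuousLinearMap.id ℝ E‖ + ‖Real.sin θ • B‖ := norm_sub_le _ _
      _ ≤ 1 * 1 + 1 * ‖B‖ := by
        rw [norm_smul, norm_smul]
        gcongr
        · exact Real.abs_cos_le_one θ
        · exact ContinuousLinearMap.norm_id_le
        · exact Real.abs_sin_le_one θ
      _ = _ := by ring
  have hN : ∀ s, ringMean f B z0 s = ∫ θ in (0:ℝ)..(2 * Real.pi), W θ (f (z0 + s * e θ)) := by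
    intro s
    simp [ringMean, hW, he]
  have hWD : ∀ θ, W θ (fderiv ℝ f z0 (e θ)) = fderiv ℝ f z0 1 := by
    intro θ
    have h1 : e θ = (Real.cos θ) • (1:ℂ) + Real.sin θ • (Complex.I * 1) := by
      simp [he, Complex.exp_mul_I, Complex.real_smul]
    rw [h1, map_add, map_smul, map_smul, hA]
    set v := fderiv ℝ f z0 1
    have : W θ (Real.cos θ • v + Real.sin θ • B v) = (Real.cos θ ^ 2 + Real.sin θ ^ 2) • v := by
      simp only [hW, sub_apply, smul_apply, ContinuousLinearMap.id_apply,
        map_add, map_smul, hA2]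
      module
    rw [this, Real.cos_sq_add_sin_sq, one_smul]
  have hW0 : ∀ v : E, ∫ θ in (0:ℝ)..(2 * Real.pi), W θ v = 0 := by
    intro v
    have : ∀ θ, W θ v = Real.cos θ • v - Real.sin θ • B v := fun θ => by simp [hW]
    simp only [this]
    rw [intervalIntegral.integral_sub, intervalIntegral.integral_smul_const,
      intervalIntegral.integral_smul_const, integral_cos, integral_sin]
    · simp
    · exact (by fun_prop : Continuous fun θ => Real.cos θ • v).intervalIntegrable _ _
    · exact (by fun_prop : Continuous fun θ => Real.sin θ • B v).intervalIntegrable _ _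
  rw [Metric.tendsto_nhdsWithin_nhds]
  intro ε hε
  have hlo := (hd z0 (mem_ball_self hR)).hasFDerivAt.isLittleO
  have hC : 0 < 2 * Real.pi * (1 + ‖B‖) := by positivity
  have := hlo.def (c := ε / 2 / (2 * Real.pi * (1 + ‖B‖))) (by positivity)
  rw [Metric.eventually_nhds_iff] at this
  obtain ⟨δ, hδ, hb⟩ := this
  refine ⟨min δ R, lt_min hδ hR, fun {s} hs0 hs => ?_⟩
  have hs0' : 0 < s := hs0
  rw [Real.dist_eq, sub_zero] at hs
  have hsR : |s| < R := hs.trans_le (min_le_right _ _)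
  have hsδ : |s| < δ := hs.trans_le (min_le_left _ _)
  have hdiff : s⁻¹ • ringMean f B z0 s - (2 * Real.pi) • fderiv ℝ f z0 1 =
      ∫ θ in (0:ℝ)..(2 * Real.pi), s⁻¹ • W θ (f (z0 + s * e θ) - f z0 - fderiv ℝ f z0 (s * e θ)) := by
    have h1 : ∀ θ, s⁻¹ • W θ (f (z0 + s * e θ) - f z0 - fderiv ℝ f z0 (s * e θ)) =
        (s⁻¹ • W θ (f (z0 + s * e θ)) - s⁻¹ • W θ (f z0)) - fderiv ℝ f z0 1 := by
      intro θ
      have h2 : (s:ℂ) * e θ = s • e θ := Complex.real_smul.symm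
      rw [← smul_sub, ← map_sub, map_sub, smul_sub, h2, map_smul, map_smul, hWD, smul_smul,
        inv_mul_cancel₀ hs0'.ne', one_smul]
    have hi1 : IntervalIntegrable (fun θ => s⁻¹ • W θ (f (z0 + s * e θ))) MeasureTheory.volume 0
        (2 * Real.pi) := ((hWc.clm_apply (hfc s hsR)).const_smul _).intervalIntegrable _ _
    have hi2 : IntervalIntegrable (fun θ => s⁻¹ • W θ (f z0)) MeasureTheory.volume 0
        (2 * Real.pi) := ((hWc.clm_apply continuous_const).const_smul _).intervalIntegrable _ _
    simp only [h1]
    rw [intervalIntegral.integral_sub (hi1.sub hi2) (by simp), intervalIntegral.integral_sub hi1 hi2,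
      intervalIntegral.integral_smul, intervalIntegral.integral_smul, hW0, hN]
    simp
  rw [dist_eq_norm, hdiff]
  have := intervalIntegral.norm_integral_le_of_norm_le_const (a := 0) (b := 2 * Real.pi)
    (C := (1 + ‖B‖) * (ε / 2 / (2 * Real.pi * (1 + ‖B‖))))
    (f := fun θ => s⁻¹ • W θ (f (z0 + s * e θ) - f z0 - fderiv ℝ f z0 (s * e θ))) (fun θ _ => by
      have h3 := hb (y := z0 + s * e θ) (by simp [dist_eq_norm, hen, hsδ])
      rw [add_sub_cancel_left] at h3
      have hns : ‖(s:ℂ) * e θ‖ = s := by simp [hen, abs_of_pos hs0']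
      rw [hns] at h3
      rw [norm_smul, norm_inv, Real.norm_of_nonneg hs0'.le]
      have h4 := (ContinuousLinearMap.le_opNorm (W θ) _).trans
        (mul_le_mul (hWn θ) h3 (norm_nonneg _) (by positivity))
      calc s⁻¹ * _ ≤ s⁻¹ * _ := mul_le_mul_of_nonneg_left h4 (by positivity)
        _ = _ := by field_simp)
  refine this.trans_lt ?_
  rw [sub_zero, abs_of_pos Real.two_pi_pos]
  have : (1 + ‖B‖) * (ε / 2 / (2 * Real.pi * (1 + ‖B‖))) * (2 * Real.pi) = ε / 2 := by
    have : 1 + ‖B‖ ≠ 0 := by positivity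
    field_simp
  rw [this]; linarith

theorem pa_mean {E : Type*} [NormedAddCommGroup E] [NormedSpace ℝ E] [FiniteDimensional ℝ E]
    {f : ℂ → E} {A : ℂ → E →L[ℝ] E} {z0 : ℂ} {R K K0 L : ℝ}
    (hK : 0 ≤ K) (hL : 0 ≤ L)
    (hd : ∀ z ∈ ball z0 R, DifferentiableAt ℝ f z)
    (hA : ∀ z ∈ ball z0 R, ∀ ξ : ℂ, fderiv ℝ f z (Complex.I * ξ) = A z (fderiv ℝ f z ξ))
    (hA2 : ∀ v, A z0 (A z0 v) = -v) (hA0 : ‖A z0‖ ≤ K0)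
    (hAK : ∀ z ∈ ball z0 R, ‖A z - A z0‖ ≤ K * ‖f z - f z0‖)
    (hDL : ∀ z ∈ ball z0 R, ‖fderiv ℝ f z‖ ≤ L) (r : ℝ) (hr : 0 < r) (hrR : r < R) :
    ‖r⁻¹ • ringMean f (A z0) z0 r - (2 * Real.pi) • fderiv ℝ f z0 1‖
      ≤ 2 * Real.pi * ((1 + K0) * K * L ^ 2) * r := by
  have hK0 : 0 ≤ K0 := (norm_nonneg _).trans hA0
  have hlim := pa_lim (hr.trans hrR) hd (hA z0 (mem_ball_self (hr.trans hrR))) hA2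
  set C := 2 * Real.pi * ((1 + K0) * K * L ^ 2) with hC
  have hC0 : 0 ≤ C := by positivity
  have hder : ∀ s ∈ Ioo 0 R, ∃ h', HasDerivAt (fun s : ℝ => s⁻¹ • ringMean f (A z0) z0 s) h' s ∧
      ‖h'‖ ≤ C := by
    intro s hs
    obtain ⟨N', h1, h2⟩ := pa_deriv hK hL hd hA hA2 hA0 hAK hDL s hs.1 hs.2
    have hs0 : s ≠ 0 := hs.1.ne'
    refine ⟨_, (hasDerivAt_inv hs0).smul h1, ?_⟩
    have : s⁻¹ • N' + (-(s ^ 2)⁻¹) • ringMean f (A z0) z0 s =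
        (s ^ 2)⁻¹ • (s • N' - ringMean f (A z0) z0 s) := by
      rw [smul_sub, smul_smul, neg_smul, sub_eq_add_neg]
      congr 2
      field_simp
    change ‖s⁻¹ • N' + (-(s ^ 2)⁻¹) • ringMean f (A z0) z0 s‖ ≤ _
    rw [this, norm_smul, norm_inv, Real.norm_of_nonneg (by positivity)]
    have h3 : ‖s • N' - ringMean f (A z0) z0 s‖ ≤ C * s ^ 2 := h2
    calc _ ≤ (s ^ 2)⁻¹ * (C * s ^ 2) := by gcongr
      _ = C := by field_simp
  refine le_of_tendsto ((tendsto_const_nhds (x := r⁻¹ • ringMean f (A z0) z0 r)).sub hlim).norm ?_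
  have : Ioo 0 r ∈ 𝓝[>] (0:ℝ) := Ioo_mem_nhdsGT hr
  filter_upwards [this] with s hs
  choose! h' hh' hn' using hder
  have := (convex_Ioo 0 R).norm_image_sub_le_of_norm_hasDerivWithin_le (C := C)
    (f := fun s : ℝ => s⁻¹ • ringMean f (A z0) z0 s) (f' := h')
    (fun x hx => (hh' x hx).hasDerivWithinAt) hn' (x := s) (y := r)
    ⟨hs.1, hs.2.trans hrR⟩ ⟨hr, hrR⟩
  refine this.trans ?_
  gcongr
  rw [Real.norm_of_nonneg (by linarith [hs.2])]
  linarith [hs.1]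

theorem ringMean_le {E : Type*} [NormedAddCommGroup E] [NormedSpace ℝ E] [FiniteDimensional ℝ E]
    {f : ℂ → E} {B : E →L[ℝ] E} {z0 : ℂ} {R K0 ω : ℝ} (hB : ‖B‖ ≤ K0)
    (hd : ContinuousOn f (ball z0 R)) 
    (hω : ∀ z ∈ ball z0 R, ‖f z - f z0‖ ≤ ω) (r : ℝ) (hr : 0 < r) (hrR : r < R) :
    ‖ringMean f B z0 r‖ ≤ 2 * Real.pi * ((1 + K0) * ω) := by
  have hK0 : 0 ≤ K0 := (norm_nonneg _).trans hB
  set e : ℝ → ℂ := fun θ => Complex.exp (θ * Complex.I) with he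
  have hec : Continuous e := by fun_prop
  have hen : ∀ θ, ‖e θ‖ = 1 := fun θ => Complex.norm_exp_ofReal_mul_I θ
  have hmem : ∀ θ : ℝ, z0 + r * e θ ∈ ball z0 R := by
    intro θ
    simp [mem_ball, dist_eq_norm, hen, abs_of_pos hr, hrR]
  have hfc : Continuous (fun θ => f (z0 + r * e θ)) :=
    hd.comp_continuous (by fun_prop) hmem
  have hi1 : IntervalIntegrable (fun θ => Real.cos θ • f (z0 + r * e θ)
        - Real.sin θ • B (f (z0 + r * e θ))) MeasureTheory.volume 0 (2 * Real.pi) :=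
    ((Real.continuous_cos.smul hfc).sub
      (Real.continuous_sin.smul (B.continuous.comp hfc))).intervalIntegrable _ _
  have hi2 : IntervalIntegrable (fun θ => Real.cos θ • f z0
        - Real.sin θ • B (f z0)) MeasureTheory.volume 0 (2 * Real.pi) :=
    (by fun_prop : Continuous _).intervalIntegrable _ _
  have h0 : ∫ θ in (0:ℝ)..(2 * Real.pi), (Real.cos θ • f z0 - Real.sin θ • B (f z0)) = 0 := by
    rw [intervalIntegral.integral_sub, intervalIntegral.integral_smul_const,
      intervalIntegral.integral_smul_const, integral_cos, integral_sin]
    · simp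
    · exact (by fun_prop : Continuous fun θ => Real.cos θ • f z0).intervalIntegrable _ _
    · exact (by fun_prop : Continuous fun θ => Real.sin θ • B (f z0)).intervalIntegrable _ _
  have h1 : ringMean f B z0 r = ∫ θ in (0:ℝ)..(2 * Real.pi), ((Real.cos θ • f (z0 + r * e θ)
        - Real.sin θ • B (f (z0 + r * e θ))) - (Real.cos θ • f z0 - Real.sin θ • B (f z0))) := by
    rw [intervalIntegral.integral_sub hi1 hi2, h0, sub_zero]; rfl
  rw [h1]
  have hω0 : 0 ≤ ω := (norm_nonneg _).trans (hω _ (hmem 0))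
  have := intervalIntegral.norm_integral_le_of_norm_le_const (a := 0) (b := 2 * Real.pi)
    (C := (1 + K0) * ω)
    (f := fun θ => ((Real.cos θ • f (z0 + r * e θ)
        - Real.sin θ • B (f (z0 + r * e θ))) - (Real.cos θ • f z0 - Real.sin θ • B (f z0)))) (fun θ _ => by
      have h2 : ((Real.cos θ • f (z0 + r * e θ)
        - Real.sin θ • B (f (z0 + r * e θ))) - (Real.cos θ • f z0 - Real.sin θ • B (f z0))) =
        Real.cos θ • (f (z0 + r * e θ) - f z0) - Real.sin θ • B (f (z0 + r * e θ) - f z0) := by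
        rw [map_sub]; module
      rw [h2]
      have h3 := hω _ (hmem θ)
      calc _ ≤ ‖Real.cos θ • (f (z0 + r * e θ) - f z0)‖ + ‖Real.sin θ • B (f (z0 + r * e θ) - f z0)‖ :=
            norm_sub_le _ _
        _ ≤ 1 * ω + 1 * (K0 * ω) := by
          rw [norm_smul, norm_smul]
          gcongr
          · exact Real.abs_cos_le_one θ
          · exact Real.abs_sin_le_one θ
          · exact (B.le_opNorm _).trans (by gcongr)
        _ = _ := by ring)
  refine this.trans (le_of_eq ?_)
  rw [sub_zero, abs_of_pos Real.two_pi_pos]; ring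

theorem jlin_norm_le {E : Type*} [NormedAddCommGroup E] [NormedSpace ℝ E]
    {D : ℂ →L[ℝ] E} {B : E →L[ℝ] E} {K0 : ℝ} (hB : ‖B‖ ≤ K0)
    (h : ∀ ξ : ℂ, D (Complex.I * ξ) = B (D ξ)) : ‖D‖ ≤ (1 + K0) * ‖D 1‖ := by
  have hK0 : 0 ≤ K0 := (norm_nonneg _).trans hB
  refine ContinuousLinearMap.opNorm_le_bound _ (by positivity) fun ξ => ?_
  have h1 : ξ = ξ.re • (1:ℂ) + ξ.im • (Complex.I * 1) := by
    simp only [Complex.real_smul, mul_one]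
    rw [Complex.re_add_im]
  have h2 : D ξ = ξ.re • D 1 + ξ.im • B (D 1) := by
    conv_lhs => rw [h1]
    rw [map_add, map_smul, map_smul, h]
  rw [h2]
  calc _ ≤ ‖ξ.re • D 1‖ + ‖ξ.im • B (D 1)‖ := norm_add_le _ _
    _ ≤ ‖ξ‖ * ‖D 1‖ + ‖ξ‖ * (K0 * ‖D 1‖) := by
      rw [norm_smul, norm_smul]
      gcongr
      · exact Complex.abs_re_le_norm ξ
      · exact Complex.abs_im_le_norm ξ
      · exact (B.le_opNorm _).trans (by gcongr)
    _ = _ := by ring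

theorem pa_point {E : Type*} [NormedAddCommGroup E] [NormedSpace ℝ E] [FiniteDimensional ℝ E]
    {f : ℂ → E} {A : ℂ → E →L[ℝ] E} {z0 : ℂ} {R K K0 L ω : ℝ}
    (hK : 0 ≤ K) (hL : 0 ≤ L)
    (hd : ∀ z ∈ ball z0 R, DifferentiableAt ℝ f z)
    (hA : ∀ z ∈ ball z0 R, ∀ ξ : ℂ, fderiv ℝ f z (Complex.I * ξ) = A z (fderiv ℝ f z ξ))
    (hA2 : ∀ v, A z0 (A z0 v) = -v) (hA0 : ‖A z0‖ ≤ K0)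
    (hAK : ∀ z ∈ ball z0 R, ‖A z - A z0‖ ≤ K * ‖f z - f z0‖)
    (hω : ∀ z ∈ ball z0 R, ‖f z - f z0‖ ≤ ω)
    (hDL : ∀ z ∈ ball z0 R, ‖fderiv ℝ f z‖ ≤ L) (r : ℝ) (hr : 0 < r) (hrR : r < R) :
    ‖fderiv ℝ f z0‖ ≤ (1 + K0) ^ 2 * (ω / r + K * L ^ 2 * r) := by
  have hK0 : 0 ≤ K0 := (norm_nonneg _).trans hA0
  have h1 := pa_mean hK hL hd hA hA2 hA0 hAK hDL r hr hrR
  have h2 := ringMean_le hA0 (fun z hz => (hd z hz).continuousAt.continuousWithinAt) hω r hr hrR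
  have h3 := jlin_norm_le hA0 (hA z0 (mem_ball_self (hr.trans hrR)))
  have h4 : ‖(2 * Real.pi) • fderiv ℝ f z0 1‖ ≤ 2 * Real.pi * ((1 + K0) * (ω / r + K * L ^ 2 * r)) := by
    calc _ = ‖r⁻¹ • ringMean f (A z0) z0 r - (r⁻¹ • ringMean f (A z0) z0 r - (2 * Real.pi) • fderiv ℝ f z0 1)‖ := by
          rw [sub_sub_cancel]
      _ ≤ ‖r⁻¹ • ringMean f (A z0) z0 r‖ + _ := norm_sub_le _ _
      _ ≤ r⁻¹ * (2 * Real.pi * ((1 + K0) * ω)) + 2 * Real.pi * ((1 + K0) * K * L ^ 2) * r := by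
        refine add_le_add ?_ h1
        rw [norm_smul, norm_inv, Real.norm_of_nonneg hr.le]
        gcongr
      _ = _ := by field_simp
  rw [norm_smul, Real.norm_of_nonneg Real.two_pi_pos.le] at h4
  have h5 := le_of_mul_le_mul_left h4 Real.two_pi_pos
  calc _ ≤ _ := h3
    _ ≤ (1 + K0) * ((1 + K0) * (ω / r + K * L ^ 2 * r)) := by gcongr
    _ = _ := by ring

theorem pa_apriori {E : Type*} [NormedAddCommGroup E] [NormedSpace ℝ E] [FiniteDimensional ℝ E]
    {f : ℂ → E} {A : ℂ → E →L[ℝ] E} {z : ℂ} {d K K0 Λ ω C : ℝ}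
    (hK : 0 ≤ K) (hd0 : 0 < d)
    (hd : ∀ w ∈ ball z d, DifferentiableAt ℝ f w)
    (hA : ∀ w ∈ ball z d, ∀ ξ : ℂ, fderiv ℝ f w (Complex.I * ξ) = A w (fderiv ℝ f w ξ))
    (hA2 : ∀ w ∈ ball z d, ∀ v, A w (A w v) = -v) (hA0 : ∀ w ∈ ball z d, ‖A w‖ ≤ K0)
    (hAK : ∀ w ∈ ball z d, ∀ w' ∈ ball z d, ‖A w - A w'‖ ≤ K * ‖f w - f w'‖)
    (hω : ∀ w ∈ ball z d, ∀ w' ∈ ball z d, ‖f w - f w'‖ ≤ ω)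
    (hDL : ∀ w ∈ ball z d, ‖fderiv ℝ f w‖ ≤ Λ)
    (hC : C = (1 + K0) ^ 2 * (1 + 16 * K)) (hωC : 8 * C ^ 2 * ω ≤ 1) :
    ‖fderiv ℝ f z‖ ≤ 32 * C ^ 2 * ω / d := by
  have hzz : z ∈ ball z d := mem_ball_self hd0
  have hK0 : 0 ≤ K0 := (norm_nonneg _).trans (hA0 z hzz)
  have hω0 : 0 ≤ ω := (norm_nonneg _).trans (hω z hzz z hzz)
  have hC1 : 1 ≤ C := by
    rw [hC]; nlinarith [sq_nonneg K0, mul_nonneg (sq_nonneg (1 + K0)) hK]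
  set S : Set ℝ := (fun w => (d - dist w z) * ‖fderiv ℝ f w‖) '' ball z d with hS
  have hbdd : BddAbove S := by
    refine ⟨d * Λ, ?_⟩
    rintro _ ⟨w, hw, rfl⟩
    have := mem_ball.1 hw
    exact mul_le_mul (by linarith [dist_nonneg (x := w) (y := z)]) (hDL w hw) (norm_nonneg _) hd0.le
  have hle : ∀ w ∈ ball z d, (d - dist w z) * ‖fderiv ℝ f w‖ ≤ sSup S := fun w hw =>
    le_csSup hbdd ⟨w, hw, rfl⟩
  have hz : d * ‖fderiv ℝ f z‖ ≤ sSup S := by simpa using hle z hzz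
  suffices hM : sSup S ≤ 32 * C ^ 2 * ω by
    rw [le_div_iff₀ hd0]; linarith
  by_cases hMpos : sSup S ≤ 0
  · exact hMpos.trans (by positivity)
  push Not at hMpos
  obtain ⟨_, ⟨w, hw, rfl⟩, hwM⟩ := exists_lt_of_lt_csSup (⟨_, ⟨z, hzz, rfl⟩⟩ : S.Nonempty)
    (show sSup S / 2 < sSup S by linarith)
  simp only at hwM
  set r0 := (d - dist w z) / 2 with hr0
  have hr0p : 0 < r0 := by have := mem_ball.1 hw; linarith
  set D := ‖fderiv ℝ f w‖ with hD
  have hD0 : 0 ≤ D := norm_nonneg _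
  have hsub : ball w r0 ⊆ ball z d := by
    refine ball_subset_ball' ?_
    linarith
  have hM4 : sSup S ≤ 4 * (r0 * D) := by
    have : d - dist w z = 2 * r0 := by rw [hr0]; ring
    rw [this] at hwM; linarith
  have hL : ∀ w' ∈ ball w r0, ‖fderiv ℝ f w'‖ ≤ 4 * D := by
    intro w' hw'
    have h1 := hle w' (hsub hw')
    have h2 : r0 ≤ d - dist w' z := by
      have := dist_triangle w' w z
      have := mem_ball.1 hw'
      linarith
    have h3 : r0 * ‖fderiv ℝ f w'‖ ≤ r0 * (4 * D) := by
      calc _ ≤ (d - dist w' z) * ‖fderiv ℝ f w'‖ := by gcongr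
        _ ≤ _ := h1.trans (hM4.trans (by linarith))
    exact le_of_mul_le_mul_left h3 hr0p
  set X := r0 * D with hX
  have hX0 : 0 ≤ X := by positivity
  set t := 1 / (2 * C * (X + 1)) with ht
  have hden : 0 < 2 * C * (X + 1) := by positivity
  have htp : 0 < t := by positivity
  have ht1 : t < 1 := by
    rw [ht, div_lt_one hden]; nlinarith
  have h1 := pa_point hK (by positivity : 0 ≤ 4 * D) (fun y hy => hd y (hsub hy))
    (fun y hy => hA y (hsub hy)) (hA2 w hw) (hA0 w hw) (fun y hy => hAK y (hsub hy) w hw)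
    (fun y hy => hω y (hsub hy) w hw) hL (t * r0) (by positivity) (by nlinarith)
  have h2 : X ≤ C * (ω / t + t * X ^ 2) := by
    have : X ≤ r0 * ((1 + K0) ^ 2 * (ω / (t * r0) + K * (4 * D) ^ 2 * (t * r0))) := by
      rw [hX]; gcongr
    have h3 : r0 * ((1 + K0) ^ 2 * (ω / (t * r0) + K * (4 * D) ^ 2 * (t * r0))) =
        (1 + K0) ^ 2 * (ω / t + 16 * K * (t * X ^ 2)) := by
      rw [hX]; field_simp
      ring
    rw [h3] at this
    refine this.trans ?_
    rw [hC, mul_assoc ((1 + K0) ^ 2) (1 + 16 * K)]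
    refine mul_le_mul_of_nonneg_left ?_ (sq_nonneg (1 + K0))
    have a1 : 0 ≤ ω / t := by positivity
    have a2 : 0 ≤ t * X ^ 2 := by positivity
    nlinarith [mul_nonneg hK a1, mul_nonneg hK a2]
  have h4 : C * (ω / t + t * X ^ 2) = 2 * C ^ 2 * ω * (X + 1) + X ^ 2 / (2 * (X + 1)) := by
    rw [ht]; field_simp
  have h5 : X ^ 2 / (2 * (X + 1)) ≤ X / 2 := by
    rw [div_le_div_iff₀ (by positivity) (by positivity)]; nlinarith
  have h6 : X ≤ 8 * C ^ 2 * ω := by nlinarith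
  linarith

theorem pa_locbdd {E : Type*} [NormedAddCommGroup E] [NormedSpace ℝ E] [FiniteDimensional ℝ E]
    {f : ℂ → E} {A : ℂ → E →L[ℝ] E} {V : Set ℂ}
    (hd : ∀ w ∈ V, DifferentiableAt ℝ f w) (hV : IsOpen V)
    (hA : ∀ w ∈ V, ∀ ξ : ℂ, fderiv ℝ f w (Complex.I * ξ) = A w (fderiv ℝ f w ξ))
    (hA2 : ∀ w ∈ V, ∀ v, A w (A w v) = -v)
    (hAK : ∀ z ∈ V, ∃ r > 0, ∃ K K0 : ℝ, 0 ≤ K ∧ ball z r ⊆ V ∧ (∀ w ∈ ball z r, ‖A w‖ ≤ K0) ∧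
      ∀ w ∈ ball z r, ∀ w' ∈ ball z r, ‖A w - A w'‖ ≤ K * ‖f w - f w'‖) :
    ∀ z ∈ V, ∃ r > 0, ∃ Λ : ℝ, ball z r ⊆ V ∧ ∀ w ∈ ball z r, ‖fderiv ℝ f w‖ ≤ Λ := by
  set G : Set ℂ := {z | ∃ r > 0, ∃ Λ : ℝ, ball z r ⊆ V ∧ ∀ w ∈ ball z r, ‖fderiv ℝ f w‖ ≤ Λ} with hG
  have hGo : IsOpen G := by
    rw [Metric.isOpen_iff]
    rintro z ⟨r, hr, Λ, h1, h2⟩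
    refine ⟨r, hr, fun w hw => ?_⟩
    obtain ⟨r', hr', hs⟩ := Metric.isOpen_iff.1 isOpen_ball w hw
    exact ⟨r', hr', Λ, hs.trans h1, fun y hy => h2 y (hs hy)⟩
  by_contra hcon
  push Not at hcon
  set S : Set ℂ := V ∩ Gᶜ with hS
  have hSne : S.Nonempty := by
    obtain ⟨z, hz, h⟩ := hcon
    refine ⟨z, hz, ?_⟩
    rintro ⟨r, hr, Λ, h1, h2⟩
    obtain ⟨w, hw, h3⟩ := h r hr Λ h1
    exact absurd (h2 w hw) (not_le.2 h3)
  have hSlc : IsLocallyClosed S := ⟨V, Gᶜ, hV, hGo.isClosed_compl, rfl⟩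
  have : LocallyCompactSpace S := hSlc.locallyCompactSpace
  have : Nonempty S := hSne.to_subtype
  have : BaireSpace S := BaireSpace.of_t2Space_locallyCompactSpace
  have hfS : Continuous (fun z : S => f z) := by
    rw [continuous_iff_continuousAt]
    intro z
    exact ContinuousAt.comp (g := f) (hd z z.2.1).continuousAt continuous_subtype_val.continuousAt
  set F : ℕ → Set S := fun k => ⋂ w ∈ V, ({z : S | 1 / ((k:ℝ) + 1) ≤ dist w z} ∪
    {z : S | ‖f w - f z‖ ≤ ((k:ℝ) + 1) * dist w z}) with hF
  have hFc : ∀ k, IsClosed (F k) := by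
    intro k
    refine isClosed_biInter fun w _ => IsClosed.union ?_ ?_
    · exact isClosed_le continuous_const (continuous_const.dist continuous_subtype_val)
    · exact isClosed_le (continuous_const.sub hfS).norm
        (continuous_const.mul (continuous_const.dist continuous_subtype_val))
  have hFU : ⋃ k, F k = univ := by
    refine eq_univ_of_forall fun z => ?_
    obtain ⟨C, hC⟩ := (hd z z.2.1).hasFDerivAt.isBigO_sub.bound
    obtain ⟨δ, hδ, hb⟩ := Metric.eventually_nhds_iff.1 hC
    obtain ⟨k1, hk1⟩ := exists_nat_one_div_lt hδ
    obtain ⟨k2, hk2⟩ := exists_nat_ge C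
    refine mem_iUnion.2 ⟨max k1 k2, ?_⟩
    refine mem_iInter₂.2 fun w hw => ?_
    by_cases h : 1 / (((max k1 k2 : ℕ):ℝ) + 1) ≤ dist w z
    · exact Or.inl h
    right
    push Not at h
    have h1 : 1 / (((max k1 k2 : ℕ):ℝ) + 1) ≤ 1 / ((k1:ℝ) + 1) := by
      gcongr; exact le_max_left _ _
    have h2 := hb (h.trans_le (h1.trans hk1.le))
    rw [← dist_eq_norm w] at h2
    refine h2.trans ?_
    gcongr
    have : (k2:ℝ) ≤ ((max k1 k2 : ℕ):ℝ) := by exact_mod_cast le_max_right _ _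
    linarith
  obtain ⟨k, ⟨z1, hz1⟩⟩ := nonempty_interior_of_iUnion_of_closed hFc hFU
  rw [mem_interior_iff_mem_nhds, Metric.mem_nhds_iff] at hz1
  obtain ⟨s, hs, hsF⟩ := hz1
  obtain ⟨r, hr, K, K0, hK, hrV, hK0', hKK⟩ := hAK z1 z1.2.1
  have hK0 : 0 ≤ K0 := (norm_nonneg _).trans (hK0' z1 (mem_ball_self hr))
  set M : ℝ := (k:ℝ) + 1 with hM
  have hMp : 0 < M := by positivity
  set C := (1 + K0) ^ 2 * (1 + 16 * K) with hC
  have hC1 : 1 ≤ C := by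
    nlinarith [sq_nonneg K0, mul_nonneg (sq_nonneg (1 + K0)) hK]
  have hCp : 0 < C := by linarith
  obtain ⟨t, ht, ht1, ht2, ht3, ht4⟩ : ∃ t > 0, t ≤ s ∧ t ≤ r ∧ t ≤ 1 / M ∧ t ≤ 1 / (80 * C ^ 2 * M) := by
    refine ⟨min (min s r) (min (1 / M) (1 / (80 * C ^ 2 * M))), by positivity, ?_, ?_, ?_, ?_⟩
    · exact (min_le_left _ _).trans (min_le_left _ _)
    · exact (min_le_left _ _).trans (min_le_right _ _)
    · exact (min_le_right _ _).trans (min_le_left _ _)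
    · exact (min_le_right _ _).trans (min_le_right _ _)
  have hkey : ∀ z ∈ S, dist z z1 < t → ∀ w ∈ V, dist w z < 1 / M → ‖f w - f z‖ ≤ M * dist w z := by
    intro z hz hzt w hw hwz
    have h1 : (⟨z, hz⟩ : S) ∈ F k := hsF (by
      rw [mem_ball, Subtype.dist_eq]; exact hzt.trans_le ht1)
    rcases mem_iInter₂.1 h1 w hw with h | h
    · exact absurd hwz (not_lt.2 h)
    · exact h
  refine z1.2.2 ⟨t / 4, by positivity, 320 * C ^ 2 * M,
    (ball_subset_ball (by linarith)).trans hrV, fun w hw => ?_⟩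
  have hwt := mem_ball.1 hw
  have hwV : w ∈ V := hrV (mem_ball.2 (by linarith))
  by_cases hwS : w ∈ S
  · have h1 : ‖fderiv ℝ f w‖ ≤ M := by
      refine (hd w hwV).hasFDerivAt.le_of_lip' hMp.le ?_
      have h2 : ∀ᶠ y in 𝓝 w, y ∈ V := hV.mem_nhds hwV
      have h3 : ∀ᶠ y in 𝓝 w, dist y w < 1 / M := ball_mem_nhds w (by positivity)
      filter_upwards [h2, h3] with y h2 h3
      rw [← dist_eq_norm y]
      exact hkey w hwS (by linarith) y h2 h3
    refine h1.trans ?_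
    have : 1 ≤ C ^ 2 := one_le_pow₀ hC1
    nlinarith
  have hwG : w ∈ G := by
    by_contra h; exact hwS ⟨hwV, h⟩
  obtain ⟨ρ, hρ, hρG⟩ := Metric.isOpen_iff.1 hGo w hwG
  set d' := infDist w S with hd'
  have hd'p : 0 < d' := by
    refine hρ.trans_le ((le_infDist hSne).2 fun y hy => ?_)
    by_contra h
    exact hy.2 (hρG (by rw [mem_ball, dist_comm]; exact not_le.1 h))
  have hd'1 : d' ≤ dist w z1 := infDist_le_dist_of_mem z1.2
  obtain ⟨z2, hz2S, hz2⟩ := (infDist_lt_iff (x := w) (r := 2 * d') hSne).1 (by linarith)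
  set d := d' / 2 with hdd
  have hd0 : 0 < d := by positivity
  have hz2t : dist z2 z1 < t := by
    have := dist_triangle z2 w z1
    rw [dist_comm z2 w] at this
    linarith
  have hcl : ∀ y ∈ closedBall w d, dist y z1 < t := by
    intro y hy
    have := dist_triangle y w z1
    have := mem_closedBall.1 hy
    linarith
  have hclV : ∀ y ∈ closedBall w d, y ∈ V := fun y hy =>
    hrV (mem_ball.2 ((hcl y hy).trans_le ht2))
  have hclG : ∀ y ∈ closedBall w d, y ∈ G := by
    intro y hy
    by_contra h
    have h1 : d' ≤ dist w y := infDist_le_dist_of_mem ⟨hclV y hy, h⟩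
    have h2 := mem_closedBall'.1 hy
    linarith
  obtain ⟨Λ, hΛ⟩ : ∃ Λ : ℝ, ∀ y ∈ closedBall w d, ‖fderiv ℝ f y‖ ≤ Λ := by
    refine (isCompact_closedBall w d).induction_on (p := fun T => ∃ Λ : ℝ, ∀ y ∈ T, ‖fderiv ℝ f y‖ ≤ Λ)
      ⟨0, by simp⟩ ?_ ?_ ?_
    · rintro s t hst ⟨Λ, h⟩
      exact ⟨Λ, fun y hy => h y (hst hy)⟩
    · rintro s t ⟨Λ, h⟩ ⟨Λ', h'⟩
      refine ⟨max Λ Λ', ?_⟩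
      rintro y (hy | hy)
      · exact (h y hy).trans (le_max_left _ _)
      · exact (h' y hy).trans (le_max_right _ _)
    · intro y hy
      obtain ⟨r, hr, Λ, _, h2⟩ := hclG y hy
      exact ⟨ball y r, mem_nhdsWithin_of_mem_nhds (ball_mem_nhds y hr), Λ, h2⟩
  have hosc : ∀ y ∈ ball w d, ‖f y - f z2‖ ≤ M * (5 * d) := by
    intro y hy
    have h1 : dist y z2 < 5 * d := by
      have := dist_triangle y w z2
      have := mem_ball.1 hy
      linarith
    have h2 := hkey z2 hz2S hz2t y (hclV y (ball_subset_closedBall hy)) (by linarith)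
    refine h2.trans ?_
    gcongr
  have hbs : ∀ y ∈ ball w d, y ∈ ball (z1:ℂ) r := fun y hy =>
    mem_ball.2 ((hcl y (ball_subset_closedBall hy)).trans_le ht2)
  have hfin := pa_apriori (f := f) (A := A) (z := w) (d := d) (K := K) (K0 := K0) (Λ := Λ) (C := C)
    (ω := 10 * M * d) hK hd0
    (fun y hy => hd y (hrV (hbs y hy))) (fun y hy => hA y (hrV (hbs y hy)))
    (fun y hy => hA2 y (hrV (hbs y hy))) (fun y hy => hK0' y (hbs y hy))
    (fun y hy y' hy' => hKK y (hbs y hy) y' (hbs y' hy'))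
    (fun y hy y' hy' => by
      have := norm_sub_le_norm_sub_add_norm_sub (f y) (f z2) (f y')
      have h1 := hosc y hy
      have h2 := hosc y' hy'
      rw [norm_sub_rev] at h2
      linarith)
    (fun y hy => hΛ y (ball_subset_closedBall hy)) rfl
    (by
      rw [le_div_iff₀ (by positivity)] at ht4
      have : d ≤ t := by linarith
      have : d * (80 * C ^ 2 * M) ≤ t * (80 * C ^ 2 * M) := by gcongr
      linarith)
  refine hfin.trans (le_of_eq ?_)
  field_simp
  ring

theorem pa_contDiff {E : Type*} [NormedAddCommGroup E] [NormedSpace ℝ E] [FiniteDimensional ℝ E]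
    {f : ℂ → E} {A : ℂ → E →L[ℝ] E} {V : Set ℂ}
    (hd : ∀ w ∈ V, DifferentiableAt ℝ f w) (hV : IsOpen V)
    (hA : ∀ w ∈ V, ∀ ξ : ℂ, fderiv ℝ f w (Complex.I * ξ) = A w (fderiv ℝ f w ξ))
    (hA2 : ∀ w ∈ V, ∀ v, A w (A w v) = -v) (hAc : ContinuousOn A V)
    (hAK : ∀ z ∈ V, ∃ r > 0, ∃ K K0 : ℝ, 0 ≤ K ∧ ball z r ⊆ V ∧ (∀ w ∈ ball z r, ‖A w‖ ≤ K0) ∧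
      ∀ w ∈ ball z r, ∀ w' ∈ ball z r, ‖A w - A w'‖ ≤ K * ‖f w - f w'‖) :
    ContDiffOn ℝ 1 f V := by
  have hb := pa_locbdd hd hV hA hA2 hAK
  have hfc : ContinuousOn f V := fun z hz => (hd z hz).continuousAt.continuousWithinAt
  have hx : ∀ z0 ∈ V, ContinuousAt (fun z => fderiv ℝ f z 1) z0 := by
    intro z0 hz0
    obtain ⟨r1, hr1, Λ, hr1V, hΛ⟩ := hb z0 hz0
    obtain ⟨r2, hr2, K, K0, hK, hr2V, hK0', hKK⟩ := hAK z0 hz0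
    have hK0 : 0 ≤ K0 := (norm_nonneg _).trans (hK0' z0 (mem_ball_self hr2))
    have hΛ0 : 0 ≤ Λ := (norm_nonneg _).trans (hΛ z0 (mem_ball_self hr1))
    set r := min r1 r2 / 2 with hr
    have hr0 : 0 < r := by positivity
    have hrr1 : r + r ≤ r1 := by have := min_le_left r1 r2; linarith
    have hrr2 : r + r ≤ r2 := by have := min_le_right r1 r2; linarith
    have hsub : ∀ z ∈ ball z0 r, ∀ y ∈ ball z r, y ∈ ball z0 r1 ∧ y ∈ ball z0 r2 := by
      intro z hz y hy
      have h1 := dist_triangle y z z0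
      have h2 := mem_ball.1 hz
      have h3 := mem_ball.1 hy
      constructor <;> rw [mem_ball] <;> linarith
    set N : ℝ → ℂ → E := fun s z => (2 * Real.pi)⁻¹ • (s⁻¹ • ringMean f (A z) z s) with hN
    have hbd : ∀ s, 0 < s → s < r → ∀ z ∈ ball z0 r, ‖fderiv ℝ f z 1 - N s z‖ ≤
        ((1 + K0) * K * Λ ^ 2) * s := by
      intro s hs hsr z hz
      have hself : z ∈ ball z r := mem_ball_self hr0
      have h1 := pa_mean (f := f) (A := A) (z0 := z) (R := r) (K := K) (K0 := K0) (L := Λ) hK hΛ0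
        (fun y hy => hd y (hr1V (hsub z hz y hy).1)) (fun y hy => hA y (hr1V (hsub z hz y hy).1))
        (hA2 z (hr1V (hsub z hz z hself).1)) (hK0' z (hsub z hz z hself).2)
        (fun y hy => hKK y (hsub z hz y hy).2 z (hsub z hz z hself).2)
        (fun y hy => hΛ y (hsub z hz y hy).1) s hs hsr
      have h2 : fderiv ℝ f z 1 - N s z = -((2 * Real.pi)⁻¹ • (s⁻¹ • ringMean f (A z) z s -
          (2 * Real.pi) • fderiv ℝ f z 1)) := by
        rw [smul_sub, smul_smul _ (2 * Real.pi), inv_mul_cancel₀ Real.two_pi_pos.ne', one_smul]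
        simp [hN]
      rw [h2, norm_neg, norm_smul, norm_inv, Real.norm_of_nonneg Real.two_pi_pos.le,
        inv_mul_le_iff₀ Real.two_pi_pos]
      refine h1.trans (le_of_eq (by ring))
    have hNc : ∀ s, 0 < s → s < r → ContinuousOn (N s) (ball z0 r) := by
      intro s hs hsr
      refine ContinuousOn.const_smul (ContinuousOn.const_smul ?_ _) _
      rw [continuousOn_iff_continuous_domRestrict]
      refine intervalIntegral.continuous_parametric_intervalIntegral_of_continuous'
        (f := fun (z : ball z0 r) θ => (Real.cos θ • f (z + s * Complex.exp (θ * Complex.I))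
        - Real.sin θ • A z (f (z + s * Complex.exp (θ * Complex.I))))) ?_ _ _
      have h1 : Continuous (fun q : ball z0 r × ℝ => f (q.1 + s * Complex.exp (q.2 * Complex.I))) := by
        refine hfc.comp_continuous (by fun_prop) fun q => hr1V (hsub q.1 q.1.2 _ ?_).1
        simp [mem_ball, dist_eq_norm, Complex.norm_exp_ofReal_mul_I, abs_of_pos hs, hsr]
      have h2 : Continuous (fun q : ball z0 r × ℝ => A q.1) := by
        refine hAc.comp_continuous (by fun_prop) fun q => hr1V (hsub q.1 q.1.2 _ (mem_ball_self hr0)).1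
      exact ((Real.continuous_cos.comp continuous_snd).smul h1).sub
        ((Real.continuous_sin.comp continuous_snd).smul (h2.clm_apply h1))
    have hcont : ContinuousOn (fun z => fderiv ℝ f z 1) (ball z0 r) := by
      refine continuousOn_of_uniform_approx_of_continuousOn fun u hu => ?_
      obtain ⟨ε, hε, hεu⟩ := Metric.mem_uniformity_dist.1 hu
      set Cc := (1 + K0) * K * Λ ^ 2 with hCc
      have hCc0 : 0 ≤ Cc := by positivity
      set s := min (r / 2) (ε / (2 * (Cc + 1))) with hs
      have hs0 : 0 < s := by positivity
      have hsr : s < r := (min_le_left _ _).trans_lt (by linarith)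
      refine ⟨N s, hNc s hs0 hsr, fun y hy => hεu ?_⟩
      rw [dist_eq_norm]
      refine (hbd s hs0 hsr y hy).trans_lt ?_
      have h1 : s ≤ ε / (2 * (Cc + 1)) := min_le_right _ _
      rw [le_div_iff₀ (by positivity)] at h1
      nlinarith
    exact hcont.continuousAt (ball_mem_nhds z0 hr0)
  rw [show (1 : WithTop ℕ∞) = 0 + 1 by simp, contDiffOn_succ_iff_fderiv_of_isOpen hV]
  refine ⟨fun z hz => (hd z hz).differentiableWithinAt, by simp, ?_⟩
  rw [contDiffOn_zero]
  have hx' : ContinuousOn (fun z => fderiv ℝ f z 1) V := fun z hz => (hx z hz).continuousWithinAt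
  have h3 : ContinuousOn (fun z => Complex.reCLM.smulRight (fderiv ℝ f z 1) +
      Complex.imCLM.smulRight (A z (fderiv ℝ f z 1))) V := by
    have h4 := hAc.clm_apply hx'
    refine ContinuousOn.add ?_ ?_
    · exact ((ContinuousLinearMap.smulRightL ℝ ℂ E Complex.reCLM).continuous).comp_continuousOn hx'
    · exact ((ContinuousLinearMap.smulRightL ℝ ℂ E Complex.imCLM).continuous).comp_continuousOn h4
  refine h3.congr fun z hz => ?_
  ext ξ
  have h1 : ξ = ξ.re • (1:ℂ) + ξ.im • (Complex.I * 1) := by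
    simp only [Complex.real_smul, mul_one]
    rw [Complex.re_add_im]
  conv_lhs => rw [h1]
  rw [map_add, map_smul, map_smul, hA z hz]
  simp

theorem pa_main {n : ℕ} {Ω : Set (Cn n)} (hΩ : IsOpen Ω) {J : Cn n → (Cn n →L[ℝ] Cn n)}
    (hJ : IsAlmostComplexOn n Ω J) {f : ℂ → Cn n} (hf : IsJHolomorphicOn n Ω J 1 f) :
    ContDiffOn ℝ 1 f (ball (0:ℂ) 1) := by
  have hfc : ContinuousOn f (ball (0:ℂ) 1) := fun z hz => (hf.2 z hz).1.continuousAt.continuousWithinAt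
  refine pa_contDiff (A := fun z => J (f z)) (fun w hw => (hf.2 w hw).1) isOpen_ball
    (fun w hw => (hf.2 w hw).2) ?_ ?_ ?_
  · intro w hw v
    have := hJ.2 (f w) (hf.1 hw)
    exact congrArg (fun T => T v) this
  · exact hJ.1.continuousOn.comp hfc hf.1
  · intro z hz
    have h1 : ContDiffAt ℝ 1 J (f z) :=
      ((hJ.1 (f z) (hf.1 hz)).contDiffAt (hΩ.mem_nhds (hf.1 hz))).of_le (by exact_mod_cast le_top)
    obtain ⟨K, t, ht, hL⟩ := h1.exists_lipschitzOnWith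
    have h2 : ∀ᶠ x in 𝓝 (f z), ‖J x‖ < ‖J (f z)‖ + 1 :=
      h1.continuousAt.norm.eventually_lt continuousAt_const (by simp)
    have h3 : ∀ᶠ w in 𝓝 z, w ∈ ball (0:ℂ) 1 ∧ f w ∈ t ∧ ‖J (f w)‖ < ‖J (f z)‖ + 1 :=
      (show ∀ᶠ w in 𝓝 z, w ∈ ball (0:ℂ) 1 from isOpen_ball.mem_nhds hz).and ((((hf.2 z hz).1.continuousAt.eventually ht).and
        ((hf.2 z hz).1.continuousAt.eventually h2)))
    obtain ⟨r, hr, hb⟩ := Metric.eventually_nhds_iff_ball.1 h3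
    refine ⟨r, hr, K, ‖J (f z)‖ + 1, K.2, fun w hw => (hb w hw).1, fun w hw => (hb w hw).2.2.le, ?_⟩
    intro w hw w' hw'
    have := hL.dist_le_mul _ (hb w hw).2.1 _ (hb w' hw').2.1
    rwa [dist_eq_norm, dist_eq_norm] at this

open scoped ContDiff

def jphi {E : Type*} [NormedAddCommGroup E] [NormedSpace ℝ E] (J0 : E →L[ℝ] E) :
    ℂ →L[ℝ] E →L[ℝ] E :=
  Complex.reCLM.smulRight (ContinuousLinearMap.id ℝ E) + Complex.imCLM.smulRight J0

theorem jphi_apply {E : Type*} [NormedAddCommGroup E] [NormedSpace ℝ E] (J0 : E →L[ℝ] E)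
    (c : ℂ) (v : E) : jphi J0 c v = c.re • v + c.im • J0 v := by
  simp [jphi]

def dbar {E : Type*} [NormedAddCommGroup E] [NormedSpace ℝ E] (J0 : E →L[ℝ] E) (u : ℂ → E)
    (z : ℂ) : E := fderiv ℝ u z 1 + J0 (fderiv ℝ u z Complex.I)

def ddel {E : Type*} [NormedAddCommGroup E] [NormedSpace ℝ E] (J0 : E →L[ℝ] E) (u : ℂ → E)
    (z : ℂ) : E := fderiv ℝ u z 1 - J0 (fderiv ℝ u z Complex.I)

def kerC : ℂ → ℂ := fun ζ => ((2 * Real.pi)⁻¹ : ℝ) • ζ⁻¹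

theorem kerC_locInt : MeasureTheory.LocallyIntegrable kerC := by
  rw [MeasureTheory.locallyIntegrable_iff]
  intro K hK
  obtain ⟨R, hR_pos, hR⟩ := hK.isBounded.exists_pos_norm_lt
  refine (MeasureTheory.integrableOn_ball_of_norm_le_rpow (C := (2 * Real.pi)⁻¹) (α := 1) (r := R)
    ?_ ?_ ?_ ?_).mono_set (fun x hx => mem_ball_zero_iff.mpr <| hR x hx)
  · simp
  · simp
  · refine Eventually.of_forall fun x => ?_
    simp only [kerC, norm_smul, norm_inv, Real.rpow_neg_one]
    rw [Real.norm_of_nonneg Real.two_pi_pos.le]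
  · unfold kerC
    exact ((measurable_inv (G := ℂ)).const_smul ((2 * Real.pi)⁻¹ : ℝ)).aestronglyMeasurable

theorem pb_intOn {E : Type*} [NormedAddCommGroup E] [NormedSpace ℝ E] {g : ℝ × ℝ → E}
    (hg : Continuous g) {R : ℝ} (hR : ∀ r θ, R < r → g (r, θ) = 0) :
    MeasureTheory.IntegrableOn g (Ioi (0:ℝ) ×ˢ Ioo (-Real.pi) Real.pi) := by
  have h1 : MeasureTheory.IntegrableOn g (Icc (0:ℝ) R ×ˢ Icc (-Real.pi) Real.pi) :=
    hg.continuousOn.integrableOn_compact (isCompact_Icc.prod isCompact_Icc)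
  refine h1.of_forall_sdiff_eq_zero (measurableSet_Ioi.prod measurableSet_Ioo) ?_
  rintro ⟨r, θ⟩ ⟨⟨h1, h2⟩, h3⟩
  apply hR
  by_contra h
  exact h3 ⟨⟨le_of_lt h1, not_lt.1 h⟩, ⟨h2.1.le, h2.2.le⟩⟩

theorem pb_intOn' {E : Type*} [NormedAddCommGroup E] [NormedSpace ℝ E] {g : ℝ × ℝ → E}
    (hg : Continuous g) {R : ℝ} (hR : ∀ r θ, R < r → g (θ, r) = 0) :
    MeasureTheory.IntegrableOn g (Ioo (-Real.pi) Real.pi ×ˢ Ioi (0:ℝ)) := by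
  have h1 : MeasureTheory.IntegrableOn g (Icc (-Real.pi) Real.pi ×ˢ Icc (0:ℝ) R) :=
    hg.continuousOn.integrableOn_compact (isCompact_Icc.prod isCompact_Icc)
  refine h1.of_forall_sdiff_eq_zero (measurableSet_Ioo.prod measurableSet_Ioi) ?_
  rintro ⟨θ, r⟩ ⟨⟨h1, h2⟩, h3⟩
  apply hR
  by_contra h
  exact h3 ⟨⟨h1.1.le, h1.2.le⟩, ⟨le_of_lt h2, not_lt.1 h⟩⟩

theorem pb_pompeiu {E : Type*} [NormedAddCommGroup E] [NormedSpace ℝ E] [FiniteDimensional ℝ E]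
    {J0 : E →L[ℝ] E} (hJ0 : ∀ v, J0 (J0 v) = -v) {b : ℂ → E} (hb : ContDiff ℝ 1 b) 
    (hbs : HasCompactSupport b) (z : ℂ) :
    ∫ ζ, jphi J0 (kerC ζ) (dbar J0 b (z - ζ)) = b z := by
  have : CompleteSpace E := FiniteDimensional.complete ℝ E
  set e : ℝ → ℂ := fun θ => (Real.cos θ + Real.sin θ * Complex.I) with he
  have hec : Continuous e := by fun_prop
  have hen : ∀ θ, ‖e θ‖ = 1 := by
    intro θ
    rw [he]
    simp only
    rw [Complex.ofReal_cos, Complex.ofReal_sin, ← Complex.exp_mul_I]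
    exact Complex.norm_exp_ofReal_mul_I θ
  have hde : ∀ θ, HasDerivAt e (Complex.I * e θ) θ := by
    intro θ
    have h1 := ((Real.hasDerivAt_cos θ).ofReal_comp.add
      ((Real.hasDerivAt_sin θ).ofReal_comp.mul_const Complex.I))
    refine HasDerivAt.congr_deriv (f := e) h1 ?_
    simp only [he]
    push_cast
    ring_nf
    simp
  have hfc : Continuous (fderiv ℝ b) := hb.continuous_fderiv (by simp)
  set g1 : ℝ × ℝ → E := fun p => fderiv ℝ b (z - p.1 * e p.2) (e p.2) with hg1
  set g2 : ℝ × ℝ → E := fun p => fderiv ℝ b (z - p.1 * e p.2) (Complex.I * e p.2) with hg2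
  have hg1c : Continuous g1 := (hfc.comp (by fun_prop)).clm_apply (by fun_prop)
  have hg2c : Continuous g2 := (hfc.comp (by fun_prop)).clm_apply (by fun_prop)
  obtain ⟨R0, hR0⟩ := hbs.isCompact.isBounded.subset_closedBall (0:ℂ)
  set R := |R0| + ‖z‖ with hR
  have hfar : ∀ r θ, R < r → z - r * e θ ∉ tsupport b := by
    intro r θ hr h
    have h1 := mem_closedBall_zero_iff.1 (hR0 h)
    have h2 := norm_sub_norm_le (r * e θ) z
    rw [norm_mul, hen, Complex.norm_real, mul_one, norm_sub_rev] at h2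
    have := le_abs_self R0
    have := Real.le_norm_self r
    linarith
  have hfar' : ∀ r θ, R < r → fderiv ℝ b (z - r * e θ) = 0 := by
    intro r θ hr
    by_contra h
    exact hfar r θ hr (support_fderiv_subset ℝ (Function.mem_support.2 h))
  have hi1 := pb_intOn hg1c (R := R) (fun r θ hr => by simp [hg1, hfar' r θ hr])
  have hi2 := pb_intOn hg2c (R := R) (fun r θ hr => by simp [hg2, hfar' r θ hr])
  have I2 : ∫ p in (Ioi (0:ℝ) ×ˢ Ioo (-Real.pi) Real.pi), g2 p = 0 := by
    rw [MeasureTheory.Measure.volume_eq_prod] at hi2 ⊢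
    rw [MeasureTheory.setIntegral_prod _ hi2]
    refine MeasureTheory.setIntegral_eq_zero_of_forall_eq_zero fun r hr => ?_
    have hr : 0 < r := hr
    rw [← MeasureTheory.integral_Ioc_eq_integral_Ioo,
      ← intervalIntegral.integral_of_le (by linarith [Real.pi_pos])]
    have := intervalIntegral.integral_eq_sub_of_hasDerivAt (a := -Real.pi) (b := Real.pi)
      (f := fun θ => -(r⁻¹) • b (z - r * e θ)) (f' := fun θ => g2 (r, θ)) (fun θ _ => ?_) ?_
    · rw [this]
      simp [he]
    · have h1 : HasDerivAt (fun θ => z - r * e θ) (-(r * (Complex.I * e θ))) θ :=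
        ((hde θ).const_mul (r:ℂ)).const_sub z
      have h2 := ((hb.differentiable (by simp) (z - r * e θ)).hasFDerivAt.comp_hasDerivAt θ h1).const_smul (-(r⁻¹))
      refine HasDerivAt.congr_deriv (f := fun θ => -(r⁻¹) • b (z - r * e θ)) h2 ?_
      have h3 : (r:ℂ) * (Complex.I * e θ) = r • (Complex.I * e θ) := Complex.real_smul.symm
      rw [map_neg, h3, map_smul, neg_smul, smul_neg, neg_neg, smul_smul, inv_mul_cancel₀ hr.ne', one_smul]
    · exact (hg2c.comp (by fun_prop)).intervalIntegrable _ _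
  have I1 : ∫ p in (Ioi (0:ℝ) ×ˢ Ioo (-Real.pi) Real.pi), g1 p = (2 * Real.pi) • b z := by
    have hsw := pb_intOn' (g := fun p => g1 p.swap) (hg1c.comp continuous_swap) (R := R)
      (fun r θ hr => by simp [hg1, hfar' r θ hr])
    rw [MeasureTheory.Measure.volume_eq_prod] at hsw ⊢
    rw [← MeasureTheory.setIntegral_prod_swap, MeasureTheory.setIntegral_prod _ hsw]
    have h1 : ∀ θ, ∫ r in Ioi (0:ℝ), g1 (r, θ) = b z := by
      intro θ
      have := MeasureTheory.integral_Ioi_of_hasDerivAt_of_tendsto (a := 0) (m := 0)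
        (f := fun r : ℝ => - b (z - r * e θ)) (f' := fun r => g1 (r, θ)) ?_ (fun r _ => ?_) ?_ ?_
      · rw [this]; simp
      · have := hb.continuous
        exact Continuous.continuousWithinAt (by fun_prop)
      · have h1 : HasDerivAt (fun r : ℝ => z - r * e θ) (-(1 * e θ)) r :=
          ((HasDerivAt.ofReal_comp (hasDerivAt_id r)).mul_const (e θ)).const_sub z
        have h2 := ((hb.differentiable (by simp) (z - r * e θ)).hasFDerivAt.comp_hasDerivAt r h1).neg
        refine HasDerivAt.congr_deriv (f := fun r : ℝ => - b (z - r * e θ)) h2 ?_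
        rw [map_neg, neg_neg, one_mul]
      · have h1 : MeasureTheory.IntegrableOn (fun r => g1 (r, θ)) (Icc (0:ℝ) R) :=
          (hg1c.comp (by fun_prop)).continuousOn.integrableOn_compact isCompact_Icc
        refine h1.of_forall_sdiff_eq_zero measurableSet_Ioi ?_
        rintro r ⟨h1, h3⟩
        have : R < r := by
          by_contra h
          exact h3 ⟨le_of_lt h1, not_lt.1 h⟩
        simp [hg1, hfar' r θ this]
      · refine tendsto_const_nhds.congr' ?_
        filter_upwards [eventually_gt_atTop R] with r hr
        rw [image_eq_zero_of_notMem_tsupport (hfar r θ hr), neg_zero]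
    simp only [Prod.swap_prod_mk, h1]
    rw [MeasureTheory.setIntegral_const]
    congr 1
    rw [MeasureTheory.measureReal_def, Real.volume_Ioo, ENNReal.toReal_ofReal (by linarith [Real.pi_pos])]
    ring
  rw [← Complex.integral_comp_polarCoord_symm]
  have hcong : ∫ p in polarCoord.target, p.1 • jphi J0 (kerC (Complex.polarCoord.symm p))
      (dbar J0 b (z - Complex.polarCoord.symm p)) =
      ∫ p in (Ioi (0:ℝ) ×ˢ Ioo (-Real.pi) Real.pi), (2 * Real.pi)⁻¹ • (g1 p + J0 (g2 p)) := by
    refine MeasureTheory.setIntegral_congr_fun (measurableSet_Ioi.prod measurableSet_Ioo) ?_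
    rintro ⟨r, θ⟩ ⟨hr, hθ⟩
    have hr : 0 < r := hr
    have hs : Complex.polarCoord.symm (r, θ) = r * e θ := by simp [he]
    have hk : kerC (r * e θ) = ((2 * Real.pi)⁻¹ * r⁻¹ : ℝ) • (Real.cos θ - Real.sin θ * Complex.I : ℂ) := by
      have h1 : e θ * (Real.cos θ - Real.sin θ * Complex.I : ℂ) = 1 := by
        have h2 : ((Real.sin θ ^ 2 + Real.cos θ ^ 2 : ℝ):ℂ) = 1 := by
          rw [Real.sin_sq_add_cos_sq θ]; simp
        rw [Complex.ofReal_add, Complex.ofReal_pow, Complex.ofReal_pow] at h2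
        simp only [he]
        linear_combination h2 - (Real.sin θ : ℂ) ^ 2 * Complex.I_sq
      have h2 : (e θ)⁻¹ = (Real.cos θ - Real.sin θ * Complex.I : ℂ) := inv_eq_of_mul_eq_one_right h1
      have h3 : ((r:ℂ) * e θ)⁻¹ = r⁻¹ • (e θ)⁻¹ := by
        rw [mul_inv, Complex.real_smul, Complex.ofReal_inv]
      rw [← h2, kerC, mul_smul, h3]
    simp only [hs, hk, hg1, hg2, jphi_apply, dbar]
    have he1 : e θ = Real.cos θ • (1:ℂ) + Real.sin θ • Complex.I := by simp [he]
    have he2 : Complex.I * e θ = Real.cos θ • Complex.I - Real.sin θ • (1:ℂ) := by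
      rw [he1]
      simp [mul_add]
      ring_nf
      simp
      ring
    set T := fderiv ℝ b (z - r * e θ)
    rw [he2]
    have h5 : T (e θ) = Real.cos θ • T 1 + Real.sin θ • T Complex.I := by
      conv_lhs => rw [he1]
      rw [map_add, map_smul, map_smul]
    have hre : (((2 * Real.pi)⁻¹ * r⁻¹) • ((Real.cos θ : ℂ) - (Real.sin θ : ℂ) * Complex.I)).re =
        ((2 * Real.pi)⁻¹ * r⁻¹) * Real.cos θ := by
      rw [Complex.smul_re]; simp [-Complex.ofReal_cos, -Complex.ofReal_sin]
    have him : (((2 * Real.pi)⁻¹ * r⁻¹) • ((Real.cos θ : ℂ) - (Real.sin θ : ℂ) * Complex.I)).im =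
        -(((2 * Real.pi)⁻¹ * r⁻¹) * Real.sin θ) := by
      rw [Complex.smul_im]; simp [-Complex.ofReal_cos, -Complex.ofReal_sin]
    rw [hre, him, h5]
    simp only [map_add, map_sub, map_smul, hJ0]
    match_scalars <;> field_simp
  rw [hcong, MeasureTheory.integral_smul, MeasureTheory.integral_add hi1 (J0.integrable_comp hi2),
    ContinuousLinearMap.integral_comp_comm _ hi2, I1, I2]
  rw [map_zero, add_zero, smul_smul, inv_mul_cancel₀ Real.two_pi_pos.ne', one_smul]

def cauchyP {E : Type*} [NormedAddCommGroup E] [NormedSpace ℝ E] (J0 : E →L[ℝ] E) (a : ℂ → E) :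
    ℂ → E := MeasureTheory.convolution kerC a (jphi J0) MeasureTheory.volume

theorem supp_of_zero {E : Type*} [NormedAddCommGroup E] [NormedSpace ℝ E] {a : ℂ → E}
    (hs : ∀ z, 2 < ‖z‖ → a z = 0) : HasCompactSupport a := by
  refine HasCompactSupport.intro (isCompact_closedBall (0:ℂ) 2) fun z hz => hs z ?_
  simpa using hz

theorem fderiv_zero_of_zero {E : Type*} [NormedAddCommGroup E] [NormedSpace ℝ E] {a : ℂ → E}
    (hs : ∀ z, 2 < ‖z‖ → a z = 0) (z : ℂ) (hz : 2 < ‖z‖) : fderiv ℝ a z = 0 := by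
  have h : a =ᶠ[𝓝 z] fun _ => 0 := by
    filter_upwards [(isOpen_lt continuous_const continuous_norm).mem_nhds hz] with w hw
    exact hs w hw
  rw [h.fderiv_eq]; simp

theorem contDiff_dir {E : Type*} [NormedAddCommGroup E] [NormedSpace ℝ E] {a : ℂ → E}
    (ha : ContDiff ℝ ∞ a) (ξ : ℂ) : ContDiff ℝ ∞ (fun w => fderiv ℝ a w ξ) :=
  (ha.fderiv_right (m := ∞) (by simp)).clm_apply contDiff_const

theorem contDiff_ddel {E : Type*} [NormedAddCommGroup E] [NormedSpace ℝ E] {a : ℂ → E}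
    (J0 : E →L[ℝ] E) (ha : ContDiff ℝ ∞ a) : ContDiff ℝ ∞ (ddel J0 a) :=
  (contDiff_dir ha 1).sub (J0.contDiff.comp (contDiff_dir ha Complex.I))

theorem contDiff_dbar {E : Type*} [NormedAddCommGroup E] [NormedSpace ℝ E] {a : ℂ → E}
    (J0 : E →L[ℝ] E) (ha : ContDiff ℝ ∞ a) : ContDiff ℝ ∞ (dbar J0 a) :=
  (contDiff_dir ha 1).add (J0.contDiff.comp (contDiff_dir ha Complex.I))

theorem cP_contDiff {E : Type*} [NormedAddCommGroup E] [NormedSpace ℝ E] [FiniteDimensional ℝ E]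
    (J0 : E →L[ℝ] E) {a : ℂ → E} (ha : ContDiff ℝ ∞ a) (hs : ∀ z, 2 < ‖z‖ → a z = 0) :
    ContDiff ℝ ∞ (cauchyP J0 a) :=
  (supp_of_zero hs).contDiff_convolution_right (n := ⊤) _ kerC_locInt ha

theorem cP_fderiv {E : Type*} [NormedAddCommGroup E] [NormedSpace ℝ E] [FiniteDimensional ℝ E]
    (J0 : E →L[ℝ] E) {a : ℂ → E} (ha : ContDiff ℝ ∞ a) (hs : ∀ z, 2 < ‖z‖ → a z = 0) (z ξ : ℂ) :
    fderiv ℝ (cauchyP J0 a) z ξ = cauchyP J0 (fun w => fderiv ℝ a w ξ) z := by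
  have : CompleteSpace E := FiniteDimensional.complete ℝ E
  have h1 := (supp_of_zero hs).hasFDerivAt_convolution_right (jphi J0) kerC_locInt
    (ha.of_le (by exact_mod_cast le_top)) z
  have h2 : HasFDerivAt (cauchyP J0 a) _ z := h1
  rw [h2.fderiv]
  exact MeasureTheory.convolution_precompR_apply _ kerC_locInt ((supp_of_zero hs).fderiv (𝕜 := ℝ))
    (ha.continuous_fderiv (by simp)) z ξ

theorem cP_lin {E : Type*} [NormedAddCommGroup E] [NormedSpace ℝ E] [FiniteDimensional ℝ E]
    (J0 : E →L[ℝ] E) {a b : ℂ → E} (ha : Continuous a) (hs : ∀ z, 2 < ‖z‖ → a z = 0)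
    (hb : Continuous b) (hsb : ∀ z, 2 < ‖z‖ → b z = 0) (s : ℝ) (z : ℂ) :
    cauchyP J0 a z + s • J0 (cauchyP J0 b z) = cauchyP J0 (fun w => a w + s • J0 (b w)) z := by
  have : CompleteSpace E := FiniteDimensional.complete ℝ E
  have h1 := (supp_of_zero hs).convolutionExists_right (jphi J0) kerC_locInt ha z
  have h2 := (supp_of_zero hsb).convolutionExists_right (jphi J0) kerC_locInt hb z
  simp only [cauchyP, MeasureTheory.convolution_def]
  rw [← ContinuousLinearMap.integral_comp_comm _ h2, ← MeasureTheory.integral_smul,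
    ← MeasureTheory.integral_add h1
      (show MeasureTheory.Integrable (fun ζ => s • J0 (jphi J0 (kerC ζ) (b (z - ζ)))) from
        (J0.integrable_comp h2).smul s)]
  congr 1
  ext ζ
  simp only [jphi_apply, map_add, map_smul]

theorem cP_ddel {E : Type*} [NormedAddCommGroup E] [NormedSpace ℝ E] [FiniteDimensional ℝ E]
    (J0 : E →L[ℝ] E) {a : ℂ → E} (ha : ContDiff ℝ ∞ a) (hs : ∀ z, 2 < ‖z‖ → a z = 0) (z : ℂ) :
    ddel J0 (cauchyP J0 a) z = cauchyP J0 (ddel J0 a) z := by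
  rw [ddel, cP_fderiv J0 ha hs, cP_fderiv J0 ha hs]
  have := cP_lin J0 (a := fun w => fderiv ℝ a w 1) (b := fun w => fderiv ℝ a w Complex.I)
    (contDiff_dir ha 1).continuous
    (fun z hz => by simp [fderiv_zero_of_zero hs z hz]) (contDiff_dir ha Complex.I).continuous
    (fun z hz => by simp [fderiv_zero_of_zero hs z hz]) (-1) z
  simp only [neg_smul, one_smul, ← sub_eq_add_neg] at this
  exact this

theorem cP_dbar {E : Type*} [NormedAddCommGroup E] [NormedSpace ℝ E] [FiniteDimensional ℝ E]
    (J0 : E →L[ℝ] E) (hJ0 : ∀ v, J0 (J0 v) = -v)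
    {a : ℂ → E} (ha : ContDiff ℝ ∞ a) (hs : ∀ z, 2 < ‖z‖ → a z = 0) (z : ℂ) :
    dbar J0 (cauchyP J0 a) z = a z := by
  rw [dbar, cP_fderiv J0 ha hs, cP_fderiv J0 ha hs]
  have := cP_lin J0 (a := fun w => fderiv ℝ a w 1) (b := fun w => fderiv ℝ a w Complex.I)
    (contDiff_dir ha 1).continuous
    (fun z hz => by simp [fderiv_zero_of_zero hs z hz]) (contDiff_dir ha Complex.I).continuous
    (fun z hz => by simp [fderiv_zero_of_zero hs z hz]) 1 z
  simp only [one_smul] at this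
  rw [this]
  exact pb_pompeiu hJ0 (ha.of_le (by exact_mod_cast le_top)) (supp_of_zero hs) z

theorem cP_bound {E : Type*} [NormedAddCommGroup E] [NormedSpace ℝ E] [FiniteDimensional ℝ E]
    (J0 : E →L[ℝ] E) : ∃ κ : ℝ, 0 ≤ κ ∧ ∀ (a : ℂ → E) (m : ℝ), 0 ≤ m → (∀ z, 2 < ‖z‖ → a z = 0) →
      (∀ z, ‖a z‖ ≤ m) → ∀ z, ‖z‖ ≤ 2 → ‖cauchyP J0 a z‖ ≤ κ * m := by
  set g : ℂ → ℝ := (closedBall (0:ℂ) 4).indicator (fun ζ => ‖jphi J0‖ * ‖kerC ζ‖) with hg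
  have hgi : MeasureTheory.Integrable g := by
    rw [hg, MeasureTheory.integrable_indicator_iff measurableSet_closedBall]
    exact ((kerC_locInt.integrableOn_isCompact (isCompact_closedBall 0 4)).norm).const_mul _
  have hg0 : ∀ ζ, 0 ≤ g ζ := fun ζ => Set.indicator_nonneg (fun _ _ => by positivity) ζ
  refine ⟨∫ ζ, g ζ, MeasureTheory.integral_nonneg hg0, fun a m hm hs ha z hz => ?_⟩
  rw [cauchyP, MeasureTheory.convolution_def, ← MeasureTheory.integral_mul_const]
  refine MeasureTheory.norm_integral_le_of_norm_le (hgi.mul_const m) (Eventually.of_forall fun ζ => ?_)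
  by_cases hζ : ζ ∈ closedBall (0:ℂ) 4
  · rw [hg, Set.indicator_of_mem hζ]
    calc _ ≤ ‖jphi J0‖ * ‖kerC ζ‖ * ‖a (z - ζ)‖ := (jphi J0).le_opNorm₂ _ _
      _ ≤ _ := by gcongr; exact ha _
  · have h1 : 4 < ‖ζ‖ := by simpa using hζ
    have h2 : 2 < ‖z - ζ‖ := by
      have := norm_sub_norm_le ζ z
      rw [norm_sub_rev] at this
      linarith
    rw [hs _ h2]
    simpa using mul_nonneg (hg0 ζ) hm

theorem clm_le {E : Type*} [NormedAddCommGroup E] [NormedSpace ℝ E] (T : ℂ →L[ℝ] E) :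
    ‖T‖ ≤ ‖T 1‖ + ‖T Complex.I‖ := by
  refine ContinuousLinearMap.opNorm_le_bound _ (by positivity) fun ξ => ?_
  have h1 : ξ = ξ.re • (1:ℂ) + ξ.im • Complex.I := by
    simp only [Complex.real_smul, mul_one]
    rw [Complex.re_add_im]
  calc ‖T ξ‖ = ‖ξ.re • T 1 + ξ.im • T Complex.I‖ := by
        conv_lhs => rw [h1]
        rw [map_add, map_smul, map_smul]
    _ ≤ ‖ξ.re • T 1‖ + ‖ξ.im • T Complex.I‖ := norm_add_le _ _
    _ ≤ ‖ξ‖ * ‖T 1‖ + ‖ξ‖ * ‖T Complex.I‖ := by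
      rw [norm_smul, norm_smul]
      gcongr
      · exact Complex.abs_re_le_norm ξ
      · exact Complex.abs_im_le_norm ξ
    _ = _ := by ring

theorem pb_T {E : Type*} [NormedAddCommGroup E] [NormedSpace ℝ E] [FiniteDimensional ℝ E]
    (J0 : E →L[ℝ] E) (hJ0 : ∀ v, J0 (J0 v) = -v) : ∃ C : ℝ, 0 ≤ C ∧
    ∀ (a : ℂ → E) (m t : ℝ), 0 ≤ m → 0 < t → t ≤ 1 → ContDiff ℝ ∞ a → (∀ z, 2 < ‖z‖ → a z = 0) →
      (∀ z, ‖a z‖ ≤ m) → (∀ z, ‖ddel J0 a z‖ ≤ m) → ∃ u : ℂ → E, ContDiff ℝ ∞ u ∧ u 0 = 0 ∧ u t = 0 ∧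
      (∀ z, dbar J0 u z = a z) ∧ (∀ z, dbar J0 (ddel J0 u) z = ddel J0 a z) ∧
      ∀ z, ‖z‖ ≤ 2 → ‖u z‖ ≤ C * m ∧ ‖fderiv ℝ u z 1‖ ≤ C * m ∧ ‖fderiv ℝ u z Complex.I‖ ≤ C * m := by
  obtain ⟨κ, hκ, hP⟩ := cP_bound J0
  set q := (1 + ‖J0‖) * (1 + κ) with hq
  have hq0 : 0 ≤ q := by positivity
  refine ⟨2 * κ + q + 2 * ‖jphi J0‖ * q, by positivity, ?_⟩
  intro a m t hm ht0 ht1 ha hs ham hdm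
  set p := cauchyP J0 a with hp
  have hpc : ContDiff ℝ ∞ p := cP_contDiff J0 ha hs
  have hpd : Differentiable ℝ p := hpc.differentiable (by simp)
  have hs' : ∀ z, 2 < ‖z‖ → ddel J0 a z = 0 := fun z hz => by
    simp [ddel, fderiv_zero_of_zero hs z hz]
  have hpb : ∀ z, ‖z‖ ≤ 2 → ‖fderiv ℝ p z 1‖ + ‖fderiv ℝ p z Complex.I‖ ≤ q * m := by
    intro z hz
    have h1 : ‖dbar J0 p z‖ ≤ m := by rw [cP_dbar J0 hJ0 ha hs]; exact ham z
    have h2 : ‖ddel J0 p z‖ ≤ κ * m := by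
      rw [cP_ddel J0 ha hs]; exact hP _ m hm hs' hdm z hz
    have h3 : fderiv ℝ p z 1 = (2⁻¹ : ℝ) • (dbar J0 p z + ddel J0 p z) := by
      simp only [dbar, ddel]; module
    have h4 : fderiv ℝ p z Complex.I = (2⁻¹ : ℝ) • J0 (ddel J0 p z - dbar J0 p z) := by
      simp only [dbar, ddel, map_sub, map_add, hJ0]; module
    have h5 : ‖fderiv ℝ p z 1‖ ≤ (1 + κ) * m := by
      rw [h3, norm_smul]
      have := norm_add_le (dbar J0 p z) (ddel J0 p z)
      norm_num
      nlinarith [norm_nonneg (dbar J0 p z + ddel J0 p z)]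
    have h6 : ‖fderiv ℝ p z Complex.I‖ ≤ ‖J0‖ * ((1 + κ) * m) := by
      rw [h4, norm_smul]
      have h7 := norm_sub_le (ddel J0 p z) (dbar J0 p z)
      have h8 : ‖J0 (ddel J0 p z - dbar J0 p z)‖ ≤ ‖J0‖ * ((1 + κ) * m) :=
        (J0.le_opNorm _).trans (by gcongr; linarith)
      rw [Real.norm_of_nonneg (by norm_num)]
      linarith [norm_nonneg (J0 (ddel J0 p z - dbar J0 p z))]
    rw [hq]; linarith
  set c : E := t⁻¹ • (p t - p 0) with hc
  have hcb : ‖c‖ ≤ q * m := by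
    have h1 : ‖p t - p 0‖ ≤ q * m * ‖(t:ℂ) - 0‖ := by
      refine Convex.norm_image_sub_le_of_norm_fderiv_le (𝕜 := ℝ) (s := closedBall (0:ℂ) 2)
        (fun z _ => hpd z) (fun z hz => (clm_le _).trans (hpb z (by simpa using hz)))
        (convex_closedBall _ _) (by simp) ?_
      simp [abs_of_pos ht0]; linarith
    rw [hc, norm_smul, norm_inv, Real.norm_of_nonneg ht0.le, inv_mul_le_iff₀ ht0]
    refine h1.trans (le_of_eq ?_)
    simp [abs_of_pos ht0]; ring
  set ℓ : ℂ →L[ℝ] E := (jphi J0).flip c with hℓ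
  have hℓa : ∀ ξ, ℓ ξ = jphi J0 ξ c := fun ξ => rfl
  have hℓb : ∀ ξ, ‖ξ‖ ≤ 2 → ‖ℓ ξ‖ ≤ ‖jphi J0‖ * ‖ξ‖ * (q * m) := by
    intro ξ hξ
    exact ((jphi J0).le_opNorm₂ ξ c).trans (by gcongr)
  have hℓ1 : ℓ 1 = c := by rw [hℓa, jphi_apply]; simp
  have hℓI : ℓ Complex.I = J0 c := by rw [hℓa, jphi_apply]; simp
  set u : ℂ → E := fun z => p z - p 0 - ℓ z with hu
  have hud : ∀ z, fderiv ℝ u z = fderiv ℝ p z - ℓ := by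
    intro z
    exact (((hpd z).hasFDerivAt.sub_const (p 0)).sub ℓ.hasFDerivAt).fderiv
  have huddel : ddel J0 u = fun z => cauchyP J0 (ddel J0 a) z - (2:ℝ) • c := by
    ext z
    rw [← cP_ddel J0 ha hs]
    simp only [ddel, hud, sub_apply, hℓ1, hℓI, map_sub, hJ0, ← hp]
    module
  have hqm : 0 ≤ q * m := by positivity
  have hjq : 0 ≤ ‖jphi J0‖ * (q * m) := by positivity
  have hκm : 0 ≤ κ * m := by positivity
  refine ⟨u, (hpc.sub contDiff_const).sub ℓ.contDiff, by simp [hu], ?_, ?_, ?_, ?_⟩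
  · have h1 : ℓ t = t • c := by rw [hℓa, jphi_apply]; simp
    simp only [hu, h1, hc]
    rw [smul_smul, mul_inv_cancel₀ ht0.ne', one_smul, sub_self]
  · intro z
    rw [← cP_dbar J0 hJ0 ha hs]
    simp only [dbar, hud, sub_apply, hℓ1, hℓI, map_sub, hJ0, ← hp]
    module
  · intro z
    have h1 : fderiv ℝ (ddel J0 u) z = fderiv ℝ (cauchyP J0 (ddel J0 a)) z := by
      rw [huddel, fderiv_sub_const]
    have h2 := cP_dbar J0 hJ0 (contDiff_ddel J0 ha) hs' z
    rw [dbar] at h2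
    rw [dbar, h1, h2]
  · intro z hz
    have h1 := hpb z hz
    refine ⟨?_, ?_, ?_⟩
    · have h2 := hP a m hm hs ham z hz
      have h3 := hP a m hm hs ham 0 (by simp)
      have h4 := hℓb z hz
      have h5 : ‖jphi J0‖ * ‖z‖ * (q * m) ≤ ‖jphi J0‖ * 2 * (q * m) := by gcongr
      have h6 := norm_sub_le (p z - p 0) (ℓ z)
      have h7 := norm_sub_le (p z) (p 0)
      simp only [hu]
      linarith
    · have h4 := hℓb 1 (by simp)
      rw [norm_one] at h4
      rw [hud, sub_apply]
      have h6 := norm_sub_le (fderiv ℝ p z 1) (ℓ 1)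
      linarith [norm_nonneg (fderiv ℝ p z Complex.I)]
    · have h4 := hℓb Complex.I (by simp)
      rw [Complex.norm_I] at h4
      rw [hud, sub_apply]
      have h6 := norm_sub_le (fderiv ℝ p z Complex.I) (ℓ Complex.I)
      linarith [norm_nonneg (fderiv ℝ p z 1)]

theorem pb_S {E : Type*} [NormedAddCommGroup E] [NormedSpace ℝ E] [FiniteDimensional ℝ E]
    {U : Set E} (hU : IsOpen U) {p : E} (hp : p ∈ U) {J : E → E →L[ℝ] E}
    (hJs : ContDiffOn ℝ ∞ J U) (hJJ : ∀ x ∈ U, J x * J x = -1) :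
    ∃ S : E → E →L[ℝ] E, ContDiff ℝ ∞ S ∧ S p = 0 ∧ (∀ x v, S x (J p v) = - J p (S x v)) ∧
      ∃ ρ > 0, ball p ρ ⊆ U ∧ ∀ x ∈ ball p ρ, ∀ a b, a + J p b = S x (a - J p b) → b = J x a := by
  have : CompleteSpace E := FiniteDimensional.complete ℝ E
  have hJ0 : J p * J p = -1 := hJJ p hp
  set J0 := J p with hJ0d
  set M : E → E →L[ℝ] E := fun x => 1 - J x * J0 with hM
  have hMs : ContDiffOn ℝ ∞ M U :=
    contDiffOn_const.sub (hJs.mul contDiffOn_const)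
  have hVo : IsOpen (U ∩ M ⁻¹' {a | IsUnit a}) :=
    hMs.continuousOn.isOpen_inter_preimage hU Units.isOpen
  have hMp : M p = (2:ℝ) • (1 : E →L[ℝ] E) := by
    simp only [hM]; rw [← hJ0d, hJ0, two_smul]; abel
  have hpV : p ∈ U ∩ M ⁻¹' {a | IsUnit a} := by
    refine ⟨hp, ?_⟩
    show IsUnit (M p)
    rw [hMp]
    refine ⟨⟨(2:ℝ) • 1, (2⁻¹:ℝ) • 1, ?_, ?_⟩, rfl⟩ <;>
    · rw [smul_mul_smul_comm]; norm_num
  obtain ⟨r, hr, hrV⟩ := Metric.isOpen_iff.1 hVo p hpV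
  set ψ : ContDiffBump p := ⟨r / 4, r / 2, by positivity, by linarith⟩ with hψ
  set S0 : E → E →L[ℝ] E := fun x => -(Ring.inverse (M x) * (1 + J x * J0)) with hS0
  have hS0s : ContDiffOn ℝ ∞ S0 (U ∩ M ⁻¹' {a | IsUnit a}) := by
    refine (ContDiffOn.mul ?_ (contDiffOn_const.add ((hJs.mono inter_subset_left).mul contDiffOn_const))).neg
    intro x hx
    obtain ⟨u, hu⟩ := hx.2
    have h1 : ContDiffAt ℝ ∞ Ring.inverse (M x) := by
      rw [← hu]; exact contDiffAt_ringInverse ℝ u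
    exact h1.comp_contDiffWithinAt x ((hMs x hx.1).mono inter_subset_left)
  refine ⟨fun x => ψ x • S0 x, ?_, ?_, ?_, r / 4, by positivity, ?_, ?_⟩
  · rw [contDiff_iff_contDiffAt]
    intro x
    by_cases hx : x ∈ ball p r
    · exact ψ.contDiff.contDiffAt.smul ((hS0s x (hrV hx)).contDiffAt (hVo.mem_nhds (hrV hx)))
    · have : (fun x => ψ x • S0 x) =ᶠ[𝓝 x] fun _ => 0 := by
        have hx' : x ∈ (closedBall p (r/2))ᶜ := by
          simp only [mem_compl_iff, mem_closedBall, mem_ball, not_lt, not_le] at hx ⊢; linarith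
        filter_upwards [isClosed_closedBall.isOpen_compl.mem_nhds hx'] with y hy
        rw [ψ.zero_of_le_dist, zero_smul]
        simp only [mem_compl_iff, mem_closedBall, not_le] at hy
        exact hy.le
      exact contDiffAt_const.congr_of_eventuallyEq this
  · simp only [hS0]
    rw [← hJ0d, hJ0]; simp
  · intro x v
    by_cases hx : x ∈ ball p r
    · obtain ⟨hxU, u, hu⟩ := hrV hx
      have hJx := hJJ x hxU
      have e1 : J x * M x = M x * J0 := by
        simp only [hM, mul_sub, sub_mul, mul_one, one_mul]
        rw [← mul_assoc, hJx, mul_assoc, hJ0]; noncomm_ring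
      have e2 : (1 + J x * J0) * J0 = -(J x * (1 + J x * J0)) := by
        simp only [mul_add, add_mul, mul_one, one_mul]
        rw [← mul_assoc, hJx, mul_assoc, hJ0]; noncomm_ring
      have e3 : Ring.inverse (M x) * J x = J0 * Ring.inverse (M x) := by
        rw [← hu, Ring.inverse_unit]
        rw [← hu] at e1
        calc (↑u⁻¹ : E →L[ℝ] E) * J x = ↑u⁻¹ * (J x * ↑u) * ↑u⁻¹ := by
              rw [mul_assoc, mul_assoc, Units.mul_inv, mul_one]
          _ = _ := by rw [e1, ← mul_assoc, Units.inv_mul, one_mul]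
      have e4 : S0 x * J0 = -(J0 * S0 x) := by
        simp only [hS0]
        rw [neg_mul, mul_assoc, e2, mul_neg, ← mul_assoc, e3]; noncomm_ring
      have := congrArg (fun T : E →L[ℝ] E => T v) e4
      change S0 x (J0 v) = -(J0 (S0 x v)) at this
      simp [this]
    · have : ψ x = 0 := by
        apply ψ.zero_of_le_dist
        simp only [mem_ball, not_lt] at hx
        show r / 2 ≤ _
        linarith
      simp [this]
  · exact (ball_subset_ball (by linarith)).trans (hrV.trans inter_subset_left)
  · intro x hx a b hab
    have hxr : x ∈ ball p r := ball_subset_ball (by linarith) hx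
    obtain ⟨hxU, u, hu⟩ := hrV hxr
    have h1 : ψ x = 1 := ψ.one_of_mem_closedBall (ball_subset_closedBall hx)
    simp only [h1, one_smul] at hab
    have e5 : M x * S0 x = -(1 + J x * J0) := by
      simp only [hS0]
      rw [mul_neg, ← mul_assoc, Ring.mul_inverse_cancel _ ⟨u, hu⟩, one_mul]
    have hab2 := congrArg (M x) hab
    have e6 := congrArg (fun T : E →L[ℝ] E => T (a - J0 b)) e5
    change M x (S0 x (a - J0 b)) = _ at e6
    rw [e6] at hab2
    have hJ0' : ∀ v, J0 (J0 v) = -v := fun v => by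
      have := congrArg (fun T : E →L[ℝ] E => T v) hJ0
      simpa using this
    have hJx' : ∀ v, J x (J x v) = -v := fun v => by
      have := congrArg (fun T : E →L[ℝ] E => T v) (hJJ x hxU)
      simpa using this
    have emul : ∀ (A B : E →L[ℝ] E) v, (A * B) v = A (B v) := fun A B v => rfl
    simp only [hM, sub_apply, neg_apply, add_apply, ContinuousLinearMap.one_apply,
      emul, map_add, map_sub, hJ0', map_neg] at hab2
    have h2 : (2:ℝ) • (a + J x b) = 0 := by
      have := sub_eq_zero.2 hab2
      rw [← this]; module
    have h3 : a = - J x b := by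
      have := (smul_eq_zero.1 h2).resolve_left (by norm_num)
      exact eq_neg_of_add_eq_zero_left this
    rw [h3, map_neg, hJx', neg_neg]

def aop {E : Type*} [NormedAddCommGroup E] [NormedSpace ℝ E] (J0 : E →L[ℝ] E)
    (S : E → E →L[ℝ] E) (χ : ℂ → ℝ) (f : ℂ → E) (z : ℂ) : E := χ z • S (f z) (ddel J0 f z)

theorem aop_contDiff {E : Type*} [NormedAddCommGroup E] [NormedSpace ℝ E] (J0 : E →L[ℝ] E)
    {S : E → E →L[ℝ] E} {χ : ℂ → ℝ} (hS : ContDiff ℝ ∞ S) (hχ : ContDiff ℝ ∞ χ) {f : ℂ → E}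
    (hf : ContDiff ℝ ∞ f) : ContDiff ℝ ∞ (aop J0 S χ f) :=
  hχ.smul ((hS.comp hf).clm_apply (contDiff_ddel J0 hf))

theorem aop_fderiv {E : Type*} [NormedAddCommGroup E] [NormedSpace ℝ E] (J0 : E →L[ℝ] E)
    {S : E → E →L[ℝ] E} {χ : ℂ → ℝ} (hS : ContDiff ℝ ∞ S) (hχ : ContDiff ℝ ∞ χ) {f : ℂ → E}
    (hf : ContDiff ℝ ∞ f) (z ξ : ℂ) : fderiv ℝ (aop J0 S χ f) z ξ =
      χ z • (S (f z) (fderiv ℝ (ddel J0 f) z ξ) + fderiv ℝ S (f z) (fderiv ℝ f z ξ) (ddel J0 f z))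
      + fderiv ℝ χ z ξ • S (f z) (ddel J0 f z) := by
  have h1 : HasFDerivAt χ (fderiv ℝ χ z) z := (hχ.differentiable (by simp) z).hasFDerivAt
  have h2 : HasFDerivAt S (fderiv ℝ S (f z)) (f z) :=
    (hS.differentiable (by simp) _).hasFDerivAt
  have h3 : HasFDerivAt f (fderiv ℝ f z) z := (hf.differentiable (by simp) z).hasFDerivAt
  have h4 : HasFDerivAt (ddel J0 f) (fderiv ℝ (ddel J0 f) z) z :=
    ((contDiff_ddel J0 hf).differentiable (by simp) z).hasFDerivAt
  have h5 := h1.smul ((h2.comp z h3).clm_apply h4)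
  have h6 : HasFDerivAt (aop J0 S χ f) _ z := h5
  rw [h6.fderiv]
  simp

theorem aop_ddel {E : Type*} [NormedAddCommGroup E] [NormedSpace ℝ E] (J0 : E →L[ℝ] E)
    {S : E → E →L[ℝ] E} {χ : ℂ → ℝ} (hS : ContDiff ℝ ∞ S) (hχ : ContDiff ℝ ∞ χ)
    (hSJ : ∀ x v, S x (J0 v) = - J0 (S x v)) {f : ℂ → E}
    (hf : ContDiff ℝ ∞ f) (z : ℂ) : ddel J0 (aop J0 S χ f) z =
      fderiv ℝ χ z 1 • S (f z) (ddel J0 f z) - fderiv ℝ χ z Complex.I • J0 (S (f z) (ddel J0 f z))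
      + χ z • fderiv ℝ S (f z) (fderiv ℝ f z 1) (ddel J0 f z)
      - χ z • J0 (fderiv ℝ S (f z) (fderiv ℝ f z Complex.I) (ddel J0 f z))
      + χ z • S (f z) (dbar J0 (ddel J0 f) z) := by
  rw [ddel, aop_fderiv J0 hS hχ hf, aop_fderiv J0 hS hχ hf, dbar]
  simp only [map_add, map_smul, hSJ]
  module

theorem clm_bil {E : Type*} [NormedAddCommGroup E] [NormedSpace ℝ E] (A B : E →L[ℝ] E) (v w : E)
    {α β a b : ℝ} (h1 : ‖A - B‖ ≤ α) (h2 : ‖v‖ ≤ a) (h3 : ‖B‖ ≤ β) (h4 : ‖v - w‖ ≤ b) :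
    ‖A v - B w‖ ≤ α * a + β * b := by
  have h : A v - B w = (A - B) v + B (v - w) := by simp
  rw [h]
  refine (norm_add_le _ _).trans (add_le_add ?_ ?_)
  · exact ((A - B).le_opNorm v).trans (mul_le_mul h1 h2 (norm_nonneg _) ((norm_nonneg _).trans h1))
  · exact (B.le_opNorm _).trans (mul_le_mul h3 h4 (norm_nonneg _) ((norm_nonneg _).trans h3))

def Good {E : Type*} [NormedAddCommGroup E] [NormedSpace ℝ E] (J0 : E →L[ℝ] E) (p : E) (ε : ℝ)
    (f : ℂ → E) : Prop := ContDiff ℝ ∞ f ∧ ∀ z, ‖z‖ ≤ 2 → ‖f z - p‖ ≤ ε ∧ ‖fderiv ℝ f z 1‖ ≤ ε ∧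
      ‖fderiv ℝ f z Complex.I‖ ≤ ε ∧ ‖dbar J0 (ddel J0 f) z‖ ≤ ε

def Close {E : Type*} [NormedAddCommGroup E] [NormedSpace ℝ E] (J0 : E →L[ℝ] E) (δ : ℝ)
    (f g : ℂ → E) : Prop := ∀ z, ‖z‖ ≤ 2 → ‖f z - g z‖ ≤ δ ∧ ‖fderiv ℝ f z 1 - fderiv ℝ g z 1‖ ≤ δ ∧
      ‖fderiv ℝ f z Complex.I - fderiv ℝ g z Complex.I‖ ≤ δ ∧
      ‖dbar J0 (ddel J0 f) z - dbar J0 (ddel J0 g) z‖ ≤ δ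

theorem aop_zero {E : Type*} [NormedAddCommGroup E] [NormedSpace ℝ E] (J0 : E →L[ℝ] E)
    {S : E → E →L[ℝ] E} {χ : ℂ → ℝ} (hχ0 : ∀ z, 2 < ‖z‖ → χ z = 0) (f : ℂ → E) (z : ℂ)
    (hz : 2 < ‖z‖) : aop J0 S χ f z = 0 := by simp [aop, hχ0 z hz]

theorem ddel_zero {E : Type*} [NormedAddCommGroup E] [NormedSpace ℝ E] (J0 : E →L[ℝ] E)
    {a : ℂ → E} (ha : ∀ z, 2 < ‖z‖ → a z = 0) (z : ℂ)
    (hz : 2 < ‖z‖) : ddel J0 a z = 0 := by simp [ddel, fderiv_zero_of_zero ha z hz]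

set_option maxHeartbeats 1000000 in
theorem pb_a {E : Type*} [NormedAddCommGroup E] [NormedSpace ℝ E] [FiniteDimensional ℝ E]
    (J0 : E →L[ℝ] E) {S : E → E →L[ℝ] E} {χ : ℂ → ℝ} {p : E} (hS : ContDiff ℝ ∞ S)
    (hχ : ContDiff ℝ ∞ χ) (hχ0 : ∀ z, 2 < ‖z‖ → χ z = 0) (hSp : S p = 0)
    (hSJ : ∀ x v, S x (J0 v) = - J0 (S x v)) : ∃ K : ℝ, 0 ≤ K ∧ ∀ (f g : ℂ → E) (ε δ : ℝ),
      0 ≤ ε → ε ≤ 1 → 0 ≤ δ → Good J0 p ε f → Good J0 p ε g → Close J0 δ f g →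
      ∀ z, ‖aop J0 S χ f z - aop J0 S χ g z‖ ≤ K * ε * δ ∧
        ‖ddel J0 (aop J0 S χ f) z - ddel J0 (aop J0 S χ g) z‖ ≤ K * ε * δ := by
  have hcB : IsCompact (closedBall p 1) := isCompact_closedBall p 1
  have hS' : ContDiff ℝ ∞ (fderiv ℝ S) := hS.fderiv_right (m := ∞) (by simp)
  obtain ⟨L1, hL1⟩ := (hS.contDiffOn (s := closedBall p 1)).exists_lipschitzOnWith (by simp)
    (convex_closedBall p 1) hcB
  obtain ⟨L2, hL2⟩ := (hS'.contDiffOn (s := closedBall p 1)).exists_lipschitzOnWith (by simp)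
    (convex_closedBall p 1) hcB
  obtain ⟨L3, hL3⟩ : ∃ L3 : ℝ, ∀ x ∈ closedBall p 1, ‖fderiv ℝ S x‖ ≤ L3 :=
    hcB.exists_bound_of_continuousOn (f := fderiv ℝ S) hS'.continuous.continuousOn
  obtain ⟨L4, hL4⟩ := (isCompact_closedBall (0:ℂ) 2).exists_bound_of_continuousOn
    hχ.continuous.continuousOn
  obtain ⟨L5, hL5⟩ := (isCompact_closedBall (0:ℂ) 2).exists_bound_of_continuousOn
    (contDiff_dir hχ 1).continuous.continuousOn
  obtain ⟨L6, hL6⟩ := (isCompact_closedBall (0:ℂ) 2).exists_bound_of_continuousOn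
    (contDiff_dir hχ Complex.I).continuous.continuousOn
  set K : ℝ := 1 + L1 + L2 + |L3| + |L4| + |L5| + |L6| + ‖J0‖ with hK
  have n1 := L1.2
  have n2 := L2.2
  have n3 := abs_nonneg L3
  have n4 := abs_nonneg L4
  have n5 := abs_nonneg L5
  have n6 := abs_nonneg L6
  have n7 := norm_nonneg J0
  have k1 : (L1:ℝ) ≤ K := by linarith
  have k2 : (L2:ℝ) ≤ K := by linarith
  have k3 : L3 ≤ K := by linarith [le_abs_self L3]
  have k4 : L4 ≤ K := by linarith [le_abs_self L4]
  have k5 : L5 ≤ K := by linarith [le_abs_self L5]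
  have k6 : L6 ≤ K := by linarith [le_abs_self L6]
  have k7 : ‖J0‖ ≤ K := by linarith
  have k8 : 1 ≤ K := by linarith
  have k0 : 0 ≤ K := by linarith
  clear_value K
  have hK4 : K ^ 2 ≤ K ^ 4 := pow_le_pow_right₀ k8 (by norm_num)
  have hK3 : K ^ 3 ≤ K ^ 4 := pow_le_pow_right₀ k8 (by norm_num)
  refine ⟨30 * K ^ 4, by positivity, fun f g ε δ hε hε1 hδ hf hg hfg z => ?_⟩
  rcases lt_or_ge 2 ‖z‖ with hz | hz
  · have h0 : 0 ≤ 30 * K ^ 4 * ε * δ := by positivity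
    rw [aop_zero J0 hχ0 f z hz, aop_zero J0 hχ0 g z hz,
      ddel_zero J0 (aop_zero J0 hχ0 f) z hz, ddel_zero J0 (aop_zero J0 hχ0 g) z hz]
    simpa using h0
  have hz' : z ∈ closedBall (0:ℂ) 2 := by simpa using hz
  obtain ⟨f0, f1, f2, f3⟩ := hf.2 z hz
  obtain ⟨g0, g1, g2, g3⟩ := hg.2 z hz
  obtain ⟨d0, d1, d2, d3⟩ := hfg z hz
  rw [aop_ddel J0 hS hχ hSJ hf.1, aop_ddel J0 hS hχ hSJ hg.1]
  simp only [aop]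
  have c0 : |χ z| ≤ K := (hL4 z hz').trans k4
  have c1 : |fderiv ℝ χ z 1| ≤ K := (hL5 z hz').trans k5
  have c2 : |fderiv ℝ χ z Complex.I| ≤ K := (hL6 z hz').trans k6
  have hxB : f z ∈ closedBall p 1 := by rw [mem_closedBall, dist_eq_norm]; linarith
  have hyB : g z ∈ closedBall p 1 := by rw [mem_closedBall, dist_eq_norm]; linarith
  have s1 : ‖S (f z) - S (g z)‖ ≤ K * δ := by
    have := hL1.dist_le_mul _ hxB _ hyB
    rw [dist_eq_norm, dist_eq_norm] at this
    exact this.trans (mul_le_mul k1 d0 (norm_nonneg _) k0)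
  have s2 : ‖S (g z)‖ ≤ K * ε := by
    have := hL1.dist_le_mul _ hyB p (by simp)
    rw [dist_eq_norm, dist_eq_norm, hSp, sub_zero] at this
    exact this.trans (mul_le_mul k1 g0 (norm_nonneg _) k0)
  have s3 : ‖fderiv ℝ S (f z) - fderiv ℝ S (g z)‖ ≤ K * δ := by
    have := hL2.dist_le_mul _ hxB _ hyB
    rw [dist_eq_norm, dist_eq_norm] at this
    exact this.trans (mul_le_mul k2 d0 (norm_nonneg _) k0)
  have s4 : ‖fderiv ℝ S (g z)‖ ≤ K := (hL3 _ hyB).trans k3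
  have w1 : ‖ddel J0 f z‖ ≤ 2 * K * ε := by
    have h1 : ‖J0 (fderiv ℝ f z Complex.I)‖ ≤ K * ε :=
      (J0.le_opNorm _).trans (mul_le_mul k7 f2 (norm_nonneg _) k0)
    have h2 := norm_sub_le (fderiv ℝ f z 1) (J0 (fderiv ℝ f z Complex.I))
    rw [ddel]
    nlinarith
  have w2 : ‖ddel J0 f z - ddel J0 g z‖ ≤ 2 * K * δ := by
    have h0 : ddel J0 f z - ddel J0 g z = (fderiv ℝ f z 1 - fderiv ℝ g z 1) -
      J0 (fderiv ℝ f z Complex.I - fderiv ℝ g z Complex.I) := by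
      simp only [ddel, map_sub]; abel
    have h1 : ‖J0 (fderiv ℝ f z Complex.I - fderiv ℝ g z Complex.I)‖ ≤ K * δ :=
      (J0.le_opNorm _).trans (mul_le_mul k7 d2 (norm_nonneg _) k0)
    have h2 := norm_sub_le (fderiv ℝ f z 1 - fderiv ℝ g z 1)
      (J0 (fderiv ℝ f z Complex.I - fderiv ℝ g z Complex.I))
    rw [h0]
    nlinarith
  have tS := clm_bil _ _ _ _ s1 w1 s2 w2
  have tD := clm_bil _ _ _ _ s1 f3 s2 d3
  have tq : ∀ a b : E, ‖a‖ ≤ ε → ‖b‖ ≤ ε → ‖a - b‖ ≤ δ →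
      ‖fderiv ℝ S (f z) a (ddel J0 f z) - fderiv ℝ S (g z) b (ddel J0 g z)‖ ≤ 6 * K ^ 2 * ε * δ := by
    intro a b ha hb hab
    have e1 : ‖fderiv ℝ S (f z) a - fderiv ℝ S (g z) b‖ ≤ 2 * K * δ := by
      have e : fderiv ℝ S (f z) a - fderiv ℝ S (g z) b =
        (fderiv ℝ S (f z) - fderiv ℝ S (g z)) a + fderiv ℝ S (g z) (a - b) := by simp
      rw [e]
      have e2 : ‖(fderiv ℝ S (f z) - fderiv ℝ S (g z)) a‖ ≤ K * δ * 1 :=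
        (ContinuousLinearMap.le_opNorm _ _).trans
          (mul_le_mul s3 (ha.trans hε1) (norm_nonneg _) (by positivity))
      have e3 : ‖fderiv ℝ S (g z) (a - b)‖ ≤ K * δ :=
        (ContinuousLinearMap.le_opNorm _ _).trans (mul_le_mul s4 hab (norm_nonneg _) k0)
      refine (norm_add_le _ _).trans ?_
      linarith
    have e4 : ‖fderiv ℝ S (g z) b‖ ≤ K * ε :=
      (ContinuousLinearMap.le_opNorm _ _).trans (mul_le_mul s4 hb (norm_nonneg _) k0)
    refine (clm_bil _ _ _ _ e1 w1 e4 w2).trans (le_of_eq ?_)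
    ring
  have t1 := tq _ _ f1 g1 d1
  have t2 := tq _ _ f2 g2 d2
  have hed : 0 ≤ ε * δ := mul_nonneg hε hδ
  have sm : ∀ (c : ℝ) (a b : E) (B : ℝ), |c| ≤ K → ‖a - b‖ ≤ B → ‖c • a - c • b‖ ≤ K * B := by
    intro c a b B hc hab
    rw [← smul_sub, norm_smul, Real.norm_eq_abs]
    exact mul_le_mul hc hab (norm_nonneg _) k0
  have jm : ∀ (a b : E) (B : ℝ), ‖a - b‖ ≤ B → ‖J0 a - J0 b‖ ≤ K * B := by
    intro a b B hab
    rw [← map_sub]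
    exact (J0.le_opNorm _).trans (mul_le_mul k7 hab (norm_nonneg _) k0)
  have r0 := (sm _ _ _ _ c0 tS).trans_eq
    (show _ = 4 * (K ^ 3 * (ε * δ)) by ring)
  have r1 := (sm _ _ _ _ c1 tS).trans_eq
    (show _ = 4 * (K ^ 3 * (ε * δ)) by ring)
  have r2 := (sm _ _ _ _ c2 (jm _ _ _ tS)).trans_eq
    (show _ = 4 * (K ^ 4 * (ε * δ)) by ring)
  have r3 := (sm _ _ _ _ c0 t1).trans_eq
    (show _ = 6 * (K ^ 3 * (ε * δ)) by ring)
  have r4 := (sm _ _ _ _ c0 (jm _ _ _ t2)).trans_eq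
    (show _ = 6 * (K ^ 4 * (ε * δ)) by ring)
  have r5 := (sm _ _ _ _ c0 tD).trans_eq
    (show _ = 2 * (K ^ 2 * (ε * δ)) by ring)
  have P2 := mul_le_mul_of_nonneg_right hK4 hed
  have P3 := mul_le_mul_of_nonneg_right hK3 hed
  have P4 : 0 ≤ K ^ 4 * (ε * δ) := by positivity
  have rr : 30 * K ^ 4 * ε * δ = 30 * (K ^ 4 * (ε * δ)) := by ring
  rw [rr]
  constructor
  · refine r0.trans ?_
    linarith
  · have tri : ∀ a1 a2 a3 a4 a5 b1 b2 b3 b4 b5 : E,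
      ‖(a1 - a2 + a3 - a4 + a5) - (b1 - b2 + b3 - b4 + b5)‖ ≤
        ‖a1 - b1‖ + ‖a2 - b2‖ + ‖a3 - b3‖ + ‖a4 - b4‖ + ‖a5 - b5‖ := by
      intro a1 a2 a3 a4 a5 b1 b2 b3 b4 b5
      have : (a1 - a2 + a3 - a4 + a5) - (b1 - b2 + b3 - b4 + b5) =
        (a1 - b1) + (-(a2 - b2)) + (a3 - b3) + (-(a4 - b4)) + (a5 - b5) := by abel
      rw [this, ← norm_neg (a2 - b2), ← norm_neg (a4 - b4)]
      refine (norm_add_le _ _).trans (add_le_add ?_ le_rfl)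
      exact norm_add₄_le
    refine (tri _ _ _ _ _ _ _ _ _ _).trans
      ((add_le_add (add_le_add (add_le_add (add_le_add r1 r2) r3) r4) r5).trans ?_)
    linarith

def PInv {E : Type*} [NormedAddCommGroup E] [NormedSpace ℝ E] (J0 : E →L[ℝ] E)
    (S : E → E →L[ℝ] E) (χ : ℂ → ℝ) (p x y : E) (t e m : ℝ) (f : ℂ → E) : Prop :=
  Good J0 p e f ∧ f 0 = x ∧ f t = y ∧ (∀ z, 2 < ‖z‖ → dbar J0 f z = 0) ∧
    ∀ z, ‖aop J0 S χ f z - dbar J0 f z‖ ≤ m ∧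
      ‖ddel J0 (fun w => aop J0 S χ f w - dbar J0 f w) z‖ ≤ m

theorem Good.mono {E : Type*} [NormedAddCommGroup E] [NormedSpace ℝ E] {J0 : E →L[ℝ] E} {p : E}
    {e e' : ℝ} {f : ℂ → E} (h : Good J0 p e f) (he : e ≤ e') : Good J0 p e' f :=
  ⟨h.1, fun z hz => by
    obtain ⟨h1, h2, h3, h4⟩ := h.2 z hz
    exact ⟨h1.trans he, h2.trans he, h3.trans he, h4.trans he⟩⟩

theorem ddel_sub {E : Type*} [NormedAddCommGroup E] [NormedSpace ℝ E] (J0 : E →L[ℝ] E)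
    {f g : ℂ → E} (hf : ContDiff ℝ ∞ f) (hg : ContDiff ℝ ∞ g) (z : ℂ) :
    ddel J0 (fun w => f w - g w) z = ddel J0 f z - ddel J0 g z := by
  rw [ddel, fderiv_fun_sub (hf.differentiable (by simp) z) (hg.differentiable (by simp) z)]
  simp only [sub_apply, map_sub, ddel]; abel

theorem ddel_add {E : Type*} [NormedAddCommGroup E] [NormedSpace ℝ E] (J0 : E →L[ℝ] E)
    {f g : ℂ → E} (hf : ContDiff ℝ ∞ f) (hg : ContDiff ℝ ∞ g) (z : ℂ) :
    ddel J0 (fun w => f w + g w) z = ddel J0 f z + ddel J0 g z := by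
  rw [ddel, fderiv_fun_add (hf.differentiable (by simp) z) (hg.differentiable (by simp) z)]
  simp only [add_apply, map_add, ddel]; abel

theorem dbar_add {E : Type*} [NormedAddCommGroup E] [NormedSpace ℝ E] (J0 : E →L[ℝ] E)
    {f g : ℂ → E} (hf : ContDiff ℝ ∞ f) (hg : ContDiff ℝ ∞ g) (z : ℂ) :
    dbar J0 (fun w => f w + g w) z = dbar J0 f z + dbar J0 g z := by
  rw [dbar, fderiv_fun_add (hf.differentiable (by simp) z) (hg.differentiable (by simp) z)]
  simp only [add_apply, map_add, dbar]; abel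

theorem pb_step {E : Type*} [NormedAddCommGroup E] [NormedSpace ℝ E] [FiniteDimensional ℝ E]
    {J0 : E →L[ℝ] E} {S : E → E →L[ℝ] E} {χ : ℂ → ℝ} {p x y : E} (hS : ContDiff ℝ ∞ S)
    (hχ : ContDiff ℝ ∞ χ) (hχ0 : ∀ z, 2 < ‖z‖ → χ z = 0) {C K ε t : ℝ} (hC : 1 ≤ C)
    (ht0 : 0 < t) (ht1 : t ≤ 1) (hε0 : 0 ≤ ε) (hε1 : ε ≤ 1) (hKC : K * ε * C ≤ 1 / 2)
    (hCT : ∀ (a : ℂ → E) (m t : ℝ), 0 ≤ m → 0 < t → t ≤ 1 → ContDiff ℝ ∞ a →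
      (∀ z, 2 < ‖z‖ → a z = 0) →
      (∀ z, ‖a z‖ ≤ m) → (∀ z, ‖ddel J0 a z‖ ≤ m) → ∃ u : ℂ → E, ContDiff ℝ ∞ u ∧ u 0 = 0 ∧ u t = 0 ∧
      (∀ z, dbar J0 u z = a z) ∧ (∀ z, dbar J0 (ddel J0 u) z = ddel J0 a z) ∧
      ∀ z, ‖z‖ ≤ 2 → ‖u z‖ ≤ C * m ∧ ‖fderiv ℝ u z 1‖ ≤ C * m ∧ ‖fderiv ℝ u z Complex.I‖ ≤ C * m)
    (hKA : ∀ (f g : ℂ → E) (ε δ : ℝ),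
      0 ≤ ε → ε ≤ 1 → 0 ≤ δ → Good J0 p ε f → Good J0 p ε g → Close J0 δ f g →
      ∀ z, ‖aop J0 S χ f z - aop J0 S χ g z‖ ≤ K * ε * δ ∧
        ‖ddel J0 (aop J0 S χ f) z - ddel J0 (aop J0 S χ g) z‖ ≤ K * ε * δ)
    {e m : ℝ} (hm : 0 ≤ m) (he : e + C * m ≤ ε) {f : ℂ → E} (hf : PInv J0 S χ p x y t e m f) :
    ∃ f', PInv J0 S χ p x y t (e + C * m) (m / 2) f' ∧ Close J0 (C * m) f' f ∧
      ∀ z, dbar J0 f' z = aop J0 S χ f z := by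
  obtain ⟨hG, hf0, hft, hfz, hfh⟩ := hf
  have hCm : 0 ≤ C * m := by positivity
  have hmC : m ≤ C * m := by nlinarith
  have hAc := aop_contDiff J0 hS hχ hG.1
  have hhc : ContDiff ℝ ∞ (fun w => aop J0 S χ f w - dbar J0 f w) :=
    hAc.sub (contDiff_dbar J0 hG.1)
  obtain ⟨u, huc, hu0, hut, hu1, hu2, hu3⟩ := hCT (fun w => aop J0 S χ f w - dbar J0 f w) m t hm
    ht0 ht1 hhc (fun z hz => by rw [hfz z hz, aop_zero J0 hχ0 f z hz, sub_zero])
    (fun z => (hfh z).1) (fun z => (hfh z).2)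
  have hfc := hG.1
  set f' : ℂ → E := fun w => f w + u w with hf'
  have hf'c : ContDiff ℝ ∞ f' := hfc.add huc
  have hfd : ∀ z, fderiv ℝ f' z = fderiv ℝ f z + fderiv ℝ u z := fun z =>
    fderiv_fun_add (hfc.differentiable (by simp) z) (huc.differentiable (by simp) z)
  have hdb : ∀ z, dbar J0 f' z = aop J0 S χ f z := fun z => by
    rw [hf', dbar_add J0 hfc huc, hu1]; abel
  have hdd : ∀ z, dbar J0 (ddel J0 f') z = dbar J0 (ddel J0 f) z +
      ddel J0 (fun w => aop J0 S χ f w - dbar J0 f w) z := fun z => by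
    have : ddel J0 f' = fun w => ddel J0 f w + ddel J0 u w := funext fun w => ddel_add J0 hfc huc w
    rw [this, dbar_add J0 (contDiff_ddel J0 hfc) (contDiff_ddel J0 huc), hu2]
  have hcl : Close J0 (C * m) f' f := by
    intro z hz
    obtain ⟨a1, a2, a3⟩ := hu3 z hz
    refine ⟨?_, ?_, ?_, ?_⟩
    · simpa [hf'] using a1
    · rw [hfd]; simpa using a2
    · rw [hfd]; simpa using a3
    · rw [hdd, add_sub_cancel_left]; exact (hfh z).2.trans hmC
  have hG' : Good J0 p (e + C * m) f' := by
    refine ⟨hf'c, fun z hz => ?_⟩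
    obtain ⟨a1, a2, a3, a4⟩ := hcl z hz
    obtain ⟨b1, b2, b3, b4⟩ := hG.2 z hz
    have key : ∀ A B : E, ‖A - B‖ ≤ C * m → ‖B‖ ≤ e → ‖A‖ ≤ e + C * m := fun A B h1 h2 => by
      have := norm_add_le (A - B) B
      rw [sub_add_cancel] at this; linarith
    refine ⟨key _ (f z - p) (by simpa using a1) b1, key _ _ a2 b2, key _ _ a3 b3, key _ _ a4 b4⟩
  have hA := hKA f' f ε (C * m) hε0 hε1 hCm (hG'.mono he)
    (hG.mono (by linarith)) hcl
  have hle : K * ε * (C * m) ≤ m / 2 := by nlinarith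
  refine ⟨f', ⟨hG', by simp [hf', hf0, hu0], by simp [hf', hft, hut], fun z hz => ?_, fun z => ?_⟩,
    hcl, hdb⟩
  · rw [hdb, aop_zero J0 hχ0 f z hz]
  · have e1 : (fun w => aop J0 S χ f' w - dbar J0 f' w) =
        fun w => aop J0 S χ f' w - aop J0 S χ f w := funext fun w => by rw [hdb]
    rw [e1, hdb, ddel_sub J0 (aop_contDiff J0 hS hχ hf'c) hAc]
    exact ⟨(hA z).1.trans hle, (hA z).2.trans hle⟩

theorem pb_disc {E : Type*} [NormedAddCommGroup E] [NormedSpace ℝ E] [FiniteDimensional ℝ E]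
    {U : Set E} (hU : IsOpen U) {p : E} (hp : p ∈ U) {J : E → E →L[ℝ] E}
    (hJs : ContDiffOn ℝ ∞ J U) (hJJ : ∀ x ∈ U, J x * J x = -1) :
    ∃ η > 0, ∀ x ∈ ball p η, ∀ v : E, ‖v‖ ≤ η → ∀ t : ℝ, 0 < t → t ≤ 1 → ∃ f : ℂ → E,
      (∀ z ∈ ball (0:ℂ) 1, f z ∈ U ∧ DifferentiableAt ℝ f z ∧
        ∀ ξ : ℂ, fderiv ℝ f z (Complex.I * ξ) = J (f z) (fderiv ℝ f z ξ)) ∧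
      f 0 = x ∧ f t = x + t • v := by
  have : CompleteSpace E := FiniteDimensional.complete ℝ E
  obtain ⟨S, hS, hSp, hSJ, ρ, hρ, hρU, hSρ⟩ := pb_S hU hp hJs hJJ
  set J0 := J p with hJ0d
  have hJ0 : ∀ v, J0 (J0 v) = -v := fun v => by
    have := congrArg (fun T : E →L[ℝ] E => T v) (hJJ p hp)
    simpa using this
  let ψ : ContDiffBump (0:ℂ) := ⟨1, 2, by norm_num, by norm_num⟩
  set χ : ℂ → ℝ := fun z => ψ z with hχd
  have hχ : ContDiff ℝ ∞ χ := ψ.contDiff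
  have hχ0 : ∀ z, 2 < ‖z‖ → χ z = 0 := fun z hz =>
    ψ.zero_of_le_dist (by rw [dist_zero_right]; exact hz.le)
  have hχ1 : ∀ z ∈ ball (0:ℂ) 1, χ z = 1 := fun z hz =>
    ψ.one_of_mem_closedBall (ball_subset_closedBall hz)
  clear_value χ
  obtain ⟨C', hC', hCT'⟩ := pb_T J0 hJ0
  obtain ⟨K, hK, hKA⟩ := pb_a J0 (p := p) hS hχ hχ0 hSp hSJ
  set C := C' + 1 with hCd
  have hC : 1 ≤ C := by linarith
  have hCT : ∀ (a : ℂ → E) (m t : ℝ), 0 ≤ m → 0 < t → t ≤ 1 → ContDiff ℝ ∞ a →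
      (∀ z, 2 < ‖z‖ → a z = 0) →
      (∀ z, ‖a z‖ ≤ m) → (∀ z, ‖ddel J0 a z‖ ≤ m) → ∃ u : ℂ → E, ContDiff ℝ ∞ u ∧ u 0 = 0 ∧ u t = 0 ∧
      (∀ z, dbar J0 u z = a z) ∧ (∀ z, dbar J0 (ddel J0 u) z = ddel J0 a z) ∧
      ∀ z, ‖z‖ ≤ 2 → ‖u z‖ ≤ C * m ∧ ‖fderiv ℝ u z 1‖ ≤ C * m ∧
        ‖fderiv ℝ u z Complex.I‖ ≤ C * m := by
    intro a m t hm h1 h2 h3 h4 h5 h6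
    obtain ⟨u, q1, q2, q3, q4, q5, q6⟩ := hCT' a m t hm h1 h2 h3 h4 h5 h6
    have : C' * m ≤ C * m := mul_le_mul_of_nonneg_right (by linarith) hm
    refine ⟨u, q1, q2, q3, q4, q5, fun z hz => ?_⟩
    obtain ⟨r1, r2, r3⟩ := q6 z hz
    exact ⟨r1.trans this, r2.trans this, r3.trans this⟩
  clear_value C
  obtain ⟨ε, hε, hε1, hερ, hKC⟩ : ∃ ε : ℝ, 0 < ε ∧ ε ≤ 1 ∧ ε < ρ ∧ K * ε * C ≤ 1 / 2 := by
    have hKC0 : 0 ≤ K * C := by positivity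
    refine ⟨min 1 (min (ρ / 2) (1 / (2 * (K * C + 1)))), ?_, min_le_left _ _, ?_, ?_⟩
    · positivity
    · exact ((min_le_right _ _).trans (min_le_left _ _)).trans_lt (by linarith)
    · have h1 : min 1 (min (ρ / 2) (1 / (2 * (K * C + 1)))) ≤ 1 / (2 * (K * C + 1)) :=
        (min_le_right _ _).trans (min_le_right _ _)
      have h2 := mul_le_mul_of_nonneg_left h1 hKC0
      have h3 : K * C * (1 / (2 * (K * C + 1))) ≤ 1 / 2 := by
        rw [mul_one_div, div_le_div_iff₀ (by positivity) (by norm_num)]; nlinarith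
      linarith
  set m0 : ℝ := K * ε * (ε / 2) with hm0
  have hm0n : 0 ≤ m0 := by positivity
  have hCm0 : 2 * C * m0 ≤ ε / 2 := by rw [hm0]; nlinarith
  have hJn := norm_nonneg J0
  set η := ε / (4 * (2 * (1 + ‖J0‖))) with hη
  have hη0 : 0 < η := by positivity
  have hηe : η * (2 * (1 + ‖J0‖)) = ε / 4 := by rw [hη]; field_simp
  refine ⟨η, hη0, fun x hx v hv t ht0 ht1 => ?_⟩
  set f0 : ℂ → E := fun z => x + jphi J0 z v with hf0
  have hf0d : ∀ z, HasFDerivAt f0 ((jphi J0).flip v) z := fun z =>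
    ((jphi J0).flip v).hasFDerivAt.const_add x
  have hf0c : ContDiff ℝ ∞ f0 := contDiff_const.add ((jphi J0).flip v).contDiff
  have hf1 : ∀ z, fderiv ℝ f0 z 1 = v := fun z => by
    rw [(hf0d z).fderiv]; simp [jphi_apply]
  have hfI : ∀ z, fderiv ℝ f0 z Complex.I = J0 v := fun z => by
    rw [(hf0d z).fderiv]; simp [jphi_apply]
  have hdb0 : ∀ z, dbar J0 f0 z = 0 := fun z => by rw [dbar, hf1, hfI, hJ0]; abel
  have hdd0 : ddel J0 f0 = fun _ => v - J0 (J0 v) := funext fun z => by rw [ddel, hf1, hfI]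
  have hJv : ‖J0 v‖ ≤ ‖J0‖ * η := (J0.le_opNorm v).trans (mul_le_mul_of_nonneg_left hv hJn)
  have hG0 : Good J0 p (ε / 2) f0 := by
    refine ⟨hf0c, fun z hz => ⟨?_, ?_, ?_, ?_⟩⟩
    · have h1 : ‖jphi J0 z v‖ ≤ 2 * (1 + ‖J0‖) * η := by
        rw [jphi_apply]
        refine (norm_add_le _ _).trans ?_
        rw [norm_smul, norm_smul, Real.norm_eq_abs, Real.norm_eq_abs]
        have a1 : |z.re| * ‖v‖ ≤ 2 * η :=
          mul_le_mul ((Complex.abs_re_le_norm z).trans hz) hv (norm_nonneg _) (by norm_num)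
        have a2 : |z.im| * ‖J0 v‖ ≤ 2 * (‖J0‖ * η) :=
          mul_le_mul ((Complex.abs_im_le_norm z).trans hz) hJv (norm_nonneg _) (by norm_num)
        linarith
      have h2 : f0 z - p = (x - p) + jphi J0 z v := by simp only [hf0]; abel
      rw [mem_ball, dist_eq_norm] at hx
      rw [h2]
      refine (norm_add_le _ _).trans ?_
      nlinarith
    · rw [hf1]; nlinarith
    · rw [hfI]; nlinarith
    · rw [hdd0, dbar]; simp; positivity
  have hGp : Good J0 p ε (fun _ => p) := by
    refine ⟨contDiff_const, fun z hz => ?_⟩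
    have : ddel J0 (fun _ : ℂ => p) = fun _ => 0 := funext fun z => by simp [ddel]
    rw [this]
    simp [dbar, hε.le]
  have hinv0 : PInv J0 S χ p x (x + t • v) t (ε / 2) m0 f0 := by
    refine ⟨hG0, by simp [hf0], by simp [hf0, jphi_apply], fun z _ => hdb0 z, fun z => ?_⟩
    have hd : ddel J0 (fun _ : ℂ => p) = fun _ => 0 := funext fun z => by simp [ddel]
    have hcl : Close J0 (ε / 2) f0 (fun _ => p) := by
      intro z hz
      obtain ⟨b1, b2, b3, b4⟩ := hG0.2 z hz
      rw [hd]
      exact ⟨b1, by simpa using b2, by simpa using b3, by simpa [dbar] using b4⟩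
    have h1 := hKA f0 (fun _ => p) ε (ε / 2) hε.le hε1 (by positivity) (hG0.mono (by linarith))
      hGp hcl z
    have e1 : aop J0 S χ (fun _ : ℂ => p) = fun _ => 0 := funext fun z => by simp [aop, hSp]
    have e2 : (fun w => aop J0 S χ f0 w - dbar J0 f0 w) = aop J0 S χ f0 := funext fun w => by
      rw [hdb0, sub_zero]
    rw [e2, hdb0, sub_zero]
    rw [e1] at h1
    simpa [ddel] using h1
  set e : ℕ → ℝ := fun k => ε / 2 + 2 * C * m0 * (1 - (1/2) ^ k) with hed
  set m : ℕ → ℝ := fun k => m0 * (1/2) ^ k with hmd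
  have hstep : ∀ k f, PInv J0 S χ p x (x + t • v) t (e k) (m k) f →
      ∃ f', PInv J0 S χ p x (x + t • v) t (e (k+1)) (m (k+1)) f' ∧ Close J0 (C * m k) f' f ∧
      ∀ z, dbar J0 f' z = aop J0 S χ f z := by
    intro k f hf
    have h1 : e k + C * m k = e (k+1) := by simp only [hed, hmd, pow_succ]; ring
    have h2 : m k / 2 = m (k+1) := by simp only [hmd, pow_succ]; ring
    rw [← h1, ← h2]
    refine pb_step hS hχ hχ0 hC ht0 ht1 hε.le hε1 hKC hCT hKA ?_ ?_ hf
    · simp only [hmd]; positivity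
    · rw [h1]
      simp only [hed]
      have : 0 ≤ 2 * C * m0 * (1/2) ^ (k+1) := by positivity
      linarith
  choose! nx hnx1 hnx2 hnx3 using hstep
  let F : ℕ → ℂ → E := fun k => Nat.rec f0 (fun k f => nx k f) k
  have hF : ∀ k, PInv J0 S χ p x (x + t • v) t (e k) (m k) (F k) := by
    intro k
    induction k with
    | zero =>
      have h1 : e 0 = ε / 2 := by simp [hed]
      have h2 : m 0 = m0 := by simp [hmd]
      rw [h1, h2]; exact hinv0
    | succ k ih => exact hnx1 k _ ih
  have hF2 : ∀ k, Close J0 (C * m k) (F (k+1)) (F k) := fun k => hnx2 k _ (hF k)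
  have hF3 : ∀ k z, dbar J0 (F (k+1)) z = aop J0 S χ (F k) z := fun k => hnx3 k _ (hF k)
  clear_value F
  have hC1 : ∀ z, ‖z‖ ≤ 2 → ∀ k, dist (F k z) (F (k+1) z) ≤ (4 * C * m0) / 2 / 2 ^ k := by
    intro z hz k
    rw [dist_comm, dist_eq_norm]
    refine ((hF2 k z hz).1).trans ?_
    have : C * m k = C * m0 / 2 ^ k := by simp only [hmd, one_div, inv_pow]; ring
    rw [this]
    gcongr
    nlinarith
  have hC2 : ∀ z, ‖z‖ ≤ 2 → ∀ k, dist (fderiv ℝ (F k) z) (fderiv ℝ (F (k+1)) z)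
      ≤ (4 * C * m0) / 2 / 2 ^ k := by
    intro z hz k
    rw [dist_comm, dist_eq_norm]
    refine (clm_le _).trans ?_
    have h1 := (hF2 k z hz).2.1
    have h2 := (hF2 k z hz).2.2.1
    rw [← sub_apply] at h1 h2
    have : C * m k + C * m k = (4 * C * m0) / 2 / 2 ^ k := by
      simp only [hmd, one_div, inv_pow]; ring
    linarith
  have hlim1 : ∀ z, ∃ l, ‖z‖ ≤ 2 → Tendsto (fun k => F k z) atTop (𝓝 l) := by
    intro z
    by_cases hz : ‖z‖ ≤ 2
    · obtain ⟨l, hl⟩ := cauchySeq_tendsto_of_complete (cauchySeq_of_le_geometric_two (hC1 z hz))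
      exact ⟨l, fun _ => hl⟩
    · exact ⟨0, fun h => absurd h hz⟩
  have hlim2 : ∀ z, ∃ l, ‖z‖ ≤ 2 → Tendsto (fun k => fderiv ℝ (F k) z) atTop (𝓝 l) := by
    intro z
    by_cases hz : ‖z‖ ≤ 2
    · obtain ⟨l, hl⟩ := cauchySeq_tendsto_of_complete (cauchySeq_of_le_geometric_two (hC2 z hz))
      exact ⟨l, fun _ => hl⟩
    · exact ⟨0, fun h => absurd h hz⟩
  choose f hf using hlim1
  choose f' hf' using hlim2
  have hunif : TendstoUniformlyOn (fun k => fderiv ℝ (F k)) f' atTop (ball (0:ℂ) 2) := by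
    rw [Metric.tendstoUniformlyOn_iff]
    intro r hr
    have h0 : Tendsto (fun k : ℕ => (4 * C * m0) / 2 ^ k) atTop (𝓝 0) := by
      have := (tendsto_pow_atTop_nhds_zero_of_lt_one (r := (1/2:ℝ)) (by norm_num)
        (by norm_num)).const_mul (4 * C * m0)
      simpa [div_eq_mul_inv] using this
    filter_upwards [h0.eventually (gt_mem_nhds hr)] with k hk z hz
    have hz2 : ‖z‖ ≤ 2 := by
      rw [mem_ball_zero_iff] at hz; exact hz.le
    rw [dist_comm]
    exact (dist_le_of_le_geometric_two_of_tendsto (hC2 z hz2) (hf' z hz2) k).trans_lt hk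
  have hder : ∀ z ∈ ball (0:ℂ) 2, HasFDerivAt f (f' z) z := fun z hz =>
    hasFDerivAt_of_tendstoUniformlyOn isOpen_ball hunif
      (fun k w _ => ((hF k).1.1.differentiable (by simp) w).hasFDerivAt)
      (fun w hw => hf w (by rw [mem_ball_zero_iff] at hw; exact hw.le)) hz
  refine ⟨f, fun z hz => ?_, ?_, ?_⟩
  · have hz2 : z ∈ ball (0:ℂ) 2 := ball_subset_ball (by norm_num) hz
    have hzn : ‖z‖ ≤ 2 := by rw [mem_ball_zero_iff] at hz2; exact hz2.le
    have hd := hder z hz2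
    have hfz := hf z hzn
    have hfz' := hf' z hzn
    have hfB : f z ∈ ball p ρ := by
      have : f z ∈ closedBall p ε := by
        refine isClosed_closedBall.mem_of_tendsto hfz (Eventually.of_forall fun k => ?_)
        rw [mem_closedBall, dist_eq_norm]
        refine ((hF k).1.2 z hzn).1.trans ?_
        simp only [hed]
        have : 0 ≤ 2 * C * m0 * (1/2) ^ k := by positivity
        linarith
      exact closedBall_subset_ball hερ this
    have t1 : Tendsto (fun k => fderiv ℝ (F k) z 1) atTop (𝓝 (f' z 1)) :=
      ((ContinuousLinearMap.apply ℝ E (1:ℂ)).continuous.tendsto _).comp hfz'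
    have tI : Tendsto (fun k => fderiv ℝ (F k) z Complex.I) atTop (𝓝 (f' z Complex.I)) :=
      ((ContinuousLinearMap.apply ℝ E Complex.I).continuous.tendsto _).comp hfz'
    have tJ := (J0.continuous.tendsto _).comp tI
    have tb : Tendsto (fun k => dbar J0 (F k) z) atTop (𝓝 (f' z 1 + J0 (f' z Complex.I))) :=
      t1.add tJ
    have tdl : Tendsto (fun k => ddel J0 (F k) z) atTop (𝓝 (f' z 1 - J0 (f' z Complex.I))) :=
      t1.sub tJ
    have ta : Tendsto (fun k => aop J0 S χ (F k) z) atTop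
        (𝓝 (S (f z) (f' z 1 - J0 (f' z Complex.I)))) := by
      have : Tendsto (fun k => S (F k z) (ddel J0 (F k) z)) atTop
        (𝓝 (S (f z) (f' z 1 - J0 (f' z Complex.I)))) :=
        ((isBoundedBilinearMap_apply (𝕜 := ℝ) (E := E) (F := E)).continuous.tendsto
          (S (f z), f' z 1 - J0 (f' z Complex.I))).comp
          (((hS.continuous.tendsto _).comp hfz).prodMk_nhds tdl)
      simpa [aop, hχ1 z hz] using this
    have tb' := tb.comp (tendsto_add_atTop_nat 1)
    have heq := tendsto_nhds_unique tb' (ta.congr fun k => (hF3 k z).symm)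
    have hfy := hSρ (f z) hfB _ _ heq
    refine ⟨hρU hfB, hd.differentiableAt, fun ξ => ?_⟩
    rw [hd.fderiv]
    have hJx' : ∀ v, J (f z) (J (f z) v) = -v := fun v => by
      have := congrArg (fun T : E →L[ℝ] E => T v) (hJJ (f z) (hρU hfB))
      simpa using this
    have h1 : ξ = ξ.re • (1:ℂ) + ξ.im • Complex.I := by
      simp only [Complex.real_smul, mul_one]
      rw [Complex.re_add_im]
    have h2 : Complex.I * ξ = ξ.re • Complex.I + (-ξ.im) • (1:ℂ) := by
      apply Complex.ext <;> simp
    rw [h2]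
    nth_rewrite 3 [h1]
    simp only [map_add, map_smul, hfy, hJx']
    module
  · have h0 := hf 0 (by simp)
    refine tendsto_nhds_unique h0 ?_
    simp only [(hF _).2.1]; exact tendsto_const_nhds
  · have h0 := hf t (by simp [abs_of_pos ht0]; linarith)
    refine tendsto_nhds_unique h0 ?_
    simp only [(hF _).2.2.1]; exact tendsto_const_nhds

inductive KChain (n : ℕ) (Ω : Set (Cn n)) (J : Cn n → (Cn n →L[ℝ] Cn n)) :
    Cn n → Cn n → ℝ → Prop
  | single (f : ℂ → Cn n) (z w : ℂ) (hf : IsJHolomorphicOn n Ω J 1 f) (hz : z ∈ ball (0:ℂ) 1)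
      (hw : w ∈ ball (0:ℂ) 1) : KChain n Ω J (f z) (f w) (poincareDist z w)
  | cons (f : ℂ → Cn n) (z w : ℂ) (hf : IsJHolomorphicOn n Ω J 1 f) (hz : z ∈ ball (0:ℂ) 1)
      (hw : w ∈ ball (0:ℂ) 1) (q : Cn n) (c : ℝ) (h : KChain n Ω J (f w) q c) :
      KChain n Ω J (f z) q (poincareDist z w + c)

theorem arctanh_nonneg {x : ℝ} (hx : 0 ≤ x) : 0 ≤ arctanh x := by
  rw [arctanh]
  refine mul_nonneg (by norm_num) ?_
  rcases eq_or_ne x 1 with h | h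
  · simp [h]
  · rw [← Real.log_abs]
    apply Real.log_nonneg
    have h1 : 0 < |1 - x| := abs_pos.2 (sub_ne_zero.2 h.symm)
    rw [abs_div, le_div_iff₀ h1, one_mul, abs_of_nonneg (by linarith : (0:ℝ) ≤ 1 + x)]
    rw [abs_le]; constructor <;> linarith

theorem poincareDist_nonneg (z w : ℂ) : 0 ≤ poincareDist z w :=
  arctanh_nonneg (by positivity)

theorem KChain.nonneg {n : ℕ} {Ω : Set (Cn n)} {J : Cn n → (Cn n →L[ℝ] Cn n)} {p q : Cn n}
    {c : ℝ} (h : KChain n Ω J p q c) : 0 ≤ c := by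
  induction h with
  | single => exact poincareDist_nonneg _ _
  | cons f z w _ _ _ q c _ ih => exact add_nonneg (poincareDist_nonneg _ _) ih

theorem KChain.trans {n : ℕ} {Ω : Set (Cn n)} {J : Cn n → (Cn n →L[ℝ] Cn n)} {p q r : Cn n}
    {c d : ℝ} (h : KChain n Ω J p q c) (h' : KChain n Ω J q r d) : KChain n Ω J p r (c + d) := by
  induction h with
  | single f z w hf hz hw => exact KChain.cons f z w hf hz hw _ _ h'
  | cons f z w hf hz hw q c _ ih =>
    rw [add_assoc]
    exact KChain.cons f z w hf hz hw _ _ (ih h')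

theorem kchain_iff {n : ℕ} {Ω : Set (Cn n)} {J : Cn n → (Cn n →L[ℝ] Cn n)} {p q : Cn n} {c : ℝ} :
    KChain n Ω J p q c ↔ ∃ m : ℕ, ∃ z w : Fin (m + 1) → ℂ, ∃ f : Fin (m + 1) → ℂ → Cn n,
    (∀ k, z k ∈ ball (0:ℂ) 1 ∧ w k ∈ ball (0:ℂ) 1 ∧ IsJHolomorphicOn n Ω J 1 (f k)) ∧
    f 0 (z 0) = p ∧
    (∀ k : Fin m, f k.castSucc (w k.castSucc) = f k.succ (z k.succ)) ∧
    f (Fin.last m) (w (Fin.last m)) = q ∧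
    c = ∑ k, poincareDist (z k) (w k) := by
  constructor
  · intro h
    induction h with
    | single f z w hf hz hw =>
      exact ⟨0, fun _ => z, fun _ => w, fun _ => f, fun _ => ⟨hz, hw, hf⟩, rfl,
        fun k => k.elim0, rfl, by simp⟩
    | cons f z w hf hz hw q c _ ih =>
      obtain ⟨m, Z, W, G, h1, h2, h3, h4, h5⟩ := ih
      refine ⟨m + 1, Fin.cons z Z, Fin.cons w W, Fin.cons f G, ?_, ?_, ?_, ?_, ?_⟩
      · intro k
        refine Fin.cases ?_ (fun i => ?_) k
        · exact ⟨hz, hw, hf⟩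
        · simpa using h1 i
      · simp
      · intro k
        refine Fin.cases ?_ (fun i => ?_) k
        · simp [h2]
        · have := h3 i
          simpa [← Fin.succ_castSucc] using this
      · rw [← Fin.succ_last]; simpa using h4
      · rw [Fin.sum_univ_succ]; simp [h5]
  · rintro ⟨m, Z, W, G, h1, h2, h3, h4, h5⟩
    induction m generalizing p c with
    | zero =>
      subst h5 h2 h4
      simpa using KChain.single (G 0) (Z 0) (W 0) (h1 0).2.2 (h1 0).1 (h1 0).2.1
    | succ m ih =>
      have := ih (p := G (Fin.succ 0) (Z (Fin.succ 0))) (c := ∑ k : Fin (m+1), poincareDist (Z k.succ) (W k.succ))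
        (fun k => Z k.succ) (fun k => W k.succ)
        (fun k => G k.succ) (fun k => h1 k.succ) rfl
        (fun k => h3 k.succ) h4 rfl
      have e := h3 0
      rw [← e] at this
      have := KChain.cons _ (Z 0) _ (h1 0).2.2 (h1 0).1 (h1 0).2.1 _ _ this
      rw [h5, Fin.sum_univ_succ, ← h2]
      exact this

theorem kd_eq {n : ℕ} {Ω : Set (Cn n)} {J : Cn n → (Cn n →L[ℝ] Cn n)} (p q : Cn n) :
    kobayashiDist n Ω J p q = sInf {c | ∃ x : ℝ, KChain n Ω J p q x ∧ c = ENNReal.ofReal x} := by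
  rw [kobayashiDist]
  congr 1
  ext c
  simp only [mem_ofPred_eq, kchain_iff]
  constructor
  · rintro ⟨m, z, w, f, h1, h2, h3, h4, h5⟩
    exact ⟨_, ⟨m, z, w, f, h1, h2, h3, h4, rfl⟩, h5⟩
  · rintro ⟨x, ⟨m, z, w, f, h1, h2, h3, h4, rfl⟩, h5⟩
    exact ⟨m, z, w, f, h1, h2, h3, h4, h5⟩

theorem kd_le {n : ℕ} {Ω : Set (Cn n)} {J : Cn n → (Cn n →L[ℝ] Cn n)} {p q : Cn n} {c : ℝ}
    (h : KChain n Ω J p q c) : kobayashiDist n Ω J p q ≤ ENNReal.ofReal c := by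
  rw [kd_eq]; exact sInf_le ⟨c, h, rfl⟩

theorem kd_triangle {n : ℕ} {Ω : Set (Cn n)} {J : Cn n → (Cn n →L[ℝ] Cn n)} (p q r : Cn n) :
    kobayashiDist n Ω J p r ≤ kobayashiDist n Ω J p q + kobayashiDist n Ω J q r := by
  rw [kd_eq p q, kd_eq q r, ENNReal.sInf_add]
  refine le_iInf₂ fun c hc => ?_
  obtain ⟨x, hx, rfl⟩ := hc
  rw [ENNReal.add_sInf]
  refine le_iInf₂ fun c hc => ?_
  obtain ⟨y, hy, rfl⟩ := hc
  rw [← ENNReal.ofReal_add hx.nonneg hy.nonneg]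
  exact kd_le (hx.trans hy)

theorem arctanh_le {t : ℝ} (h0 : 0 ≤ t) (h1 : t ≤ 1 / 2) : arctanh t ≤ 2 * t := by
  rw [arctanh]
  have h2 : 0 < 1 - t := by linarith
  have := Real.log_le_sub_one_of_pos (x := (1 + t) / (1 - t)) (by positivity)
  have h3 : (1 + t) / (1 - t) - 1 ≤ 4 * t := by
    rw [div_sub_one h2.ne', div_le_iff₀ h2]; nlinarith
  linarith

theorem poincareDist_zero {r : ℝ} (hr : 0 ≤ r) : poincareDist 0 (r:ℂ) = arctanh r := by
  simp [poincareDist, abs_of_nonneg hr]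

theorem kd_local {n : ℕ} {Ω : Set (Cn n)} (hΩ : IsOpen Ω) {J : Cn n → (Cn n →L[ℝ] Cn n)}
    (hJ : IsAlmostComplexOn n Ω J) {p : Cn n} (hp : p ∈ Ω) : ∃ ε > 0, ∃ C : ℝ, 0 ≤ C ∧
      ∀ x ∈ ball p ε, ∀ y ∈ ball p ε, kobayashiDist n Ω J x y ≤ ENNReal.ofReal (C * ‖x - y‖) := by
  obtain ⟨η, hη, h⟩ := pb_disc (E := Cn n) hΩ hp hJ.1 (fun x hx => hJ.2 x hx)
  refine ⟨η / 4, by positivity, 2 / η, by positivity, fun x hx y hy => ?_⟩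
  have hxη : x ∈ ball p η := ball_subset_ball (by linarith) hx
  have key : ∀ v : Cn n, ‖v‖ ≤ η → ∀ t : ℝ, 0 < t → t < 1 → ∃ f : ℂ → Cn n,
      IsJHolomorphicOn n Ω J 1 f ∧ f 0 = x ∧ f t = x + t • v := by
    intro v hv t h0 h1
    obtain ⟨f, q1, q2, q3⟩ := h x hxη v hv t h0 h1.le
    exact ⟨f, ⟨fun z hz => (q1 z hz).1, fun z hz => (q1 z hz).2⟩, q2, q3⟩
  rcases eq_or_ne x y with rfl | hne
  · obtain ⟨f, hf, hf0, -⟩ := key 0 (by simp [hη.le]) (1/2) (by norm_num) (by norm_num)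
    have := kd_le (KChain.single f 0 0 hf (by simp) (by simp))
    rw [hf0] at this
    refine this.trans ?_
    simp [poincareDist, arctanh]
  · have hd : 0 < ‖y - x‖ := norm_pos_iff.2 (sub_ne_zero.2 hne.symm)
    have hd2 : ‖y - x‖ < η / 2 := by
      rw [← dist_eq_norm]
      rw [mem_ball] at hx hy
      linarith [dist_triangle_right y x p]
    set t := ‖y - x‖ / η with ht
    have ht0 : 0 < t := by positivity
    have ht1 : t < 1 / 2 := by rw [ht, div_lt_iff₀ hη]; linarith
    obtain ⟨f, hf, hf0, hft⟩ := key (t⁻¹ • (y - x)) (by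
      rw [norm_smul, norm_inv, Real.norm_of_nonneg ht0.le, ht, inv_div, div_mul_cancel₀ _ hd.ne'])
      t ht0 (by linarith)
    rw [smul_smul, mul_inv_cancel₀ ht0.ne', one_smul, add_sub_cancel] at hft
    have := kd_le (KChain.single f 0 t hf (by simp) (by
      rw [mem_ball_zero_iff, Complex.norm_real, Real.norm_of_nonneg ht0.le]; linarith))
    rw [hf0, hft, poincareDist_zero ht0.le] at this
    refine this.trans (ENNReal.ofReal_le_ofReal ((arctanh_le ht0.le ht1.le).trans (le_of_eq ?_)))
    rw [norm_sub_rev x y, ht]; ring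

theorem deriv_nonneg_of_right {φ : ℝ → ℝ} {c : ℝ} (h : HasDerivAt φ c 0) (h0 : φ 0 = 0)
    (hp : ∀ᶠ x in 𝓝[>] (0:ℝ), 0 ≤ φ x) : 0 ≤ c := by
  have h1 : Tendsto (slope φ 0) (𝓝[>] 0) (𝓝 c) :=
    (hasDerivAt_iff_tendsto_slope.1 h).mono_left
      (nhdsWithin_mono _ (fun x hx => ne_of_gt hx))
  refine ge_of_tendsto h1 ?_
  filter_upwards [hp, self_mem_nhdsWithin] with x hx hx0
  rw [slope_def_field, h0, sub_zero, sub_zero]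
  exact div_nonneg hx (le_of_lt hx0)

theorem hasDerivAt_norm_zero {E : Type*} [NormedAddCommGroup E] [NormedSpace ℝ E] {k : ℝ → E}
    (h : HasDerivAt k 0 0) (h0 : k 0 = 0) : HasDerivAt (fun x => ‖k x‖) 0 0 := by
  rw [hasDerivAt_iff_isLittleO] at h ⊢
  simp only [h0, smul_zero, sub_zero, norm_zero] at h ⊢
  exact h.norm_left

theorem hasDerivAt_arctanh {x : ℝ} (h1 : -1 < x) (h2 : x < 1) :
    HasDerivAt arctanh (1 / (1 - x ^ 2)) x := by
  have h3 : 1 - x ≠ 0 := by linarith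
  have h4 : 1 + x ≠ 0 := by linarith
  have h5 : 1 - x ^ 2 ≠ 0 := by
    have : 1 - x ^ 2 = (1 - x) * (1 + x) := by ring
    rw [this]; exact mul_ne_zero h3 h4
  have := ((((hasDerivAt_id x).const_add 1).div ((hasDerivAt_id x).const_sub 1) h3).log
    (div_ne_zero h4 h3)).const_mul (1 / 2)
  refine HasDerivAt.congr_deriv (f := arctanh) this ?_
  simp only [id, Pi.div_apply]
  field_simp
  ring

theorem pd_deriv {n : ℕ} {Ω : Set (Cn n)} {J : Cn n → (Cn n →L[ℝ] Cn n)} {q p0 : Cn n}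
    {ε C : ℝ} (hC : 0 ≤ C)
    (hloc : ∀ x ∈ ball q ε, ∀ y ∈ ball q ε, kobayashiDist n Ω J x y ≤ ENNReal.ofReal (C * ‖x - y‖))
    {γ : ℝ → Cn n} {s : ℝ} (hγ : DifferentiableAt ℝ γ s) (hs : γ s ∈ ball q ε)
    (hfin : kobayashiDist n Ω J p0 (γ s) ≠ ⊤)
    (hg : DifferentiableAt ℝ (fun x => (kobayashiDist n Ω J p0 (γ x)).toReal) s) :
    ENNReal.ofReal (deriv (fun x => (kobayashiDist n Ω J p0 (γ x)).toReal) s) ≤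
      kobayashiRoyden n Ω J (γ s) (deriv γ s) := by
  set g := fun x => (kobayashiDist n Ω J p0 (γ x)).toReal with hgd
  rw [kobayashiRoyden]
  refine le_sInf ?_
  rintro c ⟨r, hr, ⟨f, hf, hf0, hf1⟩, rfl⟩
  apply ENNReal.ofReal_le_ofReal
  rw [← sub_nonneg]
  have hfd : HasFDerivAt f (fderiv ℝ f 0) (0:ℂ) := (hf.2 0 (by simp)).1.hasFDerivAt
  have hl : HasDerivAt (fun h : ℝ => ((h / r : ℝ) : ℂ)) ((1 / r : ℝ) : ℂ) 0 :=
    ((hasDerivAt_id (0:ℝ)).div_const r).ofReal_comp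
  have hk1 : HasDerivAt (fun h : ℝ => f ((h / r : ℝ) : ℂ)) (deriv γ s) 0 := by
    have h0 : ((0 / r : ℝ) : ℂ) = 0 := by simp
    have hfd' : HasFDerivAt f (fderiv ℝ f 0) (((0 / r : ℝ) : ℂ)) := by rw [h0]; exact hfd
    have := HasFDerivAt.comp_hasDerivAt (f := fun h : ℝ => ((h / r : ℝ) : ℂ)) (0:ℝ) hfd' hl
    refine this.congr_deriv ?_
    have e : ((1 / r : ℝ) : ℂ) = (1 / r) • (1:ℂ) := by rw [Complex.real_smul, mul_one]
    rw [e, map_smul, hf1, smul_smul, one_div, inv_mul_cancel₀ hr.ne', one_smul]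
  have hk2 : HasDerivAt (fun h : ℝ => γ (s + h)) (deriv γ s) 0 := by
    apply HasDerivAt.comp_const_add
    rw [add_zero]; exact hγ.hasDerivAt
  have hk := hk1.sub hk2
  rw [sub_self] at hk
  have hkn := hasDerivAt_norm_zero hk (by simp [hf0])
  have hg' : HasDerivAt (fun h : ℝ => g (s + h)) (deriv g s) 0 := by
    apply HasDerivAt.comp_const_add
    rw [add_zero]; exact hg.hasDerivAt
  have ha : HasDerivAt (fun h : ℝ => arctanh (h / r)) (1 / r) 0 := by
    have h0 : HasDerivAt arctanh (1 / (1 - (0 / r) ^ 2)) (0 / r) :=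
      hasDerivAt_arctanh (by simp) (by simp)
    have := h0.comp (0:ℝ) ((hasDerivAt_id (0:ℝ)).div_const r)
    refine HasDerivAt.congr_deriv (f := fun h : ℝ => arctanh (h / r)) this ?_
    simp
  have hφ := (ha.add (hkn.const_mul C)).sub (hg'.sub_const (g s))
  have hd := deriv_nonneg_of_right hφ (by simp [hf0, arctanh]) ?_
  · simpa using hd
  · have c1 : ∀ᶠ h in 𝓝 (0:ℝ), f ((h / r : ℝ) : ℂ) ∈ ball q ε :=
      hk1.continuousAt.preimage_mem_nhds (by simpa [hf0] using isOpen_ball.mem_nhds hs)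
    have c2 : ∀ᶠ h in 𝓝 (0:ℝ), γ (s + h) ∈ ball q ε :=
      hk2.continuousAt.preimage_mem_nhds (by simpa using isOpen_ball.mem_nhds hs)
    have c3 : ∀ᶠ h in 𝓝 (0:ℝ), h < r := gt_mem_nhds hr
    filter_upwards [nhdsWithin_le_nhds c1, nhdsWithin_le_nhds c2, nhdsWithin_le_nhds c3,
      self_mem_nhdsWithin] with h h1 h2 h3 h4
    have hh : 0 < h := h4
    have hr1 : 0 ≤ h / r := by positivity
    have d1 := kd_le (KChain.single f 0 ((h / r : ℝ) : ℂ) hf (by simp) (by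
      rw [mem_ball_zero_iff, Complex.norm_real, Real.norm_of_nonneg hr1, div_lt_one hr]; exact h3))
    rw [hf0, poincareDist_zero hr1] at d1
    have d2 := hloc _ h1 _ h2
    have d3 := kd_triangle (Ω := Ω) (J := J) p0 (γ s) (γ (s + h))
    have d4 := kd_triangle (Ω := Ω) (J := J) (γ s) (f ((h / r : ℝ) : ℂ)) (γ (s + h))
    have n1 := arctanh_nonneg hr1
    have n2 : 0 ≤ C * ‖f ((h / r : ℝ) : ℂ) - γ (s + h)‖ := by positivity
    have d5 : kobayashiDist n Ω J p0 (γ (s + h)) ≤ ENNReal.ofReal (g s +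
        (arctanh (h / r) + C * ‖f ((h / r : ℝ) : ℂ) - γ (s + h)‖)) := by
      rw [ENNReal.ofReal_add ENNReal.toReal_nonneg (by positivity), ENNReal.ofReal_add n1 n2,
        ENNReal.ofReal_toReal hfin]
      exact d3.trans (add_le_add le_rfl (d4.trans (add_le_add d1 d2)))
    have d6 := ENNReal.toReal_mono ENNReal.ofReal_ne_top d5
    rw [ENNReal.toReal_ofReal (add_nonneg ENNReal.toReal_nonneg (by positivity))] at d6
    simp only [Pi.add_apply, Pi.sub_apply]
    change 0 ≤ arctanh (h / r) + C * ‖f ((h / r : ℝ) : ℂ) - γ (s + h)‖ - (g (s + h) - g s)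
    change g (s + h) ≤ _ at d6
    linarith

theorem ofReal_integral_le {α : Type*} [MeasurableSpace α] {μ : MeasureTheory.Measure α}
    {f : α → ℝ} (hf : MeasureTheory.Integrable f μ) :
    ENNReal.ofReal (∫ x, f x ∂μ) ≤ ∫⁻ x, ENNReal.ofReal (f x) ∂μ := by
  have h1 : ∫ x, f x ∂μ ≤ ∫ x, max (f x) 0 ∂μ :=
    MeasureTheory.integral_mono hf hf.pos_part fun x => le_max_left _ _
  refine (ENNReal.ofReal_le_ofReal h1).trans ?_
  rw [MeasureTheory.ofReal_integral_eq_lintegral_ofReal hf.pos_part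
    (Eventually.of_forall fun x => le_max_right _ _)]
  refine MeasureTheory.lintegral_mono fun x => ?_
  simp

theorem kd_self {n : ℕ} {Ω : Set (Cn n)} (hΩ : IsOpen Ω) {J : Cn n → (Cn n →L[ℝ] Cn n)}
    (hJ : IsAlmostComplexOn n Ω J) {p : Cn n} (hp : p ∈ Ω) : kobayashiDist n Ω J p p = 0 := by
  obtain ⟨ε, hε, C, hC, h⟩ := kd_local hΩ hJ hp
  have := h p (by simpa using hε) p (by simpa using hε)
  simpa using this

theorem pd_local {n : ℕ} {Ω : Set (Cn n)} (hΩ : IsOpen Ω) {J : Cn n → (Cn n →L[ℝ] Cn n)}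
    (hJ : IsAlmostComplexOn n Ω J) {q : Cn n} {ε C : ℝ} (hC : 0 ≤ C)
    (hloc : ∀ x ∈ ball q ε, ∀ y ∈ ball q ε, kobayashiDist n Ω J x y ≤ ENNReal.ofReal (C * ‖x - y‖))
    {γ : ℝ → Cn n} {a b : ℝ} (hab : a ≤ b) (hγ : ContDiffOn ℝ 1 γ (Icc a b))
    (hγB : MapsTo γ (Icc a b) (ball q ε)) :
    kobayashiDist n Ω J (γ a) (γ b) ≤
      ∫⁻ t in Ioc a b, kobayashiRoyden n Ω J (γ t) (deriv γ t) := by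
  set g := fun x => (kobayashiDist n Ω J (γ a) (γ x)).toReal with hgd
  have haI : a ∈ Icc a b := ⟨le_rfl, hab⟩
  have hbI : b ∈ Icc a b := ⟨hab, le_rfl⟩
  have hfin : ∀ s ∈ Icc a b, kobayashiDist n Ω J (γ a) (γ s) ≠ ⊤ := fun s hs =>
    ((hloc _ (hγB haI) _ (hγB hs)).trans_lt ENNReal.ofReal_lt_top).ne
  obtain ⟨L, hL⟩ := hγ.exists_lipschitzOnWith (by simp) (convex_Icc a b) isCompact_Icc
  have hgle : ∀ s ∈ Icc a b, ∀ s' ∈ Icc a b, g s ≤ g s' + C * L * dist s s' := by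
    intro s hs s' hs'
    have h1 := kd_triangle (Ω := Ω) (J := J) (γ a) (γ s') (γ s)
    have h2 := hloc _ (hγB hs') _ (hγB hs)
    have h3 : C * ‖γ s' - γ s‖ ≤ C * L * dist s s' := by
      rw [mul_assoc, dist_comm s s', ← dist_eq_norm]
      exact mul_le_mul_of_nonneg_left (hL.dist_le_mul _ hs' _ hs) hC
    have h4 : kobayashiDist n Ω J (γ a) (γ s) ≤ ENNReal.ofReal (g s' + C * L * dist s s') := by
      rw [ENNReal.ofReal_add ENNReal.toReal_nonneg (by positivity),
        ENNReal.ofReal_toReal (hfin s' hs')]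
      exact h1.trans (add_le_add le_rfl (h2.trans (ENNReal.ofReal_le_ofReal h3)))
    have h5 := ENNReal.toReal_mono ENNReal.ofReal_ne_top h4
    rwa [ENNReal.toReal_ofReal (add_nonneg ENNReal.toReal_nonneg (by positivity))] at h5
  have hgL : LipschitzOnWith (Real.toNNReal C * L) g (uIcc a b) := by
    rw [uIcc_of_le hab]
    refine LipschitzOnWith.of_le_add_mul _ fun s hs s' hs' => ?_
    rw [NNReal.coe_mul, Real.coe_toNNReal C hC]
    exact hgle s hs s' hs'
  have hAC := hgL.absolutelyContinuousOnInterval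
  have hint := hAC.integral_deriv_eq_sub
  have hii := hAC.intervalIntegrable_deriv
  have hga : g a = 0 := by
    have := hloc _ (hγB haI) _ (hγB haI)
    simp only [sub_self, norm_zero, mul_zero, ENNReal.ofReal_zero, nonpos_iff_eq_zero] at this
    simp [hgd, this]
  rw [hga, sub_zero, intervalIntegral.integral_of_le hab] at hint
  rw [intervalIntegrable_iff_integrableOn_Ioc_of_le hab] at hii
  rw [← ENNReal.ofReal_toReal (hfin b hbI)]
  change ENNReal.ofReal (g b) ≤ _
  rw [← hint]
  refine (ofReal_integral_le hii).trans ?_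
  rw [← MeasureTheory.restrict_Ioo_eq_restrict_Ioc]
  refine MeasureTheory.setLIntegral_mono' measurableSet_Ioo fun s hs => ?_
  have hsI := Ioo_subset_Icc_self hs
  by_cases hd : DifferentiableAt ℝ g s
  · exact pd_deriv hC hloc ((hγ.differentiableOn (by simp)).differentiableAt
      (Icc_mem_nhds hs.1 hs.2)) (hγB hsI) (hfin s hsI) hd
  · rw [deriv_zero_of_not_differentiableAt hd]; simp

theorem pd_add {n : ℕ} {Ω : Set (Cn n)} {J : Cn n → (Cn n →L[ℝ] Cn n)} {γ : ℝ → Cn n}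
    {a b c : ℝ} (hab : a ≤ b) (hbc : b ≤ c)
    (h1 : kobayashiDist n Ω J (γ a) (γ b) ≤
      ∫⁻ t in Ioc a b, kobayashiRoyden n Ω J (γ t) (deriv γ t))
    (h2 : kobayashiDist n Ω J (γ b) (γ c) ≤
      ∫⁻ t in Ioc b c, kobayashiRoyden n Ω J (γ t) (deriv γ t)) :
    kobayashiDist n Ω J (γ a) (γ c) ≤
      ∫⁻ t in Ioc a c, kobayashiRoyden n Ω J (γ t) (deriv γ t) := by
  rw [← Ioc_union_Ioc_eq_Ioc hab hbc, MeasureTheory.lintegral_union measurableSet_Ioc]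
  · exact (kd_triangle _ _ _).trans (add_le_add h1 h2)
  · rw [Set.disjoint_left]
    intro x hx hx'
    exact absurd hx'.1 (not_lt.2 hx.2)

theorem pd_smooth {n : ℕ} {Ω : Set (Cn n)} (hΩ : IsOpen Ω) {J : Cn n → (Cn n →L[ℝ] Cn n)}
    (hJ : IsAlmostComplexOn n Ω J)
    {γ : ℝ → Cn n} {a b : ℝ} (hab : a ≤ b) (hγ : ContDiffOn ℝ 1 γ (Icc a b))
    (hγB : MapsTo γ (Icc a b) Ω) :
    kobayashiDist n Ω J (γ a) (γ b) ≤
      ∫⁻ t in Ioc a b, kobayashiRoyden n Ω J (γ t) (deriv γ t) := by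
  have hloc : ∀ x : Icc a b, ∃ ε > 0, ∃ C : ℝ, 0 ≤ C ∧ ∀ y ∈ ball (γ x) ε, ∀ z ∈ ball (γ x) ε,
      kobayashiDist n Ω J y z ≤ ENNReal.ofReal (C * ‖y - z‖) := fun x =>
    kd_local hΩ hJ (hγB x.2)
  choose ε hε C hC hloc using hloc
  have hcont : Continuous (fun x : Icc a b => γ x) :=
    continuousOn_iff_continuous_domRestrict.1 hγ.continuousOn
  obtain ⟨t, ht0, htm, ⟨m, hm⟩, ht⟩ := exists_monotone_Icc_subset_open_cover_Icc hab
    (c := fun x : Icc a b => (fun y : Icc a b => γ y) ⁻¹' ball (γ x) (ε x))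
    (fun x => isOpen_ball.preimage hcont)
    (fun x _ => mem_iUnion.2 ⟨x, by simpa using hε x⟩)
  have key : ∀ k, kobayashiDist n Ω J (γ a) (γ (t k)) ≤
      ∫⁻ s in Ioc a (t k), kobayashiRoyden n Ω J (γ s) (deriv γ s) := by
    intro k
    induction k with
    | zero => rw [ht0, kd_self hΩ hJ (hγB ⟨le_rfl, hab⟩)]; exact zero_le
    | succ k ih =>
      obtain ⟨x, hx⟩ := ht k
      have hle : (t k : ℝ) ≤ t (k+1) := htm (Nat.le_succ k)
      refine pd_add (t k).2.1 hle ih ?_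
      refine pd_local hΩ hJ (hC x) (hloc x) hle
        (hγ.mono (Icc_subset_Icc (t k).2.1 (t (k+1)).2.2)) fun y hy => ?_
      have hy' : (⟨y, (t k).2.1.trans hy.1, hy.2.trans (t (k+1)).2.2⟩ : Icc a b) ∈
        Icc (t k) (t (k+1)) := ⟨hy.1, hy.2⟩
      have := hx hy'
      exact this
  have := key m
  rwa [hm m le_rfl] at this

theorem pd_main {n : ℕ} {Ω : Set (Cn n)} (hΩ : IsOpen Ω) {J : Cn n → (Cn n →L[ℝ] Cn n)}
    (hJ : IsAlmostComplexOn n Ω J) (p q : Cn n) :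
    kobayashiDist n Ω J p q ≤ integratedKRDist n Ω J p q := by
  rw [integratedKRDist]
  refine le_iInf ?_
  rintro ⟨γ, ⟨hγc, hγm, k, t, htm, ht0, ht1, hγ⟩, rfl, rfl⟩
  rw [kobayashiRoydenLength]
  have hpos : ∀ i, 0 ≤ t i := fun i => by rw [← ht0]; exact htm.monotone (Fin.zero_le i)
  have hle1 : ∀ i, t i ≤ 1 := fun i => by rw [← ht1]; exact htm.monotone (Fin.le_last i)
  have key : ∀ i : Fin (k+1), kobayashiDist n Ω J (γ 0) (γ (t i)) ≤
      ∫⁻ s in Ioc 0 (t i), kobayashiRoyden n Ω J (γ s) (deriv γ s) := by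
    intro i
    induction i using Fin.induction with
    | zero => rw [ht0, kd_self hΩ hJ (hγm ⟨le_rfl, zero_le_one⟩)]; exact zero_le
    | succ i ih =>
      have hle : t i.castSucc ≤ t i.succ := htm.monotone (Fin.castSucc_lt_succ).le
      exact pd_add (hpos _) hle ih (pd_smooth hΩ hJ hle (hγ i)
        (hγm.mono_left (Icc_subset_Icc (hpos _) (hle1 _))))
  have := key (Fin.last k)
  rw [ht1] at this
  exact this.trans (MeasureTheory.lintegral_mono_set Ioc_subset_Icc_self)

theorem moebius_lt {a u : ℂ} (ha : ‖a‖ < 1) (hu : ‖u‖ < 1) :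
    ‖u + a‖ < ‖1 + (starRingEnd ℂ) a * u‖ := by
  have h1 : 0 < (1 - Complex.normSq a) * (1 - Complex.normSq u) := by
    rw [Complex.normSq_eq_norm_sq, Complex.normSq_eq_norm_sq]
    have := norm_nonneg a
    have := norm_nonneg u
    apply mul_pos <;> nlinarith
  have h2 : Complex.normSq (1 + (starRingEnd ℂ) a * u) - Complex.normSq (u + a) =
      (1 - Complex.normSq a) * (1 - Complex.normSq u) := by
    simp only [Complex.normSq_apply, Complex.add_re, Complex.add_im, Complex.mul_re, Complex.mul_im,
      Complex.conj_re, Complex.conj_im, Complex.one_re, Complex.one_im]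
    ring
  rw [← h2, sub_pos, Complex.normSq_eq_norm_sq, Complex.normSq_eq_norm_sq] at h1
  exact lt_of_pow_lt_pow_left₀ 2 (norm_nonneg _) h1

theorem jhol_comp {n : ℕ} {Ω : Set (Cn n)} {J : Cn n → (Cn n →L[ℝ] Cn n)} {f : ℂ → Cn n}
    (hf : IsJHolomorphicOn n Ω J 1 f) {τ : ℂ → ℂ} (hm : MapsTo τ (ball (0:ℂ) 1) (ball (0:ℂ) 1))
    (hτ : ∀ z ∈ ball (0:ℂ) 1, DifferentiableAt ℂ τ z) :
    IsJHolomorphicOn n Ω J 1 (fun z => f (τ z)) ∧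
      ∀ z ∈ ball (0:ℂ) 1, ∀ ξ, fderiv ℝ (fun z => f (τ z)) z ξ = fderiv ℝ f (τ z) (deriv τ z * ξ) := by
  have hd : ∀ z ∈ ball (0:ℂ) 1, HasFDerivAt (fun z => f (τ z))
      ((fderiv ℝ f (τ z)).comp ((fderiv ℂ τ z).restrictScalars ℝ)) z := fun z hz =>
    (hf.2 (τ z) (hm hz)).1.hasFDerivAt.comp z ((hτ z hz).hasFDerivAt.restrictScalars ℝ)
  have hd2 : ∀ z ∈ ball (0:ℂ) 1, ∀ ξ, fderiv ℝ (fun z => f (τ z)) z ξ =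
      fderiv ℝ f (τ z) (deriv τ z * ξ) := by
    intro z hz ξ
    rw [(hd z hz).fderiv]
    simp [fderiv_eq_smul_deriv, mul_comm]
  refine ⟨⟨fun z hz => hf.1 (hm hz), fun z hz => ⟨(hd z hz).differentiableAt, fun ξ => ?_⟩⟩, hd2⟩
  rw [hd2 z hz, hd2 z hz, ← (hf.2 (τ z) (hm hz)).2]
  congr 1; ring

theorem jhol_moebius {n : ℕ} {Ω : Set (Cn n)} {J : Cn n → (Cn n →L[ℝ] Cn n)} {f : ℂ → Cn n}
    (hf : IsJHolomorphicOn n Ω J 1 f) {a c : ℂ} (ha : ‖a‖ < 1) (hc : ‖c‖ = 1) :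
    IsJHolomorphicOn n Ω J 1 (fun z => f ((c * z + a) / (1 + (starRingEnd ℂ) a * (c * z)))) ∧
    fderiv ℝ (fun z => f ((c * z + a) / (1 + (starRingEnd ℂ) a * (c * z)))) 0 1 =
      fderiv ℝ f a (c * (1 - ‖a‖ ^ 2 : ℝ)) := by
  have hcz : ∀ z ∈ ball (0:ℂ) 1, ‖c * z‖ < 1 := fun z hz => by
    rw [norm_mul, hc, one_mul]; simpa using hz
  have hlt : ∀ z ∈ ball (0:ℂ) 1, ‖c * z + a‖ < ‖1 + (starRingEnd ℂ) a * (c * z)‖ := fun z hz =>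
    moebius_lt ha (hcz z hz)
  have hne : ∀ z ∈ ball (0:ℂ) 1, 1 + (starRingEnd ℂ) a * (c * z) ≠ 0 := fun z hz h => by
    have := hlt z hz
    rw [h, norm_zero] at this
    exact absurd this (not_lt.2 (norm_nonneg _))
  have hm : MapsTo (fun z => (c * z + a) / (1 + (starRingEnd ℂ) a * (c * z)))
      (ball (0:ℂ) 1) (ball (0:ℂ) 1) := fun z hz => by
    rw [mem_ball_zero_iff, norm_div, div_lt_one (norm_pos_iff.2 (hne z hz))]
    exact hlt z hz
  have hder : ∀ z ∈ ball (0:ℂ) 1, HasDerivAt (fun z => (c * z + a) / (1 + (starRingEnd ℂ) a * (c * z)))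
      (((c * 1) * (1 + (starRingEnd ℂ) a * (c * z)) - (c * z + a) * ((starRingEnd ℂ) a * (c * 1))) /
        (1 + (starRingEnd ℂ) a * (c * z)) ^ 2) z := fun z hz =>
    (((hasDerivAt_id z).const_mul c).add_const a).div
      ((((hasDerivAt_id z).const_mul c).const_mul ((starRingEnd ℂ) a)).const_add 1) (hne z hz)
  obtain ⟨h1, h2⟩ := jhol_comp hf hm (fun z hz => (hder z hz).differentiableAt)
  refine ⟨h1, ?_⟩
  have h0 : (0:ℂ) ∈ ball (0:ℂ) 1 := by simp
  rw [h2 0 h0, (hder 0 h0).deriv]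
  simp only [mul_zero, zero_add, add_zero, div_one, mul_one, one_pow]
  congr 1
  push_cast
  rw [← Complex.mul_conj']
  ring

theorem kr_disc {n : ℕ} {Ω : Set (Cn n)} {J : Cn n → (Cn n →L[ℝ] Cn n)} {f : ℂ → Cn n}
    (hf : IsJHolomorphicOn n Ω J 1 f) {ρ c : ℝ} (h0 : 0 ≤ ρ) (h1 : ρ < 1) (hc : 0 ≤ c) :
    kobayashiRoyden n Ω J (f ρ) (c • fderiv ℝ f ρ 1) ≤ ENNReal.ofReal (c / (1 - ρ ^ 2)) := by
  have hρ : ‖(ρ:ℂ)‖ = ρ := by rw [Complex.norm_real, Real.norm_of_nonneg h0]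
  have hρ2 : 0 < 1 - ρ ^ 2 := by nlinarith
  rw [kobayashiRoyden]
  rcases hc.eq_or_lt with rfl | hc
  · have hρm : (ρ:ℂ) ∈ ball (0:ℂ) 1 := by rw [mem_ball_zero_iff, hρ]; exact h1
    have hcst : IsJHolomorphicOn n Ω J 1 (fun _ => f ρ) :=
      ⟨fun z _ => hf.1 hρm, fun z _ => ⟨differentiableAt_const _, fun ξ => by simp⟩⟩
    rw [zero_div, ENNReal.ofReal_zero]
    refine le_of_forall_gt fun b hb => ?_
    obtain ⟨x, -, hx0, hxb⟩ := ENNReal.lt_iff_exists_real_btwn.1 hb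
    have hx : 0 < x := by simpa using hx0
    refine lt_of_le_of_lt (sInf_le ⟨x⁻¹, inv_pos.2 hx, ⟨_, hcst, rfl, by simp⟩, rfl⟩) ?_
    simpa using hxb
  · obtain ⟨g1, g2⟩ := jhol_moebius hf (a := ρ) (c := 1) (by rw [hρ]; exact h1) (by simp)
    refine sInf_le ⟨(1 - ρ ^ 2) / c, by positivity, ⟨_, g1, by simp, ?_⟩, by rw [one_div_div]⟩
    rw [g2, hρ, one_mul, smul_smul, div_mul_cancel₀ _ hc.ne']
    have : ((1 - ρ ^ 2 : ℝ) : ℂ) = (1 - ρ ^ 2) • (1:ℂ) := by rw [Complex.real_smul, mul_one]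
    rw [this, map_smul]

theorem disc_normalize {n : ℕ} {Ω : Set (Cn n)} {J : Cn n → (Cn n →L[ℝ] Cn n)} {f : ℂ → Cn n}
    (hf : IsJHolomorphicOn n Ω J 1 f) {z w : ℂ} (hz : z ∈ ball (0:ℂ) 1) (hw : w ∈ ball (0:ℂ) 1) :
    ∃ g : ℂ → Cn n, ∃ r : ℝ, 0 ≤ r ∧ r < 1 ∧ IsJHolomorphicOn n Ω J 1 g ∧ g 0 = f z ∧ g r = f w ∧
      poincareDist z w = arctanh r := by
  rw [mem_ball_zero_iff] at hz hw
  set u : ℂ := (w - z) / (1 - (starRingEnd ℂ) z * w) with hu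
  have hlt : ‖w - z‖ < ‖1 - (starRingEnd ℂ) z * w‖ := by
    have := moebius_lt (a := -z) (u := w) (by simpa using hz) hw
    simpa [sub_eq_add_neg] using this
  have hpos : 0 < ‖1 - (starRingEnd ℂ) z * w‖ := (norm_nonneg _).trans_lt hlt
  have hne : 1 - (starRingEnd ℂ) z * w ≠ 0 := norm_pos_iff.1 hpos
  have hur : ‖u‖ < 1 := by rw [hu, norm_div, div_lt_one hpos]; exact hlt
  obtain ⟨c, hc, hcu⟩ : ∃ c : ℂ, ‖c‖ = 1 ∧ c * (‖u‖ : ℝ) = u := by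
    rcases eq_or_ne u 0 with h | h
    · exact ⟨1, by simp, by simp [h]⟩
    · have hn : (‖u‖ : ℂ) ≠ 0 := by simpa using h
      exact ⟨u / ‖u‖, by simp [h], by field_simp⟩
  refine ⟨_, ‖u‖, norm_nonneg _, hur, (jhol_moebius hf hz hc).1, by simp, ?_, ?_⟩
  · show f _ = f w
    rw [hcu]
    congr 1
    have h2 : 1 + (starRingEnd ℂ) z * u ≠ 0 := by
      intro h
      have := moebius_lt hz hur
      rw [h, norm_zero] at this
      exact absurd this (not_lt.2 (norm_nonneg _))
    have hu' : u * (1 - (starRingEnd ℂ) z * w) = w - z := div_mul_cancel₀ _ hne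
    rw [div_eq_iff h2]
    linear_combination hu'
  · rw [poincareDist, hu, norm_div, norm_sub_rev]

def PWP (n : ℕ) (γ : ℝ → Cn n) (a b : ℝ) : Prop :=
  ∃ (k : ℕ) (t : Fin (k + 1) → ℝ), StrictMono t ∧ t 0 = a ∧ t (Fin.last k) = b ∧
      ∀ i : Fin k, ContDiffOn ℝ 1 γ (Icc (t i.castSucc) (t i.succ))

theorem PWP.single {n : ℕ} {γ : ℝ → Cn n} {a b : ℝ} (hab : a < b)
    (h : ContDiffOn ℝ 1 γ (Icc a b)) : PWP n γ a b := by
  refine ⟨1, ![a, b], ?_, rfl, rfl, ?_⟩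
  · rw [Fin.strictMono_iff_lt_succ]
    intro i; fin_cases i; simpa using hab
  · intro i; fin_cases i; simpa using h

theorem PWP.cons {n : ℕ} {γ : ℝ → Cn n} {a m b : ℝ} (ham : a < m)
    (h : ContDiffOn ℝ 1 γ (Icc a m)) (hP : PWP n γ m b) : PWP n γ a b := by
  obtain ⟨k, t, h1, h2, h3, h4⟩ := hP
  refine ⟨k + 1, Fin.cons a t, ?_, by simp, ?_, ?_⟩
  · rw [Fin.strictMono_iff_lt_succ]
    intro i
    refine Fin.cases ?_ (fun j => ?_) i
    · simpa [h2] using ham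
    · rw [← Fin.succ_castSucc, Fin.cons_succ, Fin.cons_succ]
      exact h1 Fin.castSucc_lt_succ
  · rw [← Fin.succ_last, Fin.cons_succ, h3]
  · intro i
    refine Fin.cases ?_ (fun j => ?_) i
    · simpa [h2] using h
    · rw [← Fin.succ_castSucc, Fin.cons_succ, Fin.cons_succ]
      exact h4 j

theorem PWP.congr {n : ℕ} {γ γ' : ℝ → Cn n} {a b : ℝ} (h : PWP n γ a b)
    (he : EqOn γ' γ (Icc a b)) : PWP n γ' a b := by
  obtain ⟨k, t, h1, h2, h3, h4⟩ := h
  refine ⟨k, t, h1, h2, h3, fun i => (h4 i).congr fun x hx => he ?_⟩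
  have e1 : a ≤ t i.castSucc := by rw [← h2]; exact h1.monotone (Fin.zero_le _)
  have e2 : t i.succ ≤ b := by rw [← h3]; exact h1.monotone (Fin.le_last _)
  exact ⟨e1.trans hx.1, hx.2.trans e2⟩

def PathLen (n : ℕ) (Ω : Set (Cn n)) (J : Cn n → (Cn n →L[ℝ] Cn n)) (a b : ℝ) (p q : Cn n)
    (c : ℝ) : Prop := ∃ γ : ℝ → Cn n, PWP n γ a b ∧ ContinuousOn γ (Icc a b) ∧
      MapsTo γ (Icc a b) Ω ∧ γ a = p ∧ γ b = q ∧
      ∫⁻ t in Ioo a b, kobayashiRoyden n Ω J (γ t) (deriv γ t) ≤ ENNReal.ofReal c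

theorem disc_path {n : ℕ} {Ω : Set (Cn n)} (hΩ : IsOpen Ω) {J : Cn n → (Cn n →L[ℝ] Cn n)}
    (hJ : IsAlmostComplexOn n Ω J) {f : ℂ → Cn n}
    (hf : IsJHolomorphicOn n Ω J 1 f) {z w : ℂ} (hz : z ∈ ball (0:ℂ) 1) (hw : w ∈ ball (0:ℂ) 1)
    {a b : ℝ} (hab : a < b) : ∃ γ : ℝ → Cn n, ContDiffOn ℝ 1 γ (Icc a b) ∧
      MapsTo γ (Icc a b) Ω ∧ γ a = f z ∧ γ b = f w ∧
      ∫⁻ t in Ioo a b, kobayashiRoyden n Ω J (γ t) (deriv γ t) ≤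
        ENNReal.ofReal (poincareDist z w) := by
  obtain ⟨g, r, hr0, hr1, hg, hgz, hgw, hd⟩ := disc_normalize hf hz hw
  have hba : 0 < b - a := sub_pos.2 hab
  set c : ℝ := r / (b - a) with hc
  have hc0 : 0 ≤ c := by positivity
  set σ : ℝ → ℝ := fun s => c * (s - a) with hσ
  have hσb : σ b = r := by simp only [hσ, hc]; field_simp
  have hσd : ∀ s, HasDerivAt σ c s := fun s => by
    simpa using ((hasDerivAt_id s).sub_const a).const_mul c
  have hσ0 : ∀ s ∈ Icc a b, 0 ≤ σ s := fun s hs => mul_nonneg hc0 (sub_nonneg.2 hs.1)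
  have hσ1 : ∀ s ∈ Icc a b, σ s < 1 := fun s hs => by
    have : σ s ≤ σ b := mul_le_mul_of_nonneg_left (by linarith [hs.2]) hc0
    linarith
  have hσB : ∀ s ∈ Icc a b, ((σ s : ℝ) : ℂ) ∈ ball (0:ℂ) 1 := fun s hs => by
    rw [mem_ball_zero_iff, Complex.norm_real, Real.norm_of_nonneg (hσ0 s hs)]; exact hσ1 s hs
  have hσc : ContDiff ℝ 1 (fun s => ((σ s : ℝ) : ℂ)) :=
    Complex.ofRealCLM.contDiff.comp (contDiff_const.mul (contDiff_id.sub contDiff_const))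
  refine ⟨fun s => g (σ s), ?_, fun s hs => hg.1 (hσB s hs), ?_, ?_, ?_⟩
  · exact (pa_main hΩ hJ hg).comp hσc.contDiffOn (fun s hs => hσB s hs)
  · simp [hσ, hgz]
  · simp only [hσb, hgw]
  · rw [hd]
    have hder : ∀ s ∈ Icc a b, deriv (fun s => g (σ s)) s = c • fderiv ℝ g (σ s) 1 := by
      intro s hs
      have h1 : HasDerivAt (fun s => ((σ s : ℝ) : ℂ)) ((c : ℝ) : ℂ) s := (hσd s).ofReal_comp
      have h2 := HasFDerivAt.comp_hasDerivAt (f := fun s => ((σ s : ℝ) : ℂ)) s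
        (hg.2 _ (hσB s hs)).1.hasFDerivAt h1
      have h3 : HasDerivAt (fun s => g (σ s)) _ s := h2
      rw [h3.deriv]
      have : ((c : ℝ) : ℂ) = c • (1:ℂ) := by rw [Complex.real_smul, mul_one]
      rw [this, map_smul]
    have hpos : ∀ s ∈ Icc a b, 0 < 1 - σ s ^ 2 := fun s hs => by
      have := hσ0 s hs
      have := hσ1 s hs
      nlinarith
    have hle : ∫⁻ t in Ioo a b, kobayashiRoyden n Ω J (g (σ t)) (deriv (fun s => g (σ s)) t) ≤
        ∫⁻ t in Ioo a b, ENNReal.ofReal (c / (1 - σ t ^ 2)) := by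
      refine MeasureTheory.setLIntegral_mono' measurableSet_Ioo fun s hs => ?_
      have hs' := Ioo_subset_Icc_self hs
      rw [hder s hs']
      exact kr_disc hg (hσ0 s hs') (hσ1 s hs') hc0
    refine hle.trans (le_of_eq ?_)
    have hcont : ContinuousOn (fun s => c / (1 - σ s ^ 2)) (Icc a b) := by
      refine continuousOn_const.div ?_ (fun s hs => (hpos s hs).ne')
      exact (continuous_const.sub ((continuous_const.mul
        (continuous_id.sub continuous_const)).pow 2)).continuousOn
    have hi : MeasureTheory.IntegrableOn (fun s => c / (1 - σ s ^ 2)) (Ioo a b) :=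
      (hcont.integrableOn_compact isCompact_Icc).mono_set Ioo_subset_Icc_self
    rw [← MeasureTheory.ofReal_integral_eq_lintegral_ofReal hi]
    · congr 1
      rw [← MeasureTheory.integral_Ioc_eq_integral_Ioo, ← intervalIntegral.integral_of_le hab.le]
      rw [intervalIntegral.integral_eq_sub_of_hasDerivAt (f := fun s => arctanh (σ s))]
      · have hσa : σ a = 0 := by simp [hσ]
        show arctanh (σ b) - arctanh (σ a) = arctanh r
        rw [hσb, hσa]
        simp [arctanh]
      · intro s hs
        rw [uIcc_of_le hab.le] at hs
        have h1 := (hasDerivAt_arctanh (by linarith [hσ0 s hs]) (hσ1 s hs)).comp s (hσd s)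
        refine HasDerivAt.congr_deriv (f := fun s => arctanh (σ s)) h1 ?_
        ring
      · exact ContinuousOn.intervalIntegrable (by rwa [uIcc_of_le hab.le])
    · refine (MeasureTheory.ae_restrict_mem measurableSet_Ioo).mono fun s hs => ?_
      exact div_nonneg hc0 (hpos s (Ioo_subset_Icc_self hs)).le

theorem chain_path {n : ℕ} {Ω : Set (Cn n)} (hΩ : IsOpen Ω) {J : Cn n → (Cn n →L[ℝ] Cn n)}
    (hJ : IsAlmostComplexOn n Ω J) {p q : Cn n} {c : ℝ} (h : KChain n Ω J p q c) :
    ∀ a b : ℝ, a < b → PathLen n Ω J a b p q c := by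
  induction h with
  | single f z w hf hz hw =>
    intro a b hab
    obtain ⟨γ, h1, h2, h3, h4, h5⟩ := disc_path hΩ hJ hf hz hw hab
    exact ⟨γ, PWP.single hab h1, h1.continuousOn, h2, h3, h4, h5⟩
  | cons f z w hf hz hw q c hch ih =>
    intro a b hab
    obtain ⟨m, ham, hmb⟩ := exists_between hab
    obtain ⟨α, a1, a2, a3, a4, a5⟩ := disc_path hΩ hJ hf hz hw ham
    obtain ⟨β, b1, b2, b3, b4, b5, b6⟩ := ih m b hmb
    set γ : ℝ → Cn n := fun t => if t ≤ m then α t else β t with hγ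
    have e1 : EqOn γ α (Icc a m) := fun t ht => by simp only [hγ]; rw [if_pos ht.2]
    have e2 : EqOn γ β (Icc m b) := fun t ht => by
      simp only [hγ]
      split_ifs with h
      · have : t = m := le_antisymm h ht.1
        rw [this, a4, b4]
      · rfl
    have hu : Icc a b = Icc a m ∪ Icc m b := (Icc_union_Icc_eq_Icc ham.le hmb.le).symm
    have c1 : ContDiffOn ℝ 1 γ (Icc a m) := a1.congr e1
    refine ⟨γ, PWP.cons ham c1 (b1.congr e2), ?_, ?_, ?_, ?_, ?_⟩
    · rw [hu]
      exact c1.continuousOn.union_of_isClosed (b2.congr e2) isClosed_Icc isClosed_Icc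
    · intro t ht
      rw [hu] at ht
      rcases ht with ht | ht
      · rw [e1 ht]; exact a2 ht
      · rw [e2 ht]; exact b3 ht
    · rw [e1 ⟨le_rfl, ham.le⟩, a3]
    · rw [e2 ⟨hmb.le, le_rfl⟩, b5]
    · have s1 : ∫⁻ t in Ioo a m, kobayashiRoyden n Ω J (γ t) (deriv γ t) =
          ∫⁻ t in Ioo a m, kobayashiRoyden n Ω J (α t) (deriv α t) := by
        refine MeasureTheory.setLIntegral_congr_fun measurableSet_Ioo fun t ht => ?_
        have : γ =ᶠ[𝓝 t] α := by
          filter_upwards [Ioo_mem_nhds ht.1 ht.2] with x hx using e1 (Ioo_subset_Icc_self hx)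
        simp only [this.deriv_eq, this.eq_of_nhds]
      have s2 : ∫⁻ t in Ioo m b, kobayashiRoyden n Ω J (γ t) (deriv γ t) =
          ∫⁻ t in Ioo m b, kobayashiRoyden n Ω J (β t) (deriv β t) := by
        refine MeasureTheory.setLIntegral_congr_fun measurableSet_Ioo fun t ht => ?_
        have : γ =ᶠ[𝓝 t] β := by
          filter_upwards [Ioo_mem_nhds ht.1 ht.2] with x hx using e2 (Ioo_subset_Icc_self hx)
        simp only [this.deriv_eq, this.eq_of_nhds]
      rw [MeasureTheory.restrict_Ioo_eq_restrict_Ioc, ← Ioc_union_Ioc_eq_Ioc ham.le hmb.le]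
      refine (MeasureTheory.lintegral_union_le _ _ _).trans ?_
      rw [← MeasureTheory.restrict_Ioo_eq_restrict_Ioc, ← MeasureTheory.restrict_Ioo_eq_restrict_Ioc,
        s1, s2, ENNReal.ofReal_add (poincareDist_nonneg _ _) hch.nonneg]
      exact add_le_add a5 b6

theorem pc_main {n : ℕ} {Ω : Set (Cn n)} (hΩ : IsOpen Ω) {J : Cn n → (Cn n →L[ℝ] Cn n)}
    (hJ : IsAlmostComplexOn n Ω J) (p q : Cn n) :
    integratedKRDist n Ω J p q ≤ kobayashiDist n Ω J p q := by
  rw [kd_eq]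
  refine le_sInf ?_
  rintro c ⟨x, hx, rfl⟩
  obtain ⟨γ, h1, h2, h3, h4, h5, h6⟩ := chain_path hΩ hJ hx 0 1 zero_lt_one
  rw [integratedKRDist]
  refine (iInf_le _ ⟨γ, ⟨h2, h3, h1⟩, h4, h5⟩).trans ?_
  rw [kobayashiRoydenLength, ← MeasureTheory.restrict_Ioo_eq_restrict_Icc]
  exact h6

end Helpers

/-- on a connected `Ω` the Kobayashi pseudodistance coincides with the
integrated Kobayashi–Royden pseudodistance. -/
theorem kobayashiDist_eq_integratedKRDist
    (n : ℕ) (hn : 1 ≤ n) (Ω : Set (Cn n)) (hΩ : IsOpen Ω) (hconn : IsConnected Ω)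
    (J : Cn n → (Cn n →L[ℝ] Cn n)) (hJ : IsAlmostComplexOn n Ω J) :
    ∀ p ∈ Ω, ∀ q ∈ Ω, kobayashiDist n Ω J p q = integratedKRDist n Ω J p q := by
  intro p _ q _
  exact le_antisymm (pd_main hΩ hJ p q) (pc_main hΩ hJ p q)
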